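/- Let 1 < a ≤ b ≤ c ≤ ab. Then the Kronecker cone is exactly cut out by the Ressayre inequalities: C(a,b,c) = {(λ_A,λ_B,λ_C) ∈ ℝ^a × ℝ^b × ℝ^c : λ_A, λ_B, λ_C are each nonincreasing, Σλ_A = Σλ_B = Σλ_C, and ⟨(H,z), λ⟩ ≥ 0 for every Ressayre element (H,z)}. -/

import Mathlib

open scoped BigOperators

noncomputable section

/-- The reduced density matrix on the first subsystem. -/
def rhoA {a b c : ℕ} (ψ : Fin a × Fin b × Fin c → ℂ) : Matrix (Fin a) (Fin a) ℂ :=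
  Matrix.of fun i i' => ∑ j : Fin b, ∑ k : Fin c, ψ (i, j, k) * (starRingEnd ℂ) (ψ (i', j, k))

/-- The reduced density matrix on the second subsystem. -/
def rhoB {a b c : ℕ} (ψ : Fin a × Fin b × Fin c → ℂ) : Matrix (Fin b) (Fin b) ℂ :=
  Matrix.of fun j j' => ∑ i : Fin a, ∑ k : Fin c, ψ (i, j, k) * (starRingEnd ℂ) (ψ (i, j', k))

/-- The reduced density matrix on the third subsystem. -/
def rhoC {a b c : ℕ} (ψ : Fin a × Fin b × Fin c → ℂ) : Matrix (Fin c) (Fin c) ℂ :=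
  Matrix.of fun k k' => ∑ i : Fin a, ∑ j : Fin b, ψ (i, j, k) * (starRingEnd ℂ) (ψ (i, j, k'))

/-- `lam` is the vector of eigenvalues of `ρ`, listed in nonincreasing order
with multiplicity. -/
def IsSpecDown {n : ℕ} (ρ : Matrix (Fin n) (Fin n) ℂ) (lam : Fin n → ℝ) : Prop :=
  Antitone lam ∧ ∃ (hρ : ρ.IsHermitian) (σ : Equiv.Perm (Fin n)), lam = hρ.eigenvalues ∘ σ

/-- The Kronecker cone `C(a,b,c)`. -/
def KronCone (a b c : ℕ) : Set ((Fin a → ℝ) × (Fin b → ℝ) × (Fin c → ℝ)) :=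
  { lam | ∃ ψ : Fin a × Fin b × Fin c → ℂ,
      IsSpecDown (rhoA ψ) lam.1 ∧ IsSpecDown (rhoB ψ) lam.2.1 ∧ IsSpecDown (rhoC ψ) lam.2.2 }

/-- The pairing `⟨(H,z), λ⟩`. -/
def wtPair {a b c : ℕ} (HA : Fin a → ℝ) (HB : Fin b → ℝ) (HC : Fin c → ℝ) (z : ℝ)
    (lam : (Fin a → ℝ) × (Fin b → ℝ) × (Fin c → ℝ)) : ℝ :=
  (∑ i, HA i * lam.1 i) + (∑ j, HB j * lam.2.1 j) + (∑ k, HC k * lam.2.2 k)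
    + z * ∑ i, lam.1 i

/-- `H = (H_A, H_B, H_C)` is traceless. -/
def Traceless {a b c : ℕ} (HA : Fin a → ℝ) (HB : Fin b → ℝ) (HC : Fin c → ℝ) : Prop :=
  (∑ i, HA i) = 0 ∧ (∑ j, HB j) = 0 ∧ (∑ k, HC k) = 0

/-- `(H, z)` is a facet normal of the Kronecker cone `C(a,b,c)`. -/
def IsFacetNormal (a b c : ℕ) (HA : Fin a → ℝ) (HB : Fin b → ℝ) (HC : Fin c → ℝ)
    (z : ℝ) : Prop :=
  Traceless HA HB HC ∧ ¬(HA = 0 ∧ HB = 0 ∧ HC = 0 ∧ z = 0) ∧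
  (∀ lam ∈ KronCone a b c, 0 ≤ wtPair HA HB HC z lam) ∧
  Module.finrank ℝ
    (affineSpan ℝ {lam ∈ KronCone a b c | wtPair HA HB HC z lam = 0}).direction
    = a + b + c - 3

/-- `(H, z)` is a trivial (Weyl chamber) normal. -/
def IsTrivialNormal {a b c : ℕ} (HA : Fin a → ℝ) (HB : Fin b → ℝ) (HC : Fin c → ℝ)
    (z : ℝ) : Prop :=
  ∃ t : ℝ, 0 < t ∧
    ((∃ i i' : Fin a, i < i' ∧ HA = t • (Pi.single i 1 - Pi.single i' 1) ∧
        HB = 0 ∧ HC = 0 ∧ z = 0) ∨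
     (∃ j j' : Fin b, j < j' ∧ HB = t • (Pi.single j 1 - Pi.single j' 1) ∧
        HA = 0 ∧ HC = 0 ∧ z = 0) ∨
     (∃ k k' : Fin c, k < k' ∧ HC = t • (Pi.single k 1 - Pi.single k' 1) ∧
        HA = 0 ∧ HB = 0 ∧ z = 0))

/-- The subspace of vectors supported on coordinates satisfying `P`. -/
def suppSubmodule {ι : Type*} (P : ι → Prop) : Submodule ℂ (ι → ℂ) where
  carrier := {ψ | ∀ p, ¬ P p → ψ p = 0}
  add_mem' := by
    intro x y hx hy p hp
    simp only [Pi.add_apply, hx p hp, hy p hp, add_zero]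
  zero_mem' := by intro p _; rfl
  smul_mem' := by
    intro r x hx p hp
    simp only [Pi.smul_apply, hx p hp, smul_zero]

/-- The zero-weight space `ℋ₀(H,z)`. -/
def weight0Space {a b c : ℕ} (HA : Fin a → ℝ) (HB : Fin b → ℝ) (HC : Fin c → ℝ)
    (z : ℝ) : Submodule ℂ (Fin a × Fin b × Fin c → ℂ) :=
  suppSubmodule fun p => HA p.1 + HB p.2.1 + HC p.2.2 + z = 0

/-- The negative-weight space `ℋ₋(H,z)`. -/
def weightNegSpace {a b c : ℕ} (HA : Fin a → ℝ) (HB : Fin b → ℝ) (HC : Fin c → ℝ)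
    (z : ℝ) : Submodule ℂ (Fin a × Fin b × Fin c → ℂ) :=
  suppSubmodule fun p => HA p.1 + HB p.2.1 + HC p.2.2 + z < 0

/-- Strictly lower triangular matrices `X` with `X i' i = 0` unless
`i < i'` and `Hv i' < Hv i`. -/
def lowerMod {d : ℕ} (Hv : Fin d → ℝ) : Submodule ℂ (Matrix (Fin d) (Fin d) ℂ) where
  carrier := {X | ∀ i' i, ¬ (i < i' ∧ Hv i' < Hv i) → X i' i = 0}
  add_mem' := by
    intro X Y hX hY i' i h
    simp only [Matrix.add_apply, hX i' i h, hY i' i h, add_zero]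
  zero_mem' := by intro i' i h; rfl
  smul_mem' := by
    intro r X hX i' i h
    simp only [Matrix.smul_apply, hX i' i h, smul_zero]

/-- The nilpotent algebra `𝔫₋(H)`. -/
def nMinusMod {a b c : ℕ} (HA : Fin a → ℝ) (HB : Fin b → ℝ) (HC : Fin c → ℝ) :
    Submodule ℂ (Matrix (Fin a) (Fin a) ℂ × Matrix (Fin b) (Fin b) ℂ ×
      Matrix (Fin c) (Fin c) ℂ) :=
  (lowerMod HA).prod ((lowerMod HB).prod (lowerMod HC))

/-- The infinitesimal action `(X,Y,Z) ↦ (X⊗I⊗I + I⊗Y⊗I + I⊗I⊗Z)ψ`. -/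
def act {a b c : ℕ}
    (t : Matrix (Fin a) (Fin a) ℂ × Matrix (Fin b) (Fin b) ℂ × Matrix (Fin c) (Fin c) ℂ)
    (ψ : Fin a × Fin b × Fin c → ℂ) : Fin a × Fin b × Fin c → ℂ := fun p =>
  (∑ i', t.1 p.1 i' * ψ (i', p.2.1, p.2.2)) +
  (∑ j', t.2.1 p.2.1 j' * ψ (p.1, j', p.2.2)) +
  (∑ k', t.2.2 p.2.2 k' * ψ (p.1, p.2.1, k'))

/-- The action as a linear map in `(X,Y,Z)`. -/
def actL {a b c : ℕ} (ψ : Fin a × Fin b × Fin c → ℂ) :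
    (Matrix (Fin a) (Fin a) ℂ × Matrix (Fin b) (Fin b) ℂ × Matrix (Fin c) (Fin c) ℂ)
      →ₗ[ℂ] (Fin a × Fin b × Fin c → ℂ) where
  toFun t := act t ψ
  map_add' t s := by
    funext p
    simp only [act, Prod.fst_add, Prod.snd_add, Matrix.add_apply, add_mul,
      Finset.sum_add_distrib, Pi.add_apply]
    ring
  map_smul' r t := by
    funext p
    simp only [act, Prod.smul_fst, Prod.smul_snd, Matrix.smul_apply, smul_eq_mul,
      Pi.smul_apply, RingHom.id_apply, Finset.mul_sum, mul_assoc, mul_add]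

/-- The tangent map `T_ψ : 𝔫₋(H) → ℋ₋(H,z)` is a linear isomorphism. -/
def TangentIso {a b c : ℕ} (HA : Fin a → ℝ) (HB : Fin b → ℝ) (HC : Fin c → ℝ)
    (z : ℝ) (ψ : Fin a × Fin b × Fin c → ℂ) : Prop :=
  ∃ h : ∀ t ∈ nMinusMod HA HB HC, actL ψ t ∈ weightNegSpace HA HB HC z,
    Function.Bijective ((actL ψ).restrict h)

/-- The tangent map `T_ψ : 𝔫₋(H) → ℋ₋(H,z)` is surjective. -/
def TangentSurj {a b c : ℕ} (HA : Fin a → ℝ) (HB : Fin b → ℝ) (HC : Fin c → ℝ)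
    (z : ℝ) (ψ : Fin a × Fin b × Fin c → ℂ) : Prop :=
  ∃ h : ∀ t ∈ nMinusMod HA HB HC, actL ψ t ∈ weightNegSpace HA HB HC z,
    Function.Surjective ((actL ψ).restrict h)

/-- `(H,z)` is admissible: the hyperplane `⟨(H,z), ·⟩ = 0` in `V` is spanned by
the weights of zero `(H,z)`-weight. -/
def Admissible {a b c : ℕ} (HA : Fin a → ℝ) (HB : Fin b → ℝ) (HC : Fin c → ℝ)
    (z : ℝ) : Prop :=
  (Submodule.span ℝ
    { w : (Fin a → ℝ) × (Fin b → ℝ) × (Fin c → ℝ) |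
      ∃ i j k, HA i + HB j + HC k + z = 0 ∧
        w = (Pi.single i 1, Pi.single j 1, Pi.single k 1) } : Set _)
  = { lam | (∑ i, lam.1 i) = (∑ j, lam.2.1 j) ∧ (∑ i, lam.1 i) = (∑ k, lam.2.2 k) ∧
        wtPair HA HB HC z lam = 0 }

/-- `(H,z)` is a Ressayre element. -/
def IsRessayre {a b c : ℕ} (HA : Fin a → ℝ) (HB : Fin b → ℝ) (HC : Fin c → ℝ)
    (z : ℝ) : Prop :=
  Traceless HA HB HC ∧ ¬(HA = 0 ∧ HB = 0 ∧ HC = 0 ∧ z = 0) ∧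
  Admissible HA HB HC z ∧
  ∃ ψ ∈ weight0Space HA HB HC z, TangentIso HA HB HC z ψ

/-- `(H_A, H_B)` satisfies the extremal-edge condition. -/
def ExtremalEdge {a b : ℕ} (HA : Fin a → ℝ) (HB : Fin b → ℝ) : Prop :=
  (∑ i, HA i) = 0 ∧ (∑ j, HB j) = 0 ∧ ¬(HA = 0 ∧ HB = 0) ∧
  ∀ (x : Fin a → ℝ) (y : Fin b → ℝ), (∑ i, x i) = 0 → (∑ j, y j) = 0 →
    (∀ i j k l, HA i + HB j = HA k + HB l → x i + y j = x k + y l) →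
    ∃ t : ℝ, x = t • HA ∧ y = t • HB

section

/-- A complex polynomial vanishing on a nonempty open set is zero. -/
theorem mvPolynomial_eq_zero_of_eventually {τ : Type*} [Fintype τ] {f : MvPolynomial τ ℂ}
    {y₀ : τ → ℂ} (h : ∀ᶠ y in nhds y₀, MvPolynomial.eval y f = 0) : f = 0 := by
  obtain ⟨ε, hε, hb⟩ := Metric.eventually_nhds_iff_ball.1 h
  refine MvPolynomial.funext_set (fun t => Metric.ball (y₀ t) ε) (fun t => ?_) fun x hx => ?_
  · exact infinite_of_mem_nhds (y₀ t) (Metric.ball_mem_nhds _ hε)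
  · rw [map_zero]
    apply hb
    rw [ball_pi _ hε]
    exact hx

/-- A complex polynomial map whose range is a neighbourhood of some point has dense range. -/
theorem denseRange_eval_of_range_mem_nhds {σ τ : Type} [Finite σ] [Fintype τ]
    (P : τ → MvPolynomial σ ℂ) {y₀ : τ → ℂ}
    (h : Set.range (fun (x : σ → ℂ) t => MvPolynomial.eval x (P t)) ∈ nhds y₀) :
    DenseRange (fun (x : σ → ℂ) t => MvPolynomial.eval x (P t)) := by
  classical
  let φ : MvPolynomial τ ℂ →ₐ[ℂ] MvPolynomial σ ℂ := MvPolynomial.aeval P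
  have hφ : ∀ (x : σ → ℂ) q, MvPolynomial.eval x (φ q)
      = MvPolynomial.eval (fun t => MvPolynomial.eval x (P t)) q := by
    intro x q
    have : (MvPolynomial.aeval x).comp φ
        = MvPolynomial.aeval (R := ℂ) (fun t => MvPolynomial.eval x (P t)) := by
      ext t
      simp [φ, MvPolynomial.aeval_eq_eval]
    simpa [MvPolynomial.aeval_eq_eval] using DFunLike.congr_fun this q
  have hinj : Function.Injective φ := by
    rw [injective_iff_map_eq_zero]
    intro q hq
    refine mvPolynomial_eq_zero_of_eventually (y₀ := y₀) ?_
    filter_upwards [h] with y hy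
    obtain ⟨x, rfl⟩ := hy
    rw [← hφ, hq, map_zero]
  have hfp : φ.toRingHom.FinitePresentation := by
    let _ := φ.toRingHom.toAlgebra
    have : IsScalarTower ℂ (MvPolynomial τ ℂ) (MvPolynomial σ ℂ) :=
      IsScalarTower.of_algebraMap_eq' φ.comp_algebraMap.symm
    have : Algebra.FiniteType (MvPolynomial τ ℂ) (MvPolynomial σ ℂ) :=
      Algebra.FiniteType.of_restrictScalars_finiteType ℂ _ _
    exact (Algebra.FinitePresentation.of_finiteType).1 ‹_›
  obtain ⟨S, hS⟩ := PrimeSpectrum.exists_constructibleSetData_iff.2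
    (PrimeSpectrum.isConstructible_range_comap hfp)
  have hgen : (⊥ : PrimeSpectrum (MvPolynomial τ ℂ)) ∈ S.toSet := by
    rw [hS]
    refine ⟨⊥, ?_⟩
    ext q
    change φ q ∈ (⊥ : Ideal _) ↔ q ∈ (⊥ : Ideal _)
    rw [Ideal.mem_bot, Ideal.mem_bot]
    exact map_eq_zero_iff φ hinj
  simp only [PrimeSpectrum.ConstructibleSetData.toSet, Set.mem_iUnion] at hgen
  obtain ⟨C, hC, hmem⟩ := hgen
  have hf : C.f ≠ 0 := fun h0 => hmem.2 (by
    rw [PrimeSpectrum.mem_zeroLocus, h0]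
    simp)
  have hg : ∀ q ∈ Set.range C.g, q = 0 := fun q hq => by
    have := hmem.1 hq
    exact this
  have hsub : ∀ y : τ → ℂ, MvPolynomial.eval y C.f ≠ 0 →
      y ∈ Set.range (fun (x : σ → ℂ) t => MvPolynomial.eval x (P t)) := by
    intro y hy
    let 𝔪 : PrimeSpectrum (MvPolynomial τ ℂ) :=
      ⟨RingHom.ker (MvPolynomial.eval y), RingHom.ker_isPrime _⟩
    have h𝔪 : 𝔪 ∈ S.toSet := by
      simp only [PrimeSpectrum.ConstructibleSetData.toSet, Set.mem_iUnion]
      refine ⟨C, hC, ?_, ?_⟩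
      · intro q hq
        rw [hg q hq]
        exact zero_mem _
      · intro hc
        exact hy (hc rfl)
    rw [hS] at h𝔪
    obtain ⟨Q, hQ⟩ := h𝔪
    obtain ⟨M, hM, hQM⟩ := Q.asIdeal.exists_le_maximal Q.isPrime.ne_top
    obtain ⟨x, rfl⟩ := MvPolynomial.eq_vanishingIdeal_singleton_of_isMaximal ℂ hM
    refine ⟨x, funext fun t => ?_⟩
    have h1 : (MvPolynomial.X t - MvPolynomial.C (y t)) ∈ 𝔪.asIdeal := by
      change MvPolynomial.eval y _ = 0
      simp
    rw [← hQ] at h1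
    have h2 := hQM h1
    rw [MvPolynomial.mem_vanishingIdeal_singleton_iff] at h2
    have h3 : MvPolynomial.eval x (φ (MvPolynomial.X t - MvPolynomial.C (y t))) = 0 := h2
    rw [hφ] at h3
    simpa [sub_eq_zero] using h3
  refine Dense.mono (s₁ := {y | MvPolynomial.eval y C.f ≠ 0}) hsub ?_
  intro y
  rw [mem_closure_iff_frequently]
  intro hcon
  refine hf (mvPolynomial_eq_zero_of_eventually (y₀ := y) ?_)
  filter_upwards [hcon] with z hz
  by_contra hne
  exact hz hne

end

section

open Matrix

variable {a b c : ℕ}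

/-- A matrix acting on the first tensor factor. -/
def legA (g : Matrix (Fin a) (Fin a) ℂ) (ψ : Fin a × Fin b × Fin c → ℂ) :
    Fin a × Fin b × Fin c → ℂ := fun p => ∑ i', g p.1 i' * ψ (i', p.2.1, p.2.2)

/-- A matrix acting on the second tensor factor. -/
def legB (g : Matrix (Fin b) (Fin b) ℂ) (ψ : Fin a × Fin b × Fin c → ℂ) :
    Fin a × Fin b × Fin c → ℂ := fun p => ∑ j', g p.2.1 j' * ψ (p.1, j', p.2.2)

/-- A matrix acting on the third tensor factor. -/
def legC (g : Matrix (Fin c) (Fin c) ℂ) (ψ : Fin a × Fin b × Fin c → ℂ) :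
    Fin a × Fin b × Fin c → ℂ := fun p => ∑ k', g p.2.2 k' * ψ (p.1, p.2.1, k')

theorem act_eq_legs (t : Matrix (Fin a) (Fin a) ℂ × Matrix (Fin b) (Fin b) ℂ ×
    Matrix (Fin c) (Fin c) ℂ) (ψ : Fin a × Fin b × Fin c → ℂ) :
    act t ψ = legA t.1 ψ + legB t.2.1 ψ + legC t.2.2 ψ := rfl

/-- The flattening of a tensor along the first factor. -/
def flatA (ψ : Fin a × Fin b × Fin c → ℂ) : Matrix (Fin a) (Fin b × Fin c) ℂ :=
  Matrix.of fun i p => ψ (i, p.1, p.2)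

theorem flatA_add (ψ φ : Fin a × Fin b × Fin c → ℂ) : flatA (ψ + φ) = flatA ψ + flatA φ := rfl

theorem flatA_smul (r : ℂ) (ψ : Fin a × Fin b × Fin c → ℂ) : flatA (r • ψ) = r • flatA ψ := rfl

/-- The flattening of a tensor along the second factor. -/
def flatB (ψ : Fin a × Fin b × Fin c → ℂ) : Matrix (Fin b) (Fin a × Fin c) ℂ :=
  Matrix.of fun j p => ψ (p.1, j, p.2)

theorem flatB_add (ψ φ : Fin a × Fin b × Fin c → ℂ) : flatB (ψ + φ) = flatB ψ + flatB φ := rfl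

theorem flatB_smul (r : ℂ) (ψ : Fin a × Fin b × Fin c → ℂ) : flatB (r • ψ) = r • flatB ψ := rfl

/-- The flattening of a tensor along the third factor. -/
def flatC (ψ : Fin a × Fin b × Fin c → ℂ) : Matrix (Fin c) (Fin a × Fin b) ℂ :=
  Matrix.of fun k p => ψ (p.1, p.2, k)

theorem flatC_add (ψ φ : Fin a × Fin b × Fin c → ℂ) : flatC (ψ + φ) = flatC ψ + flatC φ := rfl

theorem flatC_smul (r : ℂ) (ψ : Fin a × Fin b × Fin c → ℂ) : flatC (r • ψ) = r • flatC ψ := rfl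

@[simp] theorem flatA_apply (ψ : Fin a × Fin b × Fin c → ℂ) (i) (p) :
    flatA ψ i p = ψ (i, p.1, p.2) := rfl

@[simp] theorem flatB_apply (ψ : Fin a × Fin b × Fin c → ℂ) (i) (p) :
    flatB ψ i p = ψ (p.1, i, p.2) := rfl

@[simp] theorem flatC_apply (ψ : Fin a × Fin b × Fin c → ℂ) (i) (p) :
    flatC ψ i p = ψ (p.1, p.2, i) := rfl

/-- Right multiplication by the identity on the first index and `gᵀ` on the second. -/
def rightSnd {n m : Type*} [Fintype m] [DecidableEq n] (g : Matrix m m ℂ) :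
    Matrix (n × m) (n × m) ℂ :=
  Matrix.of fun p q => if p.1 = q.1 then g q.2 p.2 else 0

/-- Right multiplication by `gᵀ` on the first index and the identity on the second. -/
def rightFst {n m : Type*} [Fintype n] [DecidableEq m] (g : Matrix n n ℂ) :
    Matrix (n × m) (n × m) ℂ :=
  Matrix.of fun p q => if p.2 = q.2 then g q.1 p.1 else 0

theorem rightSnd_add {n m : Type*} [Fintype m] [DecidableEq n] (g h : Matrix m m ℂ) :
    (rightSnd (g + h) : Matrix (n × m) (n × m) ℂ) = rightSnd g + rightSnd h := by
  ext p q
  by_cases hpq : p.1 = q.1 <;> simp [rightSnd, hpq]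

theorem rightFst_add {n m : Type*} [Fintype n] [DecidableEq m] (g h : Matrix n n ℂ) :
    (rightFst (g + h) : Matrix (n × m) (n × m) ℂ) = rightFst g + rightFst h := by
  ext p q
  by_cases hpq : p.2 = q.2 <;> simp [rightFst, hpq]

theorem rightSnd_zero {n m : Type*} [Fintype m] [DecidableEq n] :
    (rightSnd (0 : Matrix m m ℂ) : Matrix (n × m) (n × m) ℂ) = 0 := by
  ext p q; simp [rightSnd]

theorem rightFst_zero {n m : Type*} [Fintype n] [DecidableEq m] :
    (rightFst (0 : Matrix n n ℂ) : Matrix (n × m) (n × m) ℂ) = 0 := by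
  ext p q; simp [rightFst]

theorem rightSnd_conjTranspose {n m : Type*} [Fintype m] [DecidableEq n] (g : Matrix m m ℂ) :
    (rightSnd g : Matrix (n × m) (n × m) ℂ)ᴴ = rightSnd gᴴ := by
  ext p q
  by_cases hpq : p.1 = q.1
  · simp [rightSnd, hpq]
  · simp [rightSnd, hpq, Ne.symm hpq]

theorem rightFst_conjTranspose {n m : Type*} [Fintype n] [DecidableEq m] (g : Matrix n n ℂ) :
    (rightFst g : Matrix (n × m) (n × m) ℂ)ᴴ = rightFst gᴴ := by
  ext p q
  by_cases hpq : p.2 = q.2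
  · simp [rightFst, hpq]
  · simp [rightFst, hpq, Ne.symm hpq]

theorem rightSnd_mul {n m : Type*} [Fintype n] [Fintype m] [DecidableEq n] (g h : Matrix m m ℂ) :
    (rightSnd g * rightSnd h : Matrix (n × m) (n × m) ℂ) = rightSnd (h * g) := by
  ext p q
  simp only [rightSnd, Matrix.mul_apply, Matrix.of_apply, Fintype.sum_prod_type, ite_mul, mul_ite,
    zero_mul, mul_zero]
  rw [Finset.sum_comm]
  by_cases hpq : p.1 = q.1 <;> simp [hpq, mul_comm]

theorem rightFst_mul {n m : Type*} [Fintype n] [Fintype m] [DecidableEq m] (g h : Matrix n n ℂ) :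
    (rightFst g * rightFst h : Matrix (n × m) (n × m) ℂ) = rightFst (h * g) := by
  ext p q
  simp only [rightFst, Matrix.mul_apply, Matrix.of_apply, Fintype.sum_prod_type, ite_mul, mul_ite,
    zero_mul, mul_zero]
  by_cases hpq : p.2 = q.2 <;> simp [hpq, mul_comm]

theorem rightSnd_one {n m : Type*} [Fintype m] [DecidableEq n] [DecidableEq m] :
    (rightSnd (1 : Matrix m m ℂ) : Matrix (n × m) (n × m) ℂ) = 1 := by
  ext p q
  simp only [rightSnd, Matrix.of_apply, Matrix.one_apply, Prod.ext_iff]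
  by_cases hpq : p.1 = q.1 <;> simp [hpq, eq_comm]

theorem rightFst_one {n m : Type*} [Fintype n] [DecidableEq n] [DecidableEq m] :
    (rightFst (1 : Matrix n n ℂ) : Matrix (n × m) (n × m) ℂ) = 1 := by
  ext p q
  simp only [rightFst, Matrix.of_apply, Matrix.one_apply, Prod.ext_iff]
  by_cases hpq : p.2 = q.2 <;> simp [hpq, eq_comm]

variable (gA : Matrix (Fin a) (Fin a) ℂ) (gB : Matrix (Fin b) (Fin b) ℂ)
  (gC : Matrix (Fin c) (Fin c) ℂ) (ψ φ : Fin a × Fin b × Fin c → ℂ)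

theorem flatA_legA : flatA (legA gA ψ) = gA * flatA ψ := rfl

theorem flatB_legB : flatB (legB gB ψ) = gB * flatB ψ := rfl

theorem flatC_legC : flatC (legC gC ψ) = gC * flatC ψ := rfl

theorem flatA_legB : flatA (legB gB ψ) = 
    flatA ψ * (rightFst gB : Matrix (Fin b × Fin c) (Fin b × Fin c) ℂ) := by
  ext i p
  rw [Matrix.mul_apply]
  simp [legB, rightFst, Fintype.sum_prod_type, mul_comm]

theorem flatA_legC : flatA (legC gC ψ) = 
    flatA ψ * (rightSnd gC : Matrix (Fin b × Fin c) (Fin b × Fin c) ℂ) := by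
  ext i p
  rw [Matrix.mul_apply]
  simp only [flatA_apply, legC, rightSnd, Fintype.sum_prod_type, Matrix.of_apply, mul_ite, mul_zero]
  rw [Finset.sum_comm]
  simp [mul_comm]

theorem flatB_legA : flatB (legA gA ψ) = 
    flatB ψ * (rightFst gA : Matrix (Fin a × Fin c) (Fin a × Fin c) ℂ) := by
  ext i p
  rw [Matrix.mul_apply]
  simp [legA, rightFst, Fintype.sum_prod_type, mul_comm]

theorem flatB_legC : flatB (legC gC ψ) = 
    flatB ψ * (rightSnd gC : Matrix (Fin a × Fin c) (Fin a × Fin c) ℂ) := by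
  ext i p
  rw [Matrix.mul_apply]
  simp only [flatB_apply, legC, rightSnd, Fintype.sum_prod_type, Matrix.of_apply, mul_ite, mul_zero]
  rw [Finset.sum_comm]
  simp [mul_comm]

theorem flatC_legA : flatC (legA gA ψ) = 
    flatC ψ * (rightFst gA : Matrix (Fin a × Fin b) (Fin a × Fin b) ℂ) := by
  ext i p
  rw [Matrix.mul_apply]
  simp [legA, rightFst, Fintype.sum_prod_type, mul_comm]

theorem flatC_legB : flatC (legB gB ψ) = 
    flatC ψ * (rightSnd gB : Matrix (Fin a × Fin b) (Fin a × Fin b) ℂ) := by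
  ext i p
  rw [Matrix.mul_apply]
  simp only [flatC_apply, legB, rightSnd, Fintype.sum_prod_type, Matrix.of_apply, mul_ite, mul_zero]
  rw [Finset.sum_comm]
  simp [mul_comm]

theorem rhoA_eq_flat : rhoA ψ = flatA ψ * (flatA ψ)ᴴ := by
  ext i i'
  rw [Matrix.mul_apply]
  simp [rhoA, Fintype.sum_prod_type]

theorem rhoB_eq_flat : rhoB ψ = flatB ψ * (flatB ψ)ᴴ := by
  ext i i'
  rw [Matrix.mul_apply]
  simp [rhoB, Fintype.sum_prod_type]

theorem rhoC_eq_flat : rhoC ψ = flatC ψ * (flatC ψ)ᴴ := by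
  ext i i'
  rw [Matrix.mul_apply]
  simp [rhoC, Fintype.sum_prod_type]

/-- The group `GL × GL × GL` (indeed all triples of matrices) acting on tensors. -/
def gact (g : Matrix (Fin a) (Fin a) ℂ × Matrix (Fin b) (Fin b) ℂ × Matrix (Fin c) (Fin c) ℂ)
    (ψ : Fin a × Fin b × Fin c → ℂ) : Fin a × Fin b × Fin c → ℂ :=
  legA g.1 (legB g.2.1 (legC g.2.2 ψ))

theorem legA_mul (g h : Matrix (Fin a) (Fin a) ℂ) : legA (g * h) ψ = legA g (legA h ψ) := by
  apply (show Function.Injective (flatA (a := a) (b := b) (c := c)) from fun x y h => by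
    funext p; exact congrFun (congrFun h p.1) p.2)
  simp [flatA_legA, Matrix.mul_assoc]

theorem legB_mul (g h : Matrix (Fin b) (Fin b) ℂ) : legB (g * h) ψ = legB g (legB h ψ) := by
  apply (show Function.Injective (flatB (a := a) (b := b) (c := c)) from fun x y h => by
    funext p; exact congrFun (congrFun h p.2.1) (p.1, p.2.2))
  simp [flatB_legB, Matrix.mul_assoc]

theorem legC_mul (g h : Matrix (Fin c) (Fin c) ℂ) : legC (g * h) ψ = legC g (legC h ψ) := by
  apply (show Function.Injective (flatC (a := a) (b := b) (c := c)) from fun x y h => by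
    funext p; exact congrFun (congrFun h p.2.2) (p.1, p.2.1))
  simp [flatC_legC, Matrix.mul_assoc]

theorem legA_legB_comm : legA gA (legB gB ψ) = legB gB (legA gA ψ) := by
  apply (show Function.Injective (flatA (a := a) (b := b) (c := c)) from fun x y h => by
    funext p; exact congrFun (congrFun h p.1) p.2)
  simp [flatA_legA, flatA_legB, Matrix.mul_assoc]

theorem legA_legC_comm : legA gA (legC gC ψ) = legC gC (legA gA ψ) := by
  apply (show Function.Injective (flatA (a := a) (b := b) (c := c)) from fun x y h => by
    funext p; exact congrFun (congrFun h p.1) p.2)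
  simp [flatA_legA, flatA_legC, Matrix.mul_assoc]

theorem legB_legC_comm : legB gB (legC gC ψ) = legC gC (legB gB ψ) := by
  apply (show Function.Injective (flatB (a := a) (b := b) (c := c)) from fun x y h => by
    funext p; exact congrFun (congrFun h p.2.1) (p.1, p.2.2))
  simp [flatB_legB, flatB_legC, Matrix.mul_assoc]

theorem legB_one : legB (1 : Matrix (Fin b) (Fin b) ℂ) ψ = ψ := by
  funext p; simp [legB, Matrix.one_apply]

theorem legC_one : legC (1 : Matrix (Fin c) (Fin c) ℂ) ψ = ψ := by
  funext p; simp [legC, Matrix.one_apply]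

theorem gact_mul (g h : Matrix (Fin a) (Fin a) ℂ × Matrix (Fin b) (Fin b) ℂ ×
    Matrix (Fin c) (Fin c) ℂ) : gact (g * h) ψ = gact g (gact h ψ) := by
  simp only [gact, Prod.fst_mul, Prod.snd_mul, legA_mul, legB_mul, legC_mul]
  rw [← legA_legC_comm, ← legA_legB_comm, ← legB_legC_comm]

theorem mul_unitary_mul_conjTranspose {n p : Type*} [Fintype n] [Fintype p] [DecidableEq p]
    (G : Matrix n n ℂ) (M : Matrix n p ℂ) (S F : Matrix p p ℂ) (hF : F * Fᴴ = 1)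
    (hS : S * Sᴴ = 1) :
    (G * (M * S * F)) * (G * (M * S * F))ᴴ = G * (M * Mᴴ) * Gᴴ := by
  have h : (G * (M * S * F)) * (G * (M * S * F))ᴴ
      = G * (M * (S * (F * Fᴴ) * Sᴴ) * Mᴴ) * Gᴴ := by
    simp only [Matrix.conjTranspose_mul, Matrix.mul_assoc]
  rw [h, hF, Matrix.mul_one, hS, Matrix.mul_one]

theorem rhoA_gact (hB : gBᴴ * gB = 1) (hC : gCᴴ * gC = 1) :
    rhoA (gact (gA, gB, gC) ψ) = gA * rhoA ψ * gAᴴ := by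
  simp only [gact, rhoA_eq_flat, flatA_legA, flatA_legB, flatA_legC]
  refine mul_unitary_mul_conjTranspose _ _ _ _ ?_ ?_
  · rw [rightFst_conjTranspose, rightFst_mul, hB, rightFst_one]
  · rw [rightSnd_conjTranspose, rightSnd_mul, hC, rightSnd_one]

theorem rhoB_gact (hA : gAᴴ * gA = 1) (hC : gCᴴ * gC = 1) :
    rhoB (gact (gA, gB, gC) ψ) = gB * rhoB ψ * gBᴴ := by
  simp only [gact, legA_legB_comm, rhoB_eq_flat, flatB_legA, flatB_legB, flatB_legC]
  refine mul_unitary_mul_conjTranspose _ _ _ _ ?_ ?_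
  · rw [rightFst_conjTranspose, rightFst_mul, hA, rightFst_one]
  · rw [rightSnd_conjTranspose, rightSnd_mul, hC, rightSnd_one]

theorem rhoC_gact (hA : gAᴴ * gA = 1) (hB : gBᴴ * gB = 1) :
    rhoC (gact (gA, gB, gC) ψ) = gC * rhoC ψ * gCᴴ := by
  simp only [gact, legB_legC_comm, legA_legC_comm, rhoC_eq_flat, flatC_legA, flatC_legB, flatC_legC]
  refine mul_unitary_mul_conjTranspose _ _ _ _ ?_ ?_
  · rw [rightFst_conjTranspose, rightFst_mul, hA, rightFst_one]
  · rw [rightSnd_conjTranspose, rightSnd_mul, hB, rightSnd_one]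

theorem rhoA_isHermitian : (rhoA ψ).IsHermitian := by
  rw [rhoA_eq_flat]; exact Matrix.isHermitian_mul_conjTranspose_self _

theorem rhoB_isHermitian : (rhoB ψ).IsHermitian := by
  rw [rhoB_eq_flat]; exact Matrix.isHermitian_mul_conjTranspose_self _

theorem rhoC_isHermitian : (rhoC ψ).IsHermitian := by
  rw [rhoC_eq_flat]; exact Matrix.isHermitian_mul_conjTranspose_self _

end

section

open Matrix

variable {a b c : ℕ}

/-- Tensors of format `a × b × c`. -/
abbrev Ten (a b c : ℕ) := Fin a × Fin b × Fin c → ℂ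

/-- Triples of square matrices of sizes `a`, `b`, `c`. -/
abbrev Mat3 (a b c : ℕ) :=
  Matrix (Fin a) (Fin a) ℂ × Matrix (Fin b) (Fin b) ℂ × Matrix (Fin c) (Fin c) ℂ

/-- The sum of the traces of a triple of matrices. -/
def tr3 (S : Mat3 a b c) : ℂ := S.1.trace + S.2.1.trace + S.2.2.trace

theorem tr3_add (S T : Mat3 a b c) : tr3 (S + T) = tr3 S + tr3 T := by
  simp only [tr3, Prod.fst_add, Prod.snd_add, Matrix.trace_add]; ring

theorem tr3_mul_comm (S T : Mat3 a b c) : tr3 (S * T) = tr3 (T * S) := by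
  simp only [tr3, Prod.fst_mul, Prod.snd_mul]
  rw [Matrix.trace_mul_comm, Matrix.trace_mul_comm S.2.1, Matrix.trace_mul_comm S.2.2]

theorem tr3_star (S : Mat3 a b c) : tr3 (star S) = star (tr3 S) := by
  simp only [tr3, Prod.fst_star, Prod.snd_star, Matrix.star_eq_conjTranspose,
    Matrix.trace_conjTranspose, star_add]

theorem tr3_smul (r : ℝ) (S : Mat3 a b c) : tr3 (r • S) = r • tr3 S := by
  simp only [tr3, Prod.smul_fst, Prod.smul_snd, Matrix.trace_smul, smul_add]

/-- The polarisation of the reduced density matrices. -/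
def rhoBil (ψ w : Ten a b c) : Mat3 a b c :=
  (flatA ψ * (flatA w)ᴴ, flatB ψ * (flatB w)ᴴ, flatC ψ * (flatC w)ᴴ)

/-- The triple of reduced density matrices. -/
def rho (ψ : Ten a b c) : Mat3 a b c := (rhoA ψ, rhoB ψ, rhoC ψ)

theorem rho_eq_rhoBil (ψ : Ten a b c) : rho ψ = rhoBil ψ ψ := by
  simp only [rho, rhoBil, rhoA_eq_flat, rhoB_eq_flat, rhoC_eq_flat]

theorem rhoBil_add_left (ψ φ w : Ten a b c) :
    rhoBil (ψ + φ) w = rhoBil ψ w + rhoBil φ w := by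
  simp only [rhoBil, flatA_add, flatB_add, flatC_add, Matrix.add_mul, Prod.mk_add_mk]

theorem rhoBil_add_right (ψ φ w : Ten a b c) :
    rhoBil w (ψ + φ) = rhoBil w ψ + rhoBil w φ := by
  simp only [rhoBil, flatA_add, flatB_add, flatC_add, Matrix.mul_add, Prod.mk_add_mk,
    Matrix.conjTranspose_add]

theorem rhoBil_smul_left (r : ℝ) (ψ w : Ten a b c) : rhoBil (r • ψ) w = r • rhoBil ψ w := by
  have h : r • ψ = (r : ℂ) • ψ := by ext; simp
  rw [h]
  simp only [rhoBil, flatA_smul, flatB_smul, flatC_smul, Matrix.smul_mul, Prod.smul_mk]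
  ext <;> simp

theorem rhoBil_smul_right (r : ℝ) (ψ w : Ten a b c) : rhoBil ψ (r • w) = r • rhoBil ψ w := by
  have h : r • w = (r : ℂ) • w := by ext; simp
  rw [h]
  simp only [rhoBil, flatA_smul, flatB_smul, flatC_smul, Matrix.mul_smul, Prod.smul_mk,
    Matrix.conjTranspose_smul]
  ext <;> simp

theorem star_rhoBil (ψ w : Ten a b c) : star (rhoBil ψ w) = rhoBil w ψ := by
  ext : 1
  · simp [rhoBil, Matrix.star_eq_conjTranspose]
  · ext : 1 <;> simp [rhoBil, Matrix.star_eq_conjTranspose]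

theorem star_rho (ψ : Ten a b c) : star (rho ψ) = rho ψ := by
  rw [rho_eq_rhoBil, star_rhoBil]

/-- The derivative of `rho` at `ψ` in direction `w`. -/
def drho (ψ w : Ten a b c) : Mat3 a b c := rhoBil ψ w + rhoBil w ψ

theorem drho_comm (ψ w : Ten a b c) : drho ψ w = drho w ψ := add_comm _ _

theorem star_drho (ψ w : Ten a b c) : star (drho ψ w) = drho ψ w := by
  rw [drho, star_add, star_rhoBil, star_rhoBil, add_comm]

theorem drho_add (ψ v w : Ten a b c) : drho ψ (v + w) = drho ψ v + drho ψ w := by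
  simp only [drho, rhoBil_add_left, rhoBil_add_right]; abel

theorem drho_smul (r : ℝ) (ψ w : Ten a b c) : drho ψ (r • w) = r • drho ψ w := by
  simp only [drho, rhoBil_smul_left, rhoBil_smul_right, smul_add]

theorem rho_add (ψ w : Ten a b c) : rho (ψ + w) = rho ψ + drho ψ w + rho w := by
  simp only [rho_eq_rhoBil, drho, rhoBil_add_left, rhoBil_add_right]; abel

theorem rho_smul (r : ℝ) (ψ : Ten a b c) : rho (r • ψ) = r ^ 2 • rho ψ := by
  simp only [rho_eq_rhoBil, rhoBil_smul_left, rhoBil_smul_right, smul_smul, sq]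

theorem dotProduct_eq_trace_flatA (w ψ : Ten a b c) :
    star w ⬝ᵥ ψ = (flatA ψ * (flatA w)ᴴ).trace := by
  simp only [dotProduct, Matrix.trace, Matrix.diag_apply, Matrix.mul_apply, flatA_apply,
    Fintype.sum_prod_type, Matrix.conjTranspose_apply, Pi.star_apply, mul_comm]

theorem dotProduct_eq_trace_flatB (w ψ : Ten a b c) :
    star w ⬝ᵥ ψ = (flatB ψ * (flatB w)ᴴ).trace := by
  simp only [dotProduct, Matrix.trace, Matrix.diag_apply, Matrix.mul_apply, flatB_apply,
    Fintype.sum_prod_type, Matrix.conjTranspose_apply, Pi.star_apply, mul_comm]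
  exact Finset.sum_comm

theorem dotProduct_eq_trace_flatC (w ψ : Ten a b c) :
    star w ⬝ᵥ ψ = (flatC ψ * (flatC w)ᴴ).trace := by
  simp only [dotProduct, Matrix.trace, Matrix.diag_apply, Matrix.mul_apply, flatC_apply,
    Fintype.sum_prod_type, Matrix.conjTranspose_apply, Pi.star_apply, mul_comm]
  rw [Finset.sum_comm' (t' := Finset.univ) (s' := fun _ => Finset.univ) (by simp)]
  conv_lhs => enter [2, j]; rw [Finset.sum_comm]
  rw [Finset.sum_comm]
  exact Finset.sum_congr rfl fun k _ => Finset.sum_comm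

theorem dotProduct_act (w ψ : Ten a b c) (ξ : Mat3 a b c) :
    star w ⬝ᵥ act ξ ψ = tr3 (rhoBil ψ w * ξ) := by
  rw [act_eq_legs, dotProduct_add, dotProduct_add, dotProduct_eq_trace_flatA,
    dotProduct_eq_trace_flatB w (legB _ _), dotProduct_eq_trace_flatC w (legC _ _), flatA_legA,
    flatB_legB, flatC_legC]
  simp only [tr3, rhoBil, Prod.fst_mul, Prod.snd_mul, Matrix.mul_assoc]
  rw [Matrix.trace_mul_comm, Matrix.trace_mul_comm ξ.2.1, Matrix.trace_mul_comm ξ.2.2]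
  simp only [Matrix.mul_assoc]

theorem act_add_left (ξ η : Mat3 a b c) (ψ : Ten a b c) : act (ξ + η) ψ = act ξ ψ + act η ψ :=
  (actL ψ).map_add ξ η

theorem act_sub_left (ξ η : Mat3 a b c) (ψ : Ten a b c) : act (ξ - η) ψ = act ξ ψ - act η ψ :=
  (actL ψ).map_sub ξ η

theorem act_smul_left (r : ℂ) (ξ : Mat3 a b c) (ψ : Ten a b c) : act (r • ξ) ψ = r • act ξ ψ :=
  (actL ψ).map_smul r ξ

theorem star_dotProduct_swap (w ψ : Ten a b c) : star (star w ⬝ᵥ ψ) = star ψ ⬝ᵥ w := by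
  rw [← Matrix.star_dotProduct_star, star_star, dotProduct_comm]

theorem two_re_dotProduct_act (w ψ : Ten a b c) {ξ : Mat3 a b c} (hξ : star ξ = ξ) :
    2 * (star w ⬝ᵥ act ξ ψ).re = (tr3 (drho ψ w * ξ)).re := by
  have h : (tr3 (rhoBil w ψ * ξ)).re = (tr3 (rhoBil ψ w * ξ)).re := by
    rw [tr3_mul_comm, ← Complex.conj_re, starRingEnd_apply,
      ← tr3_star, star_mul, star_rhoBil, hξ]
  rw [dotProduct_act, drho, add_mul, tr3_add, Complex.add_re, h]; ring

theorem drho_act (ψ : Ten a b c) {Y : Mat3 a b c} (hY : star Y = -Y) :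
    drho ψ (act Y ψ) = Y * rho ψ - rho ψ * Y := by
  have key : ∀ {n m : Type} [Fintype n] [Fintype m] (M : Matrix n m ℂ) (X : Matrix n n ℂ)
      (K L : Matrix m m ℂ), Xᴴ = -X → Kᴴ = -K → Lᴴ = -L →
      M * (X * M + M * K + M * L)ᴴ + (X * M + M * K + M * L) * Mᴴ
        = X * (M * Mᴴ) - M * Mᴴ * X := by
    intro n m _ _ M X K L hX hK hL
    simp only [Matrix.conjTranspose_add, Matrix.conjTranspose_mul, hX, hK, hL, Matrix.mul_add,
      Matrix.add_mul, Matrix.mul_neg, Matrix.neg_mul, Matrix.mul_assoc]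
    abel
  have hA : Y.1ᴴ = -Y.1 := congrArg Prod.fst hY
  have hB : Y.2.1ᴴ = -Y.2.1 := congrArg (fun Z => Z.2.1) hY
  have hC : Y.2.2ᴴ = -Y.2.2 := congrArg (fun Z => Z.2.2) hY
  have hr {n m : Type} [Fintype n] [Fintype m] [DecidableEq n] [DecidableEq m]
      {g : Matrix n n ℂ} (h : gᴴ = -g) :
      (rightFst g : Matrix (n × m) (n × m) ℂ)ᴴ = -rightFst g := by
    rw [rightFst_conjTranspose, h, eq_neg_iff_add_eq_zero, ← rightFst_add, neg_add_cancel,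
      rightFst_zero]
  have hs {n m : Type} [Fintype n] [Fintype m] [DecidableEq n] [DecidableEq m]
      {g : Matrix m m ℂ} (h : gᴴ = -g) :
      (rightSnd g : Matrix (n × m) (n × m) ℂ)ᴴ = -rightSnd g := by
    rw [rightSnd_conjTranspose, h, eq_neg_iff_add_eq_zero, ← rightSnd_add, neg_add_cancel,
      rightSnd_zero]
  rw [act_eq_legs, drho]
  ext1
  · simp only [rhoBil, rho, rhoA_eq_flat, flatA_add, flatA_legA, flatA_legB, flatA_legC,
      Prod.fst_add, Prod.fst_sub, Prod.fst_mul]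
    exact key _ _ _ _ hA (hr hB) (hs hC)
  · ext1
    · simp only [rhoBil, rho, rhoB_eq_flat, flatB_add, flatB_legA, flatB_legB, flatB_legC,
        Prod.fst_add, Prod.fst_sub, Prod.fst_mul, Prod.snd_add, Prod.snd_sub, Prod.snd_mul]
      rw [add_comm (flatB ψ * rightFst Y.1)]
      exact key _ _ _ _ hB (hr hA) (hs hC)
    · simp only [rhoBil, rho, rhoC_eq_flat, flatC_add, flatC_legA, flatC_legB, flatC_legC,
        Prod.snd_add, Prod.snd_sub, Prod.snd_mul]
      rw [add_comm (flatC ψ * rightFst Y.1 + _), ← add_assoc]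
      exact key _ _ _ _ hC (hr hA) (hs hB)

end

section

open Matrix

variable {a b c : ℕ}

/-- Triples of real vectors. -/
abbrev Spec3 (a b c : ℕ) := (Fin a → ℝ) × (Fin b → ℝ) × (Fin c → ℝ)

/-- The triple of diagonal matrices with given diagonals. -/
def diag3 (q : Spec3 a b c) : Mat3 a b c :=
  (Matrix.diagonal fun i => (q.1 i : ℂ), Matrix.diagonal fun i => (q.2.1 i : ℂ),
    Matrix.diagonal fun i => (q.2.2 i : ℂ))

/-- All three vectors are strictly decreasing. -/
def StrictAnti3 (q : Spec3 a b c) : Prop := StrictAnti q.1 ∧ StrictAnti q.2.1 ∧ StrictAnti q.2.2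

/-- All three vectors are nonincreasing. -/
def Antitone3 (q : Spec3 a b c) : Prop := Antitone q.1 ∧ Antitone q.2.1 ∧ Antitone q.2.2

theorem StrictAnti3.antitone3 {q : Spec3 a b c} (h : StrictAnti3 q) : Antitone3 q :=
  ⟨h.1.antitone, h.2.1.antitone, h.2.2.antitone⟩

/-- All three matrices are diagonal. -/
def IsDiag3 (Δ : Mat3 a b c) : Prop := Δ.1.IsDiag ∧ Δ.2.1.IsDiag ∧ Δ.2.2.IsDiag

theorem isDiag_of_commute_diagonal {n : Type*} [Fintype n] [DecidableEq n] {d : n → ℝ}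
    (hd : Function.Injective d) {X : Matrix n n ℂ}
    (h : X * Matrix.diagonal (fun i => (d i : ℂ)) = Matrix.diagonal (fun i => (d i : ℂ)) * X) :
    X.IsDiag := by
  intro i j hij
  have h1 := congrFun (congrFun h i) j
  rw [Matrix.mul_diagonal, Matrix.diagonal_mul] at h1
  have h2 : ((d j : ℂ) - d i) * X i j = 0 := by linear_combination h1
  rcases mul_eq_zero.1 h2 with h3 | h3
  · exact absurd (hd (by exact_mod_cast sub_eq_zero.1 h3)) (Ne.symm hij)
  · exact h3

theorem drho_zero (ψ : Ten a b c) : drho ψ 0 = 0 := by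
  have := drho_smul 0 ψ 0
  simpa using this

/-- A Hermitian stabiliser of a tensor with regular diagonal marginals is diagonal. -/
theorem isDiag3_of_act_eq_zero {ψ : Ten a b c} {q : Spec3 a b c} (hψ : rho ψ = diag3 q)
    (hq : StrictAnti3 q) {Δ : Mat3 a b c} (hΔ : star Δ = Δ) (h0 : act Δ ψ = 0) : IsDiag3 Δ := by
  have h := drho_act ψ (Y := Complex.I • Δ) (by
    rw [star_smul, hΔ]; simp)
  rw [act_smul_left, h0, smul_zero, drho_zero, hψ, smul_mul_assoc, mul_smul_comm, ← smul_sub] at h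
  have h' := (smul_eq_zero.1 h.symm).resolve_left Complex.I_ne_zero
  rw [sub_eq_zero] at h'
  exact ⟨isDiag_of_commute_diagonal hq.1.injective (congrArg Prod.fst h'),
    isDiag_of_commute_diagonal hq.2.1.injective (congrArg (fun Z => Z.2.1) h'),
    isDiag_of_commute_diagonal hq.2.2.injective (congrArg (fun Z => Z.2.2) h')⟩

/-- The squared norm of a tensor. -/
def nsq (ψ : Ten a b c) : ℝ := ∑ p, Complex.normSq (ψ p)

theorem star_dotProduct_self (ψ : Ten a b c) : star ψ ⬝ᵥ ψ = (nsq ψ : ℂ) := by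
  simp only [dotProduct, nsq, Complex.ofReal_sum, Pi.star_apply, ← starRingEnd_apply,
    Complex.normSq_eq_conj_mul_self]

theorem nsq_nonneg (ψ : Ten a b c) : 0 ≤ nsq ψ :=
  Finset.sum_nonneg fun _ _ => Complex.normSq_nonneg _

theorem nsq_eq_zero {ψ : Ten a b c} (h : nsq ψ = 0) : ψ = 0 := by
  funext p
  have := (Finset.sum_eq_zero_iff_of_nonneg fun p _ => Complex.normSq_nonneg (ψ p)).1 h p
    (Finset.mem_univ p)
  simpa using this

theorem re_dotProduct_sub_add (x y : Ten a b c) :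
    (star (x - y) ⬝ᵥ (x + y)).re = nsq x - nsq y := by
  have hc : (star y ⬝ᵥ x).re = (star x ⬝ᵥ y).re := by
    rw [← star_dotProduct_swap]; simp
  rw [star_sub, sub_dotProduct, dotProduct_add, dotProduct_add, star_dotProduct_self,
    star_dotProduct_self]
  simp only [Complex.add_re, Complex.sub_re, Complex.ofReal_re, hc]; ring

/-- The commutator weight of a matrix with respect to a diagonal. -/
def offWeight {n : Type*} [Fintype n] (X : Matrix n n ℂ) (d : n → ℝ) : ℝ :=
  ∑ i, ∑ j, Complex.normSq (X i j) * (d j - d i)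

theorem re_trace_commutator {n : Type*} [Fintype n] [DecidableEq n] (X : Matrix n n ℂ)
    (d : n → ℝ) :
    (((X - Xᴴ) * Matrix.diagonal (fun i => (d i : ℂ))
      - Matrix.diagonal (fun i => (d i : ℂ)) * (X - Xᴴ)) * (X + Xᴴ)).trace.re
      = 2 * offWeight X d := by
  have h : (((X - Xᴴ) * Matrix.diagonal (fun i => (d i : ℂ))
      - Matrix.diagonal (fun i => (d i : ℂ)) * (X - Xᴴ)) * (X + Xᴴ)).trace.re
      = ∑ i, ∑ j, (Complex.normSq (X i j) - Complex.normSq (X j i)) * (d j - d i) := by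
    simp only [Matrix.trace, Matrix.diag_apply, Complex.re_sum]
    refine Finset.sum_congr rfl fun i _ => ?_
    rw [Matrix.mul_apply, Complex.re_sum]
    refine Finset.sum_congr rfl fun j _ => ?_
    rw [Matrix.sub_apply, Matrix.mul_diagonal, Matrix.diagonal_mul]
    simp only [Matrix.sub_apply, Matrix.add_apply, Matrix.conjTranspose_apply, Complex.star_def,
      Complex.normSq_apply, Complex.mul_re, Complex.sub_re, Complex.sub_im, Complex.add_re,
      Complex.add_im, Complex.conj_re, Complex.conj_im, Complex.mul_im, Complex.ofReal_re,
      Complex.ofReal_im]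
    ring
  have h2 : ∑ i, ∑ j, Complex.normSq (X j i) * (d j - d i) = - offWeight X d := by
    rw [Finset.sum_comm, offWeight, ← Finset.sum_neg_distrib]
    refine Finset.sum_congr rfl fun i _ => ?_
    rw [← Finset.sum_neg_distrib]
    exact Finset.sum_congr rfl fun j _ => by ring
  rw [h]
  simp only [sub_mul, Finset.sum_sub_distrib, h2]
  simp only [offWeight]; ring

theorem nsq_act_sub_nsq_act_star {ψ : Ten a b c} {q : Spec3 a b c} (hψ : rho ψ = diag3 q)
    (X : Mat3 a b c) :
    nsq (act X ψ) - nsq (act (star X) ψ)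
      = offWeight X.1 q.1 + offWeight X.2.1 q.2.1 + offWeight X.2.2 q.2.2 := by
  have h1 := two_re_dotProduct_act (act (X - star X) ψ) ψ (ξ := X + star X) (by
    rw [star_add, star_star, add_comm])
  rw [drho_act ψ (Y := X - star X) (by rw [star_sub, star_star, neg_sub]), hψ] at h1
  have h2 : (tr3 (((X - star X) * diag3 q - diag3 q * (X - star X)) * (X + star X))).re
      = 2 * offWeight X.1 q.1 + 2 * offWeight X.2.1 q.2.1 + 2 * offWeight X.2.2 q.2.2 := by
    rw [← re_trace_commutator, ← re_trace_commutator, ← re_trace_commutator]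
    simp only [tr3, Complex.add_re]
    rfl
  rw [h2, act_sub_left, act_add_left, re_dotProduct_sub_add] at h1
  linarith

theorem offWeight_nonneg {n : ℕ} {X : Matrix (Fin n) (Fin n) ℂ} {d : Fin n → ℝ}
    (hd : StrictAnti d) {Hv : Fin n → ℝ} (hX : X ∈ lowerMod Hv) : 0 ≤ offWeight X d := by
  refine Finset.sum_nonneg fun i _ => Finset.sum_nonneg fun j _ => ?_
  by_cases h : j < i
  · exact mul_nonneg (Complex.normSq_nonneg _) (sub_nonneg.2 (hd h).le)
  · rw [hX i j (fun h' => h h'.1)]; simp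

theorem eq_zero_of_offWeight {n : ℕ} {X : Matrix (Fin n) (Fin n) ℂ} {d : Fin n → ℝ}
    (hd : StrictAnti d) {Hv : Fin n → ℝ} (hX : X ∈ lowerMod Hv) (h0 : offWeight X d = 0) :
    X = 0 := by
  have hnn : ∀ i j, 0 ≤ Complex.normSq (X i j) * (d j - d i) := by
    intro i j
    by_cases h : j < i
    · exact mul_nonneg (Complex.normSq_nonneg _) (sub_nonneg.2 (hd h).le)
    · rw [hX i j (fun h' => h h'.1)]; simp
  ext i j
  by_cases h : j < i
  · have h1 := (Finset.sum_eq_zero_iff_of_nonneg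
      (fun i _ => Finset.sum_nonneg fun j _ => hnn i j)).1 h0 i (Finset.mem_univ i)
    have h2 := (Finset.sum_eq_zero_iff_of_nonneg (fun j _ => hnn i j)).1 h1 j (Finset.mem_univ j)
    rcases mul_eq_zero.1 h2 with h3 | h3
    · simpa using h3
    · exact absurd h3 (sub_pos.2 (hd h)).ne'
  · rw [hX i j (fun h' => h h'.1)]; rfl

/-- Strictly lower triangular triples act with strictly larger norm than their adjoints on a
tensor with regular decreasing diagonal marginals. -/
theorem nsq_act_star_lt {ψ : Ten a b c} {q : Spec3 a b c} (hψ : rho ψ = diag3 q)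
    (hq : StrictAnti3 q) {HA : Fin a → ℝ} {HB : Fin b → ℝ} {HC : Fin c → ℝ} {X : Mat3 a b c}
    (hX : X ∈ nMinusMod HA HB HC) (h0 : X ≠ 0) : nsq (act (star X) ψ) < nsq (act X ψ) := by
  have h := nsq_act_sub_nsq_act_star hψ X
  have hA := offWeight_nonneg hq.1 hX.1
  have hB := offWeight_nonneg hq.2.1 hX.2.1
  have hC := offWeight_nonneg hq.2.2 hX.2.2
  by_contra! hle
  refine h0 (Prod.ext (eq_zero_of_offWeight hq.1 hX.1 ?_) (Prod.ext
    (eq_zero_of_offWeight hq.2.1 hX.2.1 ?_) (eq_zero_of_offWeight hq.2.2 hX.2.2 ?_))) <;> linarith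

theorem act_injOn_nMinusMod {ψ : Ten a b c} {q : Spec3 a b c} (hψ : rho ψ = diag3 q)
    (hq : StrictAnti3 q) {HA : Fin a → ℝ} {HB : Fin b → ℝ} {HC : Fin c → ℝ} {X : Mat3 a b c}
    (hX : X ∈ nMinusMod HA HB HC) (h0 : act X ψ = 0) : X = 0 := by
  by_contra h
  have h1 := nsq_act_star_lt hψ hq hX h
  rw [h0] at h1
  have h2 := nsq_nonneg (act (star X) ψ)
  have : nsq (0 : Ten a b c) = 0 := by simp [nsq]
  linarith

end

section

open Matrix

variable {a b c : ℕ}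

theorem exists_perm_of_map_eq {n : ℕ} {α : Type*} [LinearOrder α] {f g : Fin n → α}
    (h : Multiset.map f Finset.univ.val = Multiset.map g Finset.univ.val) :
    ∃ σ : Equiv.Perm (Fin n), f = g ∘ σ := by
  have hp : (List.ofFn f).Perm (List.ofFn g) := by
    rw [Fin.univ_val_map, Fin.univ_val_map] at h
    exact Multiset.coe_eq_coe.1 h
  have h1 : f ∘ Tuple.sort f = g ∘ Tuple.sort g := by
    apply List.ofFn_injective
    exact ((((Tuple.sort f).ofFn_comp_perm f).trans hp).trans
      ((Tuple.sort g).ofFn_comp_perm g).symm).eq_of_pairwise'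
      (Tuple.monotone_sort f).sortedLE_ofFn.pairwise (Tuple.monotone_sort g).sortedLE_ofFn.pairwise
  refine ⟨(Tuple.sort f).symm.trans (Tuple.sort g), ?_⟩
  funext i
  have := congrFun h1 ((Tuple.sort f).symm i)
  simpa using this

theorem isSpecDown_of_conj {n : ℕ} {ρ W : Matrix (Fin n) (Fin n) ℂ} {lam : Fin n → ℝ}
    (hW : Wᴴ * W = 1) (h : W * ρ * Wᴴ = Matrix.diagonal fun i => (lam i : ℂ))
    (hl : Antitone lam) : IsSpecDown ρ lam := by
  have hρ : ρ = Wᴴ * Matrix.diagonal (fun i => (lam i : ℂ)) * W := by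
    rw [← h, show Wᴴ * (W * ρ * Wᴴ) * W = (Wᴴ * W) * ρ * (Wᴴ * W) by
      simp only [Matrix.mul_assoc], hW, Matrix.one_mul, Matrix.mul_one]
  have hd : (Matrix.diagonal fun i => (lam i : ℂ)).IsHermitian := by
    rw [Matrix.isHermitian_diagonal_iff]
    intro i; simp [IsSelfAdjoint]
  have hH : ρ.IsHermitian := by
    rw [hρ]
    exact Matrix.isHermitian_conjTranspose_mul_mul W hd
  refine ⟨hl, hH, exists_perm_of_map_eq ?_⟩
  have h1 := hH.roots_charpoly_eq_eigenvalues
  have h2 : ρ.charpoly = ∏ i, (Polynomial.X - Polynomial.C (lam i : ℂ)) := by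
    rw [← Matrix.charpoly_diagonal, ← h, Matrix.mul_assoc, Matrix.charpoly_mul_comm,
      Matrix.mul_assoc, hW, Matrix.mul_one]
  rw [h2, Polynomial.roots_prod _ _
    (Finset.prod_ne_zero_iff.2 fun i _ => Polynomial.X_sub_C_ne_zero _)] at h1
  simp only [Polynomial.roots_X_sub_C, Multiset.bind_singleton] at h1
  have h3 := congrArg (Multiset.map Complex.re) h1
  simpa [Multiset.map_map, Function.comp_def] using h3

theorem IsSpecDown.exists_unitary {n : ℕ} {ρ : Matrix (Fin n) (Fin n) ℂ} {lam : Fin n → ℝ}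
    (h : IsSpecDown ρ lam) : ∃ W : Matrix (Fin n) (Fin n) ℂ, Wᴴ * W = 1 ∧ W * Wᴴ = 1 ∧
      W * ρ * Wᴴ = Matrix.diagonal fun i => (lam i : ℂ) := by
  obtain ⟨-, hρ, σ, rfl⟩ := h
  let U : Matrix (Fin n) (Fin n) ℂ := (hρ.eigenvectorUnitary : Matrix (Fin n) (Fin n) ℂ)
  have hU : Uᴴ * U = 1 := Unitary.coe_star_mul_self hρ.eigenvectorUnitary
  have hU' : U * Uᴴ = 1 := Unitary.coe_mul_star_self hρ.eigenvectorUnitary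
  have hD : Uᴴ * ρ * U = Matrix.diagonal fun i => (hρ.eigenvalues i : ℂ) := by
    have := hρ.conjStarAlgAut_star_eigenvectorUnitary
    rw [Unitary.conjStarAlgAut_star_apply] at this
    exact this
  have hW2 : (Uᴴ.submatrix σ id) * (Uᴴ.submatrix σ id)ᴴ = 1 := by
    rw [Matrix.conjTranspose_submatrix, Matrix.conjTranspose_conjTranspose,
      ← Matrix.submatrix_one_equiv σ, ← hU]
    rfl
  refine ⟨Uᴴ.submatrix σ id, mul_eq_one_comm.1 hW2, hW2, ?_⟩
  have : (Uᴴ.submatrix σ id) * ρ * (Uᴴ.submatrix σ id)ᴴ = (Uᴴ * ρ * U).submatrix σ σ := by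
    rw [Matrix.conjTranspose_submatrix, Matrix.conjTranspose_conjTranspose]
    rfl
  rw [this, hD, Matrix.submatrix_diagonal_equiv]
  rfl

theorem exists_isSpecDown {n : ℕ} {ρ : Matrix (Fin n) (Fin n) ℂ} (hρ : ρ.IsHermitian) :
    ∃ lam, IsSpecDown ρ lam := by
  refine ⟨hρ.eigenvalues ∘ (Tuple.sort hρ.eigenvalues) ∘ Fin.rev, ?_, hρ,
    Fin.revPerm.trans (Tuple.sort hρ.eigenvalues), rfl⟩
  intro i j hij
  exact Tuple.monotone_sort hρ.eigenvalues (Fin.rev_le_rev.2 hij)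

theorem IsSpecDown.unique {n : ℕ} {ρ : Matrix (Fin n) (Fin n) ℂ} {lam mu : Fin n → ℝ}
    (h : IsSpecDown ρ lam) (h' : IsSpecDown ρ mu) : lam = mu := by
  obtain ⟨hl, hρ, σ, rfl⟩ := h
  obtain ⟨hm, _, τ, rfl⟩ := h'
  exact Tuple.unique_antitone hl hm

theorem rho_gact {U : Mat3 a b c} (hU : star U * U = 1) (ψ : Ten a b c) :
    rho (gact U ψ) = U * rho ψ * star U := by
  have hA : U.1ᴴ * U.1 = 1 := congrArg Prod.fst hU
  have hB : U.2.1ᴴ * U.2.1 = 1 := congrArg (fun Z => Z.2.1) hU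
  have hC : U.2.2ᴴ * U.2.2 = 1 := congrArg (fun Z => Z.2.2) hU
  exact Prod.ext (rhoA_gact _ _ _ _ hB hC)
    (Prod.ext (rhoB_gact _ _ _ _ hA hC) (rhoC_gact _ _ _ _ hA hB))

/-- A triple of unitaries diagonalises the three marginals of a tensor. -/
theorem exists_unitary_of_isSpecDown {ψ : Ten a b c} {q : Spec3 a b c}
    (hA : IsSpecDown (rhoA ψ) q.1) (hB : IsSpecDown (rhoB ψ) q.2.1)
    (hC : IsSpecDown (rhoC ψ) q.2.2) :
    ∃ U : Mat3 a b c, star U * U = 1 ∧ U * star U = 1 ∧ rho (gact U ψ) = diag3 q := by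
  obtain ⟨U, hU, hU', hUd⟩ := hA.exists_unitary
  obtain ⟨V, hV, hV', hVd⟩ := hB.exists_unitary
  obtain ⟨W, hW, hW', hWd⟩ := hC.exists_unitary
  have h : star (U, V, W) * (U, V, W) = (1 : Mat3 a b c) :=
    Prod.ext hU (Prod.ext hV hW)
  refine ⟨(U, V, W), h, Prod.ext hU' (Prod.ext hV' hW'), ?_⟩
  rw [rho_gact h]
  exact Prod.ext hUd (Prod.ext hVd hWd)

theorem isSpecDown_of_unitary {ψ : Ten a b c} {q : Spec3 a b c} {U : Mat3 a b c}
    (hU : star U * U = 1) (hq : Antitone3 q) (h : U * rho ψ * star U = diag3 q) :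
    IsSpecDown (rhoA ψ) q.1 ∧ IsSpecDown (rhoB ψ) q.2.1 ∧ IsSpecDown (rhoC ψ) q.2.2 :=
  ⟨isSpecDown_of_conj (W := U.1) (congrArg Prod.fst hU) (congrArg Prod.fst h) hq.1,
    isSpecDown_of_conj (W := U.2.1) (congrArg (fun Z => Z.2.1) hU)
      (congrArg (fun Z => Z.2.1) h) hq.2.1,
    isSpecDown_of_conj (W := U.2.2) (congrArg (fun Z => Z.2.2) hU)
      (congrArg (fun Z => Z.2.2) h) hq.2.2⟩

/-- Up to local unitaries, the tensors realising a point of the Kronecker cone have diagonal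
marginals. -/
theorem mem_kronCone_iff {q : Spec3 a b c} :
    q ∈ KronCone a b c ↔ Antitone3 q ∧ ∃ ψ : Ten a b c, rho ψ = diag3 q := by
  constructor
  · rintro ⟨ψ, hA, hB, hC⟩
    obtain ⟨U, -, -, h⟩ := exists_unitary_of_isSpecDown hA hB hC
    exact ⟨⟨hA.1, hB.1, hC.1⟩, _, h⟩
  · rintro ⟨hq, ψ, h⟩
    exact ⟨ψ, isSpecDown_of_unitary (U := 1) (by simp) hq (by simpa using h)⟩

theorem exists_gact_diag3 (ψ : Ten a b c) : ∃ (q : Spec3 a b c) (U : Mat3 a b c),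
    Antitone3 q ∧ star U * U = 1 ∧ U * star U = 1 ∧ rho (gact U ψ) = diag3 q := by
  obtain ⟨x, hx⟩ := exists_isSpecDown (rhoA_isHermitian ψ)
  obtain ⟨y, hy⟩ := exists_isSpecDown (rhoB_isHermitian ψ)
  obtain ⟨z, hz⟩ := exists_isSpecDown (rhoC_isHermitian ψ)
  obtain ⟨U, h1, h2, h3⟩ := exists_unitary_of_isSpecDown (q := (x, y, z)) hx hy hz
  exact ⟨(x, y, z), U, ⟨hx.1, hy.1, hz.1⟩, h1, h2, h3⟩

theorem sum_eq_nsq {ψ : Ten a b c} {q : Spec3 a b c} (h : rho ψ = diag3 q) :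
    ∑ i, q.1 i = nsq ψ ∧ ∑ i, q.2.1 i = nsq ψ ∧ ∑ i, q.2.2 i = nsq ψ := by
  have hA := dotProduct_eq_trace_flatA ψ ψ
  have hB := dotProduct_eq_trace_flatB ψ ψ
  have hC := dotProduct_eq_trace_flatC ψ ψ
  rw [star_dotProduct_self] at hA hB hC
  rw [← rhoA_eq_flat, show rhoA ψ = _ from congrArg Prod.fst h] at hA
  rw [← rhoB_eq_flat, show rhoB ψ = _ from congrArg (fun Z => Z.2.1) h] at hB
  rw [← rhoC_eq_flat, show rhoC ψ = _ from congrArg (fun Z => Z.2.2) h] at hC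
  simp only [diag3, Matrix.trace_diagonal] at hA hB hC
  exact ⟨by exact_mod_cast hA.symm, by exact_mod_cast hB.symm, by exact_mod_cast hC.symm⟩

theorem continuous_rho : Continuous (rho : Ten a b c → Mat3 a b c) := by
  unfold rho rhoA rhoB rhoC
  refine Continuous.prodMk ?_ (Continuous.prodMk ?_ ?_) <;>
  · refine continuous_matrix fun i j => ?_
    simp only [Matrix.of_apply]
    fun_prop

theorem continuous_diag3 : Continuous (diag3 : Spec3 a b c → Mat3 a b c) := by
  unfold diag3
  fun_prop

theorem norm_sq_le_nsq (ψ : Ten a b c) : ‖ψ‖ ^ 2 ≤ nsq ψ := by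
  have : ‖ψ‖ ≤ Real.sqrt (nsq ψ) := by
    rw [pi_norm_le_iff_of_nonneg (Real.sqrt_nonneg _)]
    intro p
    refine Real.le_sqrt_of_sq_le ?_
    rw [← Complex.normSq_eq_norm_sq]
    exact Finset.single_le_sum (f := fun p => Complex.normSq (ψ p))
      (fun p _ => Complex.normSq_nonneg _) (Finset.mem_univ p)
  calc ‖ψ‖ ^ 2 ≤ Real.sqrt (nsq ψ) ^ 2 := by gcongr
    _ = nsq ψ := Real.sq_sqrt (nsq_nonneg ψ)

theorem isClosed_antitone3 : IsClosed {q : Spec3 a b c | Antitone3 q} := by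
  have h1 (n : ℕ) : IsClosed {f : Fin n → ℝ | Antitone f} := by
    have : {f : Fin n → ℝ | Antitone f} = ⋂ i, ⋂ j, ⋂ _ : i ≤ j, {f | f j ≤ f i} := by
      ext f; simp [Antitone]
    rw [this]
    exact isClosed_iInter fun i => isClosed_iInter fun j => isClosed_iInter fun _ =>
      isClosed_le (continuous_apply j) (continuous_apply i)
  exact ((h1 a).preimage continuous_fst).inter
    (((h1 b).preimage (continuous_fst.comp continuous_snd)).inter
      ((h1 c).preimage (continuous_snd.comp continuous_snd)))

/-- A sequence of tensors with convergent diagonal marginals subconverges. -/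
theorem exists_subseq_tendsto {ψ : ℕ → Ten a b c} {R : ℝ} (hR : ∀ n, nsq (ψ n) ≤ R) :
    ∃ (φ : Ten a b c) (k : ℕ → ℕ), StrictMono k ∧
      Filter.Tendsto (ψ ∘ k) Filter.atTop (nhds φ) := by
  have hb : ∀ n, ψ n ∈ Metric.closedBall (0 : Ten a b c) (Real.sqrt R) := by
    intro n
    rw [mem_closedBall_zero_iff]
    exact Real.le_sqrt_of_sq_le ((norm_sq_le_nsq _).trans (hR n))
  obtain ⟨φ, -, k, hk, ht⟩ := tendsto_subseq_of_bounded Metric.isBounded_closedBall hb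
  exact ⟨φ, k, hk, ht⟩

theorem isClosed_kronCone : IsClosed (KronCone a b c) := by
  refine IsSeqClosed.isClosed fun x y hx hy => ?_
  simp only [mem_kronCone_iff] at hx ⊢
  choose hanti ψ hψ using hx
  refine ⟨isClosed_antitone3.mem_of_tendsto hy (Filter.Eventually.of_forall hanti), ?_⟩
  have hs : Filter.Tendsto (fun n => nsq (ψ n)) Filter.atTop (nhds (∑ i, y.1 i)) := by
    simp only [fun n => (sum_eq_nsq (hψ n)).1.symm]
    exact ((continuous_finsetSum _ fun i _ =>
      (continuous_apply i).comp continuous_fst : Continuous fun q : Spec3 a b c =>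
        ∑ i, q.1 i).tendsto y).comp hy
  obtain ⟨R, hR⟩ := hs.bddAbove_range
  obtain ⟨φ, k, hk, ht⟩ := exists_subseq_tendsto (fun n => hR (Set.mem_range_self n))
  refine ⟨φ, ?_⟩
  have h1 := (continuous_rho.tendsto φ).comp ht
  have h2 := ((continuous_diag3.tendsto y).comp hy).comp hk.tendsto_atTop
  refine tendsto_nhds_unique h1 (h2.congr fun n => ?_)
  simp [hψ]

end

section

open Matrix Filter Topology

variable {a b c : ℕ}

/-- A continuously differentiable map whose directional derivatives at a point form a surjective
linear map is open at that point. -/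
theorem map_nhds_eq_of_directional {E F : Type*} [NormedAddCommGroup E] [NormedSpace ℝ E]
    [NormedAddCommGroup F] [NormedSpace ℝ F] [FiniteDimensional ℝ E] [FiniteDimensional ℝ F]
    {f : E → F} (hf : ContDiff ℝ 1 f) {x : E} {L : E → F} (hL : Function.Surjective L)
    (hd : ∀ v, HasDerivAt (fun t : ℝ => f (x + t • v)) (L v) 0) : map f (𝓝 x) = 𝓝 (f x) := by
  have : CompleteSpace E := FiniteDimensional.complete ℝ E
  have : CompleteSpace F := FiniteDimensional.complete ℝ F
  have h1 := hf.contDiffAt.hasStrictFDerivAt (x := x) one_ne_zero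
  refine h1.map_nhds_eq_of_surj ?_
  rw [LinearMap.range_eq_top]
  intro y
  obtain ⟨v, rfl⟩ := hL y
  refine ⟨v, ?_⟩
  have h2 : HasDerivAt (fun t : ℝ => x + t • v) v 0 := by
    simpa using ((hasDerivAt_id (0 : ℝ)).smul_const v).const_add x
  have h3 : HasFDerivAt f (fderiv ℝ f x) (x + (0 : ℝ) • v) := by
    simpa using h1.hasFDerivAt
  exact (h3.comp_hasDerivAt (0 : ℝ) h2).unique (hd v)

/-- `drho` as a real-linear map. -/
def drhoL (ψ : Ten a b c) : Ten a b c →ₗ[ℝ] Mat3 a b c where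
  toFun := drho ψ
  map_add' := drho_add ψ
  map_smul' r w := drho_smul r ψ w

theorem hasDerivAt_quadratic {E : Type*} [NormedAddCommGroup E] [NormedSpace ℝ E] (x y z : E) :
    HasDerivAt (fun t : ℝ => x + t • y + t ^ 2 • z) y 0 := by
  have h1 : HasDerivAt (fun t : ℝ => x + t • y) y 0 := by
    simpa using ((hasDerivAt_id (0 : ℝ)).smul_const y).const_add x
  have h2 : HasDerivAt (fun t : ℝ => t ^ 2 • z) 0 0 := by
    simpa using ((hasDerivAt_id (0 : ℝ)).pow 2).smul_const z
  simpa using! h1.add h2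

theorem rho_add_smul (ψ v : Ten a b c) (t : ℝ) :
    rho (ψ + t • v) = rho ψ + t • drho ψ v + t ^ 2 • rho v := by
  rw [rho_add, drho_smul, rho_smul]

/-- The real part of the trace pairing with a fixed triple of matrices. -/
def reTr (w : Mat3 a b c) : Mat3 a b c →ₗ[ℝ] ℝ where
  toFun Δ := (tr3 (w * Δ)).re
  map_add' v w := by rw [mul_add, tr3_add, Complex.add_re]
  map_smul' r w := by rw [mul_smul_comm, tr3_smul]; simp

theorem reTr_apply (w Δ : Mat3 a b c) : reTr w Δ = (tr3 (w * Δ)).re := rfl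

theorem reTr_comm (w Δ : Mat3 a b c) : reTr w Δ = reTr Δ w := by
  rw [reTr_apply, reTr_apply, tr3_mul_comm]

/-- The trace pairing against a basis of the range of `drho ψ`. -/
def pairRange (ψ : Ten a b c) :
    Mat3 a b c →ₗ[ℝ] (Fin (Module.finrank ℝ (LinearMap.range (drhoL ψ))) → ℝ) :=
  LinearMap.pi fun i =>
    reTr (Module.finBasis ℝ (LinearMap.range (drhoL ψ)) i : Mat3 a b c)

theorem reTr_drho_of_pairRange {ψ : Ten a b c} {Δ : Mat3 a b c} (h : pairRange ψ Δ = 0)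
    (v : Ten a b c) : reTr Δ (drho ψ v) = 0 := by
  have h1 : (reTr Δ).comp (LinearMap.range (drhoL ψ)).subtype = 0 := by
    refine (Module.finBasis ℝ (LinearMap.range (drhoL ψ))).ext fun i => ?_
    exact (reTr_comm _ _).trans (congrFun h i)
  exact LinearMap.congr_fun h1 ⟨drhoL ψ v, v, rfl⟩

theorem eq_zero_of_re_tr3_star_mul {S : Mat3 a b c} (h : (tr3 (star S * S)).re = 0) : S = 0 := by
  have hn {n : ℕ} (M : Matrix (Fin n) (Fin n) ℂ) :
      ((Mᴴ * M).trace).re = ∑ i, ∑ j, Complex.normSq (M j i) := by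
    simp [Matrix.trace, Matrix.mul_apply, Complex.normSq_apply]
  have h0 {n : ℕ} (M : Matrix (Fin n) (Fin n) ℂ) : 0 ≤ ((Mᴴ * M).trace).re := by
    rw [hn]; exact Finset.sum_nonneg fun _ _ => Finset.sum_nonneg fun _ _ => Complex.normSq_nonneg _
  have hz {n : ℕ} {M : Matrix (Fin n) (Fin n) ℂ} (hM : ((Mᴴ * M).trace).re = 0) : M = 0 := by
    rw [hn] at hM
    ext j i
    have h1 := (Finset.sum_eq_zero_iff_of_nonneg fun i _ =>
      Finset.sum_nonneg fun j _ => Complex.normSq_nonneg (M j i)).1 hM i (Finset.mem_univ i)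
    have h2 := (Finset.sum_eq_zero_iff_of_nonneg fun j _ =>
      Complex.normSq_nonneg (M j i)).1 h1 j (Finset.mem_univ j)
    simpa using h2
  have hs : ((S.1ᴴ * S.1).trace).re + ((S.2.1ᴴ * S.2.1).trace).re
      + ((S.2.2ᴴ * S.2.2).trace).re = 0 := h
  have hA := h0 S.1
  have hB := h0 S.2.1
  have hC := h0 S.2.2
  exact Prod.ext (hz (by linarith)) (Prod.ext (hz (by linarith)) (hz (by linarith)))

theorem pairRange_drho_surjective (ψ : Ten a b c) :
    Function.Surjective fun v => pairRange ψ (drho ψ v) := by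
  let K := (pairRange ψ).comp (LinearMap.range (drhoL ψ)).subtype
  have hinj : Function.Injective K := by
    rw [injective_iff_map_eq_zero]
    rintro ⟨w, v, rfl⟩ hw
    have h2 : (tr3 (drho ψ v * drho ψ v)).re = 0 := reTr_drho_of_pairRange hw v
    refine Subtype.ext (eq_zero_of_re_tr3_star_mul (S := drho ψ v) ?_)
    rw [star_drho, h2]
  have hdim : Module.finrank ℝ (LinearMap.range (drhoL ψ))
      = Module.finrank ℝ (Fin (Module.finrank ℝ (LinearMap.range (drhoL ψ))) → ℝ) := by
    simp
  have hsurj := (LinearMap.injective_iff_surjective_of_finrank_eq_finrank (f := K) hdim).1 hinj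
  intro ℓ
  obtain ⟨⟨w, v, rfl⟩, hw⟩ := hsurj ℓ
  exact ⟨v, hw⟩

theorem act_eq_zero_of_pairRange {ψ : Ten a b c} {Δ : Mat3 a b c} (hΔ : star Δ = Δ)
    (h : pairRange ψ Δ = 0) : act Δ ψ = 0 := by
  have h1 := two_re_dotProduct_act (act Δ ψ) ψ hΔ
  have h2 : (tr3 (Δ * drho ψ (act Δ ψ))).re = 0 := reTr_drho_of_pairRange h _
  rw [tr3_mul_comm, h2, star_dotProduct_self, Complex.ofReal_re] at h1
  exact nsq_eq_zero (by linarith)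

theorem contDiff_pairRange_rho (ψ : Ten a b c) {E : Type*} [NormedAddCommGroup E]
    [NormedSpace ℝ E] {f : E → Ten a b c} (hf : ContDiff ℝ 1 f) :
    ContDiff ℝ 1 fun x => pairRange ψ (rho (f x)) := by
  have hr (w : Mat3 a b c) (φ : Ten a b c) : reTr w (rho φ) = (star φ ⬝ᵥ act w φ).re := by
    rw [reTr_comm, reTr_apply, dotProduct_act, rho_eq_rhoBil]
  have hp (p) : ContDiff ℝ 1 fun x => f x p := contDiff_pi.1 hf p
  refine contDiff_pi.2 fun i => ?_
  simp only [pairRange, LinearMap.pi_apply, hr]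
  refine Complex.reCLM.contDiff.comp ?_
  simp only [dotProduct, act, Pi.star_apply]
  refine ContDiff.sum fun p _ => ContDiff.mul (Complex.conjCLE.contDiff.comp (hp p)) ?_
  refine ((ContDiff.sum fun q _ => ?_).add (ContDiff.sum fun q _ => ?_)).add
    (ContDiff.sum fun q _ => ?_) <;> exact contDiff_const.mul (hp _)

theorem contDiff_pairRange_drho (ψ : Ten a b c) {E : Type*} [NormedAddCommGroup E]
    [NormedSpace ℝ E] {f g : E → Ten a b c} (hf : ContDiff ℝ 1 f) (hg : ContDiff ℝ 1 g) :
    ContDiff ℝ 1 fun x => pairRange ψ (drho (f x) (g x)) := by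
  have h (x) : pairRange ψ (drho (f x) (g x)) = pairRange ψ (rho (f x + g x))
      - pairRange ψ (rho (f x)) - pairRange ψ (rho (g x)) := by
    rw [rho_add, map_add, map_add]; abel
  simp only [h]
  exact ((contDiff_pairRange_rho ψ (hf.add hg)).sub (contDiff_pairRange_rho ψ hf)).sub
    (contDiff_pairRange_rho ψ hg)

/-- The projected moment map is open. -/
theorem map_pairRange_rho_nhds (ψ : Ten a b c) :
    map (fun φ => pairRange ψ (rho φ)) (𝓝 ψ) = 𝓝 (pairRange ψ (rho ψ)) := by
  refine map_nhds_eq_of_directional (contDiff_pairRange_rho ψ (f := fun x => x) contDiff_id)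
    (pairRange_drho_surjective ψ) fun v => ?_
  change HasDerivAt (fun t : ℝ => pairRange ψ (rho (ψ + t • v))) (pairRange ψ (drho ψ v)) 0
  simp only [rho_add_smul, map_add, map_smul]
  exact hasDerivAt_quadratic _ _ _

end

section

open Matrix Filter Topology

variable {a b c : ℕ}

/-- The value of a triple of real vectors at an index of the tensor, that is, its pairing with the
corresponding weight. -/
def ev (h : Spec3 a b c) (p : Fin a × Fin b × Fin c) : ℝ := h.1 p.1 + h.2.1 p.2.1 + h.2.2 p.2.2

/-- The weight of a standard basis vector. -/
def omega (p : Fin a × Fin b × Fin c) : Spec3 a b c :=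
  (Pi.single p.1 1, Pi.single p.2.1 1, Pi.single p.2.2 1)

/-- The Euclidean pairing of triples of real vectors, as a linear functional. -/
def ip3 (h : Spec3 a b c) : Spec3 a b c →ₗ[ℝ] ℝ where
  toFun q := h.1 ⬝ᵥ q.1 + h.2.1 ⬝ᵥ q.2.1 + h.2.2 ⬝ᵥ q.2.2
  map_add' x y := by
    simp only [Prod.fst_add, Prod.snd_add, dotProduct_add]; ring
  map_smul' r x := by
    simp only [Prod.smul_fst, Prod.smul_snd, dotProduct_smul, smul_eq_mul, RingHom.id_apply]; ring

theorem ip3_apply (h q : Spec3 a b c) :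
    ip3 h q = h.1 ⬝ᵥ q.1 + h.2.1 ⬝ᵥ q.2.1 + h.2.2 ⬝ᵥ q.2.2 := rfl

theorem ip3_omega (h : Spec3 a b c) (p) : ip3 h (omega p) = ev h p := by
  simp [ip3_apply, omega, ev]

theorem eq_zero_of_ip3_self {h : Spec3 a b c} (h0 : ip3 h h = 0) : h = 0 := by
  have hp {n : ℕ} (x : Fin n → ℝ) : 0 ≤ x ⬝ᵥ x :=
    Finset.sum_nonneg fun i _ => mul_self_nonneg _
  rw [ip3_apply] at h0
  have hA := hp h.1
  have hB := hp h.2.1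
  have hC := hp h.2.2
  exact Prod.ext (dotProduct_self_eq_zero.1 (by linarith))
    (Prod.ext (dotProduct_self_eq_zero.1 (by linarith)) (dotProduct_self_eq_zero.1 (by linarith)))

variable (a b c) in
/-- The triples of vectors with equal sums. -/
def eqSum : Submodule ℝ (Spec3 a b c) where
  carrier := {q | ∑ i, q.1 i = ∑ j, q.2.1 j ∧ ∑ i, q.1 i = ∑ k, q.2.2 k}
  add_mem' {x y} hx hy := by
    simp only [Set.mem_ofPred_eq, Prod.fst_add, Prod.snd_add, Pi.add_apply,
      Finset.sum_add_distrib] at *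
    exact ⟨by rw [hx.1, hy.1], by rw [hx.2, hy.2]⟩
  zero_mem' := by simp
  smul_mem' r x hx := by
    simp only [Set.mem_ofPred_eq, Prod.smul_fst, Prod.smul_snd, Pi.smul_apply, smul_eq_mul,
      ← Finset.mul_sum] at *
    exact ⟨by rw [hx.1], by rw [hx.2]⟩

theorem mem_eqSum {q : Spec3 a b c} :
    q ∈ eqSum a b c ↔ ∑ i, q.1 i = ∑ j, q.2.1 j ∧ ∑ i, q.1 i = ∑ k, q.2.2 k := Iff.rfl

theorem omega_mem_eqSum (p : Fin a × Fin b × Fin c) : omega p ∈ eqSum a b c := by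
  simp [mem_eqSum, omega]

theorem eqSum_of_rho {ψ : Ten a b c} {q : Spec3 a b c} (h : rho ψ = diag3 q) :
    q ∈ eqSum a b c := by
  obtain ⟨h1, h2, h3⟩ := sum_eq_nsq h
  exact ⟨h1.trans h2.symm, h1.trans h3.symm⟩

theorem act_diag3 (h : Spec3 a b c) (ψ : Ten a b c) (p) :
    act (diag3 h) ψ p = (ev h p : ℂ) * ψ p := by
  simp only [act, diag3, Matrix.diagonal_apply, ite_mul, zero_mul, Finset.sum_ite_eq,
    Finset.mem_univ, if_true, ev]
  push_cast; ring

theorem tr3_diag3_mul_diag3 (q h : Spec3 a b c) : tr3 (diag3 q * diag3 h) = (ip3 h q : ℂ) := by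
  simp only [tr3, diag3, Prod.mk_mul_mk, Matrix.diagonal_mul_diagonal, Matrix.trace_diagonal,
    ip3_apply, dotProduct]
  push_cast
  simp only [mul_comm]

theorem star_dotProduct_act_diag3 (ψ : Ten a b c) (h : Spec3 a b c) :
    star ψ ⬝ᵥ act (diag3 h) ψ = ((∑ p, ev h p * Complex.normSq (ψ p) : ℝ) : ℂ) := by
  simp only [dotProduct, act_diag3, Pi.star_apply]
  push_cast
  refine Finset.sum_congr rfl fun p _ => ?_
  rw [Complex.normSq_eq_conj_mul_self]
  simp only [RCLike.star_def]; ring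

/-- The pairing of the spectra with `h` is the expectation value of `h`. -/
theorem ip3_eq_sum {ψ : Ten a b c} {q : Spec3 a b c} (hψ : rho ψ = diag3 q) (h : Spec3 a b c) :
    ip3 h q = ∑ p, ev h p * Complex.normSq (ψ p) := by
  have h1 := dotProduct_act ψ ψ (diag3 h)
  rw [star_dotProduct_act_diag3, ← rho_eq_rhoBil, hψ, tr3_diag3_mul_diag3] at h1
  exact_mod_cast h1.symm

theorem isOpen_strictAnti3 : IsOpen {q : Spec3 a b c | StrictAnti3 q} := by
  have h {n : ℕ} {f : Spec3 a b c → Fin n → ℝ} (hf : Continuous f) :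
      IsOpen {q | StrictAnti (f q)} := by
    have : {q | StrictAnti (f q)} = ⋂ i, ⋂ j, {q | i < j → f q j < f q i} := by
      ext q; simp [StrictAnti]
    rw [this]
    refine isOpen_iInter_of_finite fun i => isOpen_iInter_of_finite fun j => ?_
    by_cases hij : i < j
    · simp only [hij, true_imp_iff]
      exact isOpen_lt (by fun_prop) (by fun_prop)
    · simp [hij]
  exact (h continuous_fst).inter ((h (by fun_prop)).inter (h (by fun_prop)))

/-- The real diagonals of a triple of matrices. -/
def reDiag (R : Mat3 a b c) : Spec3 a b c :=
  (fun i => (R.1 i i).re, fun i => (R.2.1 i i).re, fun i => (R.2.2 i i).re)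

theorem reDiag_diag3 (q : Spec3 a b c) : reDiag (diag3 q) = q := by
  simp [reDiag, diag3]

theorem continuous_reDiag : Continuous (reDiag : Mat3 a b c → Spec3 a b c) := by
  unfold reDiag
  fun_prop

theorem IsDiag3.eq_diag3 {R : Mat3 a b c} (hR : IsDiag3 R) (hs : star R = R) :
    R = diag3 (reDiag R) := by
  have h {n : ℕ} {M : Matrix (Fin n) (Fin n) ℂ} (hM : M.IsDiag) (hH : Mᴴ = M) :
      M = Matrix.diagonal fun i => ((M i i).re : ℂ) := by
    ext i j
    rcases eq_or_ne i j with rfl | hij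
    · have := congrFun (congrFun hH i) i
      rw [Matrix.conjTranspose_apply] at this
      rw [Matrix.diagonal_apply_eq]
      exact (Complex.conj_eq_iff_re.1 this).symm
    · rw [Matrix.diagonal_apply_ne _ hij, hM hij]
  exact Prod.ext (h hR.1 (congrArg Prod.fst hs)) (Prod.ext (h hR.2.1 (congrArg (fun Z => Z.2.1) hs))
    (h hR.2.2 (congrArg (fun Z => Z.2.2) hs)))

theorem star_diag3 (q : Spec3 a b c) : star (diag3 q) = diag3 q := by
  have h {n : ℕ} (x : Fin n → ℝ) : (Matrix.diagonal fun i => (x i : ℂ))ᴴ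
      = Matrix.diagonal fun i => (x i : ℂ) := by
    rw [Matrix.diagonal_conjTranspose]
    congr 1
    ext i
    simp
  exact Prod.ext (h _) (Prod.ext (h _) (h _))

theorem isDiag3_diag3 (q : Spec3 a b c) : IsDiag3 (diag3 q) :=
  ⟨Matrix.isDiag_diagonal _, Matrix.isDiag_diagonal _, Matrix.isDiag_diagonal _⟩

theorem diag3_sub (q r : Spec3 a b c) : diag3 (q - r) = diag3 q - diag3 r := by
  have h {n : ℕ} (x y : Fin n → ℝ) : (Matrix.diagonal fun i => ((x - y) i : ℂ))
      = (Matrix.diagonal fun i => (x i : ℂ)) - Matrix.diagonal fun i => (y i : ℂ) := by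
    rw [Matrix.diagonal_sub]
    congr 1
    ext i
    simp
  exact Prod.ext (h _ _) (Prod.ext (h _ _) (h _ _))

/-- Marginals agreeing with a diagonal triple along the range of the derivative are diagonal. -/
theorem exists_diag3_of_pairRange {ψ φ : Ten a b c} {q μ : Spec3 a b c} (hψ : rho ψ = diag3 q)
    (hq : StrictAnti3 q) (h : pairRange ψ (rho φ) = pairRange ψ (diag3 μ)) :
    ∃ μ', rho φ = diag3 μ' ∧ ∀ p, ψ p ≠ 0 → ev (μ' - μ) p = 0 := by
  have hs : star (rho φ - diag3 μ) = rho φ - diag3 μ := by rw [star_sub, star_rho, star_diag3]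
  have h0 := act_eq_zero_of_pairRange hs (ψ := ψ) (by rw [map_sub, h, sub_self])
  have hd := isDiag3_of_act_eq_zero hψ hq hs h0
  have hd' : IsDiag3 (rho φ) := by
    have e : rho φ = (rho φ - diag3 μ) + diag3 μ := by abel
    rw [e]
    have hm := isDiag3_diag3 μ
    exact ⟨hd.1.add hm.1, hd.2.1.add hm.2.1, hd.2.2.add hm.2.2⟩
  refine ⟨reDiag (rho φ), hd'.eq_diag3 (star_rho φ), fun p hp => ?_⟩
  rw [hd'.eq_diag3 (star_rho φ), ← diag3_sub] at h0
  have h1 := congrFun h0 p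
  rw [act_diag3] at h1
  rcases mul_eq_zero.1 h1 with h2 | h2
  · exact_mod_cast h2
  · exact absurd h2 hp

theorem ip3_eq_zero_of_le_span {s : Set (Fin a × Fin b × Fin c)} {δ : Spec3 a b c}
    (h : ∀ p ∈ s, ev δ p = 0) {x : Spec3 a b c} (hx : x ∈ Submodule.span ℝ (omega '' s)) :
    ip3 δ x = 0 := by
  have : Submodule.span ℝ (omega '' s) ≤ LinearMap.ker (ip3 δ) := by
    rw [Submodule.span_le]
    rintro _ ⟨p, hp, rfl⟩
    exact (ip3_omega δ p).trans (h p hp)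
  exact this hx

/-- A regular point whose support spans is interior to the Kronecker cone. -/
theorem eventually_mem_of_support {ψ : Ten a b c} {q : Spec3 a b c} (hψ : rho ψ = diag3 q)
    (hq : StrictAnti3 q) (hs : eqSum a b c ≤ Submodule.span ℝ (omega '' {p | ψ p ≠ 0})) :
    ∀ᶠ μ in 𝓝 q, μ ∈ eqSum a b c → μ ∈ KronCone a b c := by
  have h1 : Set.range (fun φ => pairRange ψ (rho φ)) ∈ 𝓝 (pairRange ψ (diag3 q)) := by
    rw [← hψ, ← map_pairRange_rho_nhds]
    exact range_mem_map
  have hc : Continuous fun μ : Spec3 a b c => pairRange ψ (diag3 μ) :=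
    (LinearMap.continuous_of_finiteDimensional _).comp continuous_diag3
  filter_upwards [hc.continuousAt.preimage_mem_nhds h1,
    isOpen_strictAnti3.mem_nhds hq] with μ ⟨φ, hφ⟩ hμ hV
  obtain ⟨μ', h2, h3⟩ := exists_diag3_of_pairRange hψ hq hφ
  have hδ : μ' - μ ∈ eqSum a b c := sub_mem (eqSum_of_rho h2) hV
  have h4 : μ' - μ = 0 := eq_zero_of_ip3_self (ip3_eq_zero_of_le_span h3 (hs hδ))
  rw [sub_eq_zero] at h4
  exact mem_kronCone_iff.2 ⟨StrictAnti3.antitone3 hμ, φ, h4 ▸ h2⟩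

theorem rho_second_order (ψ u x : Ten a b c) (t : ℝ) (hu : drho ψ u = 0) :
    rho (ψ + t • u + t ^ 2 • x)
      = rho ψ + t ^ 2 • (rho u + drho ψ x + t • drho u x + t ^ 2 • rho x) := by
  have h (φ : Ten a b c) : drho (ψ + t • u) φ = drho ψ φ + t • drho u φ := by
    rw [drho_comm, drho_add, drho_smul, drho_comm φ, drho_comm φ]
  simp only [rho_add, h, drho_smul, hu, rho_smul]
  module

theorem map_pairRange_second_order (ψ u x₀ : Ten a b c) :
    map (fun y : ℝ × Ten a b c => (y.1, pairRange ψ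
      (rho u + drho ψ y.2 + y.1 • drho u y.2 + y.1 ^ 2 • rho y.2))) (𝓝 (0, x₀))
    = 𝓝 ((0 : ℝ), pairRange ψ (rho u + drho ψ x₀)) := by
  have hcd (w : Ten a b c) : ContDiff ℝ 1 fun y : ℝ × Ten a b c => pairRange ψ (drho w y.2) :=
    contDiff_pairRange_drho ψ contDiff_const contDiff_snd
  have hcr : ContDiff ℝ 1 fun y : ℝ × Ten a b c => pairRange ψ (rho y.2) :=
    contDiff_pairRange_rho ψ contDiff_snd
  have hc : ContDiff ℝ 1 (fun y : ℝ × Ten a b c => (y.1, pairRange ψ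
      (rho u + drho ψ y.2 + y.1 • drho u y.2 + y.1 ^ 2 • rho y.2))) := by
    simp only [map_add, map_smul]
    exact contDiff_fst.prodMk (((contDiff_const.add (hcd ψ)).add (contDiff_fst.smul (hcd u))).add
      ((contDiff_fst.pow 2).smul hcr))
  have := map_nhds_eq_of_directional hc (x := ((0 : ℝ), x₀))
    (L := fun y => (y.1, pairRange ψ (drho ψ y.2) + y.1 • pairRange ψ (drho u x₀))) ?_ ?_
  · simpa using this
  · rintro ⟨s, y⟩
    obtain ⟨v, hv⟩ := pairRange_drho_surjective ψ (y - s • pairRange ψ (drho u x₀))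
    exact ⟨(s, v), by simp only at hv; simp [hv]⟩
  · rintro ⟨s, v⟩
    have hline : HasDerivAt (fun t : ℝ => t * s) s 0 := by
      simpa using (hasDerivAt_id (0 : ℝ)).mul_const s
    have hdiff {f : ℝ × Ten a b c → Fin (Module.finrank ℝ (LinearMap.range (drhoL ψ))) → ℝ}
        (hf : ContDiff ℝ 1 f) : DifferentiableAt ℝ (fun t : ℝ => f (0, x₀ + t • v)) 0 := by
      have hg : ContDiff ℝ 1 fun t : ℝ => f (0, x₀ + t • v) :=
        hf.comp (contDiff_const.prodMk (contDiff_const.add (contDiff_id.smul contDiff_const)))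
      exact (hg.differentiable one_ne_zero).differentiableAt
    have h1 : HasDerivAt (fun t : ℝ => pairRange ψ (rho u) + pairRange ψ (drho ψ x₀)
        + t • pairRange ψ (drho ψ v)) (pairRange ψ (drho ψ v)) 0 := by
      simpa using ((hasDerivAt_id (0 : ℝ)).smul_const (pairRange ψ (drho ψ v))).const_add
        (pairRange ψ (rho u) + pairRange ψ (drho ψ x₀))
    have h2 : HasDerivAt (fun t : ℝ => (t * s) • pairRange ψ (drho u (x₀ + t • v)))
        (s • pairRange ψ (drho u x₀)) 0 := by
      simpa using! hline.smul (hdiff (hcd u)).hasDerivAt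
    have h3 : HasDerivAt (fun t : ℝ => (t * s) ^ 2 • pairRange ψ (rho (x₀ + t • v))) 0 0 := by
      simpa using! (hline.pow 2).smul (hdiff hcr).hasDerivAt
    have h4 := hline.prodMk ((h1.add h2).add h3)
    simp only [add_zero] at h4
    refine h4.congr_of_eventuallyEq (.of_forall fun t => ?_)
    simp [drho_add, drho_smul, add_assoc]

theorem exists_mem_of_second_order {ψ u : Ten a b c} {q h : Spec3 a b c} (hψ : rho ψ = diag3 q)
    (hq : StrictAnti3 q) (h0 : ∀ p, ψ p ≠ 0 → ev h p = 0) (hu : drho ψ u = 0)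
    (hneg : ∑ p, ev h p * Complex.normSq (u p) < 0) {U : Set (Spec3 a b c)} (hU : U ∈ 𝓝 q) :
    ∃ μ ∈ U, μ ∈ KronCone a b c ∧ ip3 h μ < 0 := by
  obtain ⟨x₀, hx₀⟩ := pairRange_drho_surjective ψ (-pairRange ψ (rho u))
  have hmap := map_pairRange_second_order ψ u x₀
  rw [map_add, show pairRange ψ (drho ψ x₀) = _ from hx₀, add_neg_cancel] at hmap
  have hc1 : Continuous fun y : ℝ × Ten a b c =>
      reDiag (rho (ψ + y.1 • u + y.1 ^ 2 • y.2)) :=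
    continuous_reDiag.comp (continuous_rho.comp (by fun_prop))
  have hc2 : Continuous fun y : ℝ × Ten a b c =>
      ∑ p, ev h p * Complex.normSq (u p + y.1 * y.2 p) := by
    refine continuous_finsetSum _ fun p _ => continuous_const.mul
      (Complex.continuous_normSq.comp ?_)
    fun_prop
  have hev : ∀ᶠ y : ℝ × Ten a b c in 𝓝 (0, x₀),
      reDiag (rho (ψ + y.1 • u + y.1 ^ 2 • y.2)) ∈ U ∩ {q | StrictAnti3 q} ∧
      ∑ p, ev h p * Complex.normSq (u p + y.1 * y.2 p) < 0 := by
    refine Filter.Eventually.and ?_ ?_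
    · refine hc1.continuousAt.preimage_mem_nhds ?_
      simpa [hψ, reDiag_diag3] using ⟨hU, isOpen_strictAnti3.mem_nhds hq⟩
    · refine hc2.continuousAt.eventually_lt continuousAt_const ?_
      simpa using hneg
  have hev2 := image_mem_map (m := fun y : ℝ × Ten a b c => (y.1, pairRange ψ
      (rho u + drho ψ y.2 + y.1 • drho u y.2 + y.1 ^ 2 • rho y.2))) hev
  rw [hmap] at hev2
  have hcont : ContinuousAt (fun t : ℝ =>
      (t, (0 : Fin (Module.finrank ℝ (LinearMap.range (drhoL ψ))) → ℝ))) 0 := by fun_prop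
  have hev3 : ∀ᶠ t : ℝ in 𝓝[>] 0, (t, (0 : Fin (Module.finrank ℝ (LinearMap.range (drhoL ψ))) → ℝ))
      ∈ (fun y : ℝ × Ten a b c => (y.1, pairRange ψ
      (rho u + drho ψ y.2 + y.1 • drho u y.2 + y.1 ^ 2 • rho y.2))) '' _ :=
    nhdsWithin_le_nhds (hcont.preimage_mem_nhds hev2)
  obtain ⟨t, ⟨⟨s, x⟩, ⟨⟨hy1, hy2⟩, hy3⟩, hst⟩, ht⟩ := (hev3.and self_mem_nhdsWithin).exists
  simp only [Prod.mk.injEq] at hst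
  obtain ⟨rfl, hst⟩ := hst
  have hpr : pairRange ψ (rho (ψ + s • u + s ^ 2 • x)) = pairRange ψ (diag3 q) := by
    rw [rho_second_order _ _ _ _ hu, map_add, map_smul, hst, smul_zero, add_zero, hψ]
  obtain ⟨μ, hμ, -⟩ := exists_diag3_of_pairRange hψ hq hpr
  simp only [hμ, reDiag_diag3] at hy1 hy2
  refine ⟨μ, hy1, mem_kronCone_iff.2 ⟨StrictAnti3.antitone3 hy2, _, hμ⟩, ?_⟩
  have hsum : ip3 h μ = s ^ 2 * ∑ p, ev h p * Complex.normSq (u p + s * x p) := by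
    rw [ip3_eq_sum hμ, Finset.mul_sum]
    refine Finset.sum_congr rfl fun p _ => ?_
    by_cases hp : ψ p = 0
    · have : (ψ + s • u + s ^ 2 • x) p = (s : ℂ) * (u p + s * x p) := by
        simp only [Pi.add_apply, Pi.smul_apply, hp, zero_add, Complex.real_smul]
        push_cast; ring
      rw [this, Complex.normSq_mul, Complex.normSq_ofReal]; ring
    · rw [h0 p hp]; ring
  rw [hsum]
  exact mul_neg_of_pos_of_neg (pow_pos ht 2) hy3

end

section

open Matrix Filter Topology

variable {a b c : ℕ}

/-- A tensor is stable if its only Hermitian stabiliser with equal traces is zero. -/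
def TrivialStabilizer (ψ : Ten a b c) : Prop :=
  ∀ Δ : Mat3 a b c, star Δ = Δ → Δ.1.trace = Δ.2.1.trace → Δ.1.trace = Δ.2.2.trace →
    act Δ ψ = 0 → Δ = 0

theorem mul_rho_comm_of_act_eq_zero {ψ : Ten a b c} {Δ : Mat3 a b c} (hΔ : star Δ = Δ)
    (h0 : act Δ ψ = 0) : Δ * rho ψ = rho ψ * Δ := by
  have h := drho_act ψ (Y := Complex.I • Δ) (by
    rw [star_smul, hΔ]; simp)
  rw [act_smul_left, h0, smul_zero, drho_zero, smul_mul_assoc, mul_smul_comm, ← smul_sub] at h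
  exact sub_eq_zero.1 ((smul_eq_zero.1 h.symm).resolve_left Complex.I_ne_zero)

section Cyclic

variable (hab : a ≤ b)

/-- Matrices supported on a cyclic diagonal, with entries `1, 2, …, a`. -/
def cyc (k : Fin b) (p : Fin a × Fin b) : ℂ :=
  if p.2 = Fin.castLE hab p.1 + k then (p.1 : ℂ) + 1 else 0

theorem cyc_mul_cyc_eq_zero {k k' : Fin b} (h : k ≠ k') (p : Fin a × Fin b) :
    cyc hab k p * star (cyc hab k' p) = 0 := by
  unfold cyc
  split_ifs with h1 h2
  · exact absurd (add_left_cancel (h1.symm.trans h2)) h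
  all_goals simp

theorem cyc_ne_zero (ha : 0 < a) (k : Fin b) : cyc hab k ≠ 0 := by
  intro h
  have := congrFun h (⟨0, ha⟩, Fin.castLE hab ⟨0, ha⟩ + k)
  simp [cyc] at this

/-- An orthogonal family of matrices with distinct norms, starting with the cyclic diagonals. -/
theorem exists_orthogonal_slices (ha : 0 < a) (hbc : b ≤ c) (hcab : c ≤ a * b) :
    ∃ M : Fin c → Fin a × Fin b → ℂ,
      (∀ k k', M k ⬝ᵥ star (M k') = if k = k' then ((k : ℂ) + 1) ^ 2 else 0) ∧
      ∀ k : Fin b, ∃ r : ℂ, r ≠ 0 ∧ M (Fin.castLE hbc k) = r • cyc hab k := by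
  let E := EuclideanSpace ℂ (Fin a × Fin b)
  let N : Fin b → E := fun k => WithLp.toLp 2 (cyc hab k)
  have hN (k) : N k ≠ 0 := fun h => cyc_ne_zero hab ha k (congrArg WithLp.ofLp h)
  let v : Fin (a * b) → E := fun k =>
    if h : (k : ℕ) < b then ((‖N ⟨k, h⟩‖ : ℂ)⁻¹) • N ⟨k, h⟩ else 0
  let s : Set (Fin (a * b)) := {k | (k : ℕ) < b}
  have hv : Orthonormal ℂ (s.domRestrict v) := by
    constructor
    · rintro ⟨k, hk⟩
      have hk' : (k : ℕ) < b := hk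
      simp only [Set.domRestrict_apply, v, hk', dif_pos]
      exact norm_smul_inv_norm (hN _)
    · rintro ⟨k, hk⟩ ⟨k', hk'⟩ hne
      have h1 : (k : ℕ) < b := hk
      have h2 : (k' : ℕ) < b := hk'
      simp only [Set.domRestrict_apply, v, h1, h2, dif_pos, inner_smul_left, inner_smul_right]
      have : inner ℂ (N ⟨k, h1⟩) (N ⟨k', h2⟩) = 0 := by
        rw [EuclideanSpace.inner_eq_star_dotProduct]
        refine Finset.sum_eq_zero fun p _ => cyc_mul_cyc_eq_zero hab ?_ p
        intro h
        exact hne (Subtype.ext (Fin.ext (Fin.mk.inj_iff.1 h).symm))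
      rw [this, mul_zero, mul_zero]
  obtain ⟨B, hB⟩ := hv.exists_orthonormalBasis_extension_of_card_eq (by simp [E])
  refine ⟨fun k => ((k : ℂ) + 1) • WithLp.ofLp (B (Fin.castLE hcab k)), fun k k' => ?_,
    fun k => ?_⟩
  · have h := orthonormal_iff_ite.1 B.orthonormal (Fin.castLE hcab k') (Fin.castLE hcab k)
    rw [EuclideanSpace.inner_eq_star_dotProduct] at h
    rw [star_smul, smul_dotProduct, dotProduct_smul, h]
    by_cases hk : k = k'
    · subst hk
      simp [sq]
    · have : Fin.castLE hcab k' ≠ Fin.castLE hcab k := fun h =>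
        hk (Fin.castLE_injective _ h).symm
      simp [hk, this]
  · have hk : ((Fin.castLE hcab (Fin.castLE hbc k) : Fin (a * b)) : ℕ) < b := k.2
    refine ⟨((k : ℂ) + 1) * (‖N k‖ : ℂ)⁻¹, ?_, ?_⟩
    · refine mul_ne_zero (by exact_mod_cast Nat.succ_ne_zero k) (inv_ne_zero ?_)
      exact_mod_cast norm_ne_zero_iff.2 (hN k)
    · have h1 := hB (Fin.castLE hcab (Fin.castLE hbc k)) hk
      simp only [v, hk, dif_pos] at h1
      change _ • (B (Fin.castLE hcab (Fin.castLE hbc k))).ofLp = _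
      rw [h1, mul_smul]
      rfl

theorem eq_zero_of_cross {x y : ℂ} {i m : ℕ} (h : i ≠ m)
    (h1 : x * ((m : ℂ) + 1) + y * ((i : ℂ) + 1) = 0)
    (h2 : x * ((i : ℂ) + 1) + y * ((m : ℂ) + 1) = 0) : x = 0 ∧ y = 0 := by
  have hne : ((m : ℂ) + 1) ^ 2 - ((i : ℂ) + 1) ^ 2 ≠ 0 := by
    have : ((m : ℂ) + 1) ^ 2 - ((i : ℂ) + 1) ^ 2 = ((m : ℂ) - i) * (((m + i + 2 : ℕ)) : ℂ) := by
      push_cast; ring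
    rw [this]
    refine mul_ne_zero (sub_ne_zero.2 (by exact_mod_cast h.symm)) ?_
    exact_mod_cast (by omega : m + i + 2 ≠ 0)
  constructor
  · exact (mul_eq_zero.1 (show x * (((m : ℂ) + 1) ^ 2 - ((i : ℂ) + 1) ^ 2) = 0 by
      linear_combination ((m : ℂ) + 1) * h1 - ((i : ℂ) + 1) * h2)).resolve_right hne
  · exact (mul_eq_zero.1 (show y * (((m : ℂ) + 1) ^ 2 - ((i : ℂ) + 1) ^ 2) = 0 by
      linear_combination ((m : ℂ) + 1) * h2 - ((i : ℂ) + 1) * h1)).resolve_right hne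

/-- Hermitian pairs having all cyclic diagonals as eigenvectors are scalar. -/
theorem scalar_of_cyc_eigen [NeZero b] (ha : 1 < a) {X : Matrix (Fin a) (Fin a) ℂ}
    {Y : Matrix (Fin b) (Fin b) ℂ} (hX : X.IsHermitian) (hY : Y.IsHermitian) {τ : Fin b → ℂ}
    (h : ∀ k i j, (∑ i', X i i' * cyc hab k (i', j)) + (∑ j', Y j j' * cyc hab k (i, j'))
      = τ k * cyc hab k (i, j)) :
    ∃ x y : ℂ, X = Matrix.scalar _ x ∧ Y = Matrix.scalar _ y := by
  let e : Fin a → Fin b := Fin.castLE hab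
  have he : Function.Injective e := Fin.castLE_injective hab
  let z : Fin a := ⟨0, by omega⟩
  have hz : e z = 0 := Fin.ext (by simp [e, z])
  have hYs (k i j) : ∑ j', Y j j' * cyc hab k (i, j') = Y j (e i + k) * ((i : ℂ) + 1) := by
    simp [cyc, e]
  have h1 (k : Fin b) (i m : Fin a) : X i m * ((m : ℂ) + 1) + Y (e m + k) (e i + k) * ((i : ℂ) + 1)
      = if i = m then τ k * ((i : ℂ) + 1) else 0 := by
    have := h k i (e m + k)
    rw [hYs] at this
    have hXs : ∑ i', X i i' * cyc hab k (i', e m + k) = X i m * ((m : ℂ) + 1) := by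
      rw [Finset.sum_eq_single m]
      · simp [cyc, e]
      · intro i' _ hi'
        have : ¬ (e m + k = Fin.castLE hab i' + k) := fun h' =>
          hi' (he (add_right_cancel h').symm)
        simp [cyc, this]
      · simp
    rw [hXs] at this
    rw [this]
    by_cases him : i = m
    · subst him; simp [cyc, e]
    · have h' : ¬ (e m + k = Fin.castLE hab i + k) := fun h' =>
        him (he (add_right_cancel h').symm)
      simp [cyc, h', him]
  have h2 (k : Fin b) (i m : Fin a) (him : i ≠ m) : X i m = 0 ∧ Y (e m + k) (e i + k) = 0 := by
    refine eq_zero_of_cross (Fin.val_injective.ne him) ?_ ?_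
    · simpa [him] using h1 k i m
    · have h3 := congrArg star (h1 k m i)
      have h4 : star (X m i) = X i m := hX.apply i m
      have h5 : star (Y (e i + k) (e m + k)) = Y (e m + k) (e i + k) := hY.apply _ _
      simpa [him.symm, h4, h5] using h3
  have h3 (l j : Fin b) (hne : j ≠ l) : Y j l = 0 := by
    by_cases hj : ∃ m, j = e m + l
    · obtain ⟨m, rfl⟩ := hj
      have hm : z ≠ m := by
        rintro rfl
        exact hne (by rw [hz, zero_add])
      simpa [hz] using (h2 l z m hm).2
    · have h4 := h l z j
      rw [hYs, hz, zero_add, Finset.sum_eq_zero] at h4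
      · have : ¬ (j = Fin.castLE hab z + l) := fun h' => hj ⟨z, h'⟩
        simpa [cyc, this, z, hne] using h4
      · intro i' _
        have : ¬ (j = Fin.castLE hab i' + l) := fun h' => hj ⟨i', h'⟩
        simp [cyc, this]
  have h4 (k : Fin b) (i : Fin a) : X i i + Y (e i + k) (e i + k) = τ k := by
    have h5 := h1 k i i
    rw [if_pos rfl, ← add_mul] at h5
    exact mul_right_cancel₀ (by exact_mod_cast Nat.succ_ne_zero i) h5
  have h5 (k : Fin b) (i : Fin a) : X i i + Y (e i + k) (e i + k) = X z z + Y k k := by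
    rw [h4, ← h4 k z, hz, zero_add]
  have h6 (i : Fin a) : X i i = X z z := by
    have h7 : ∑ k, (X i i + Y (e i + k) (e i + k)) = ∑ k, (X z z + Y k k) :=
      Finset.sum_congr rfl fun k _ => h5 k i
    rw [Finset.sum_add_distrib, Finset.sum_add_distrib, show ∑ k, Y (e i + k) (e i + k) = ∑ k, Y k k
      from Equiv.sum_comp (Equiv.addLeft (e i)) (fun k => Y k k)] at h7
    have h8 := add_right_cancel h7
    simp only [Finset.sum_const, Finset.card_univ, Fintype.card_fin, nsmul_eq_mul] at h8
    exact mul_left_cancel₀ (by exact_mod_cast NeZero.ne b) h8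
  have h7 (k : Fin b) : Y (1 + k) (1 + k) = Y k k := by
    have hone : e ⟨1, ha⟩ = 1 := by
      apply Fin.ext
      have : 1 < b := by omega
      simp [e, Nat.mod_eq_of_lt this]
    have h8 := h5 k ⟨1, ha⟩
    rw [h6, hone] at h8
    exact add_left_cancel h8
  have h8 (n : ℕ) : Y (Fin.ofNat b n) (Fin.ofNat b n) = Y 0 0 := by
    induction n with
    | zero => rfl
    | succ n ih =>
      have : Fin.ofNat b (n + 1) = 1 + Fin.ofNat b n := by
        apply Fin.ext
        simp [Fin.val_add, Nat.add_comm]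
      rw [this, h7, ih]
  refine ⟨X z z, Y 0 0, ?_, ?_⟩
  · ext i m
    by_cases him : i = m
    · subst him; simp [h6]
    · simp [him, (h2 0 i m him).1]
  · ext j l
    by_cases hjl : j = l
    · subst hjl
      have := h8 j
      rw [show Fin.ofNat b (j : ℕ) = j from Fin.ext (Nat.mod_eq_of_lt j.2)] at this
      simp [this]
    · simp [hjl, h3 l j hjl]

end Cyclic

/-- For `1 < a ≤ b ≤ c ≤ ab` there is a tensor with trivial stabiliser. -/
theorem exists_trivialStabilizer (ha : 1 < a) (hab : a ≤ b) (hbc : b ≤ c) (hcab : c ≤ a * b) :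
    ∃ ψ : Ten a b c, TrivialStabilizer ψ := by
  have : NeZero b := ⟨by omega⟩
  obtain ⟨M, hM, hN⟩ := exists_orthogonal_slices hab (by omega) hbc hcab
  refine ⟨fun p => M p.2.2 (p.1, p.2.1), ?_⟩
  set ψ : Ten a b c := fun p => M p.2.2 (p.1, p.2.1)
  rintro ⟨X, Y, Z⟩ hΔ hAB hAC h0
  have hX : X.IsHermitian := congrArg Prod.fst hΔ
  have hY : Y.IsHermitian := congrArg (fun Δ : Mat3 a b c => Δ.2.1) hΔ
  have hrho : rhoC ψ = Matrix.diagonal fun k : Fin c => (((((k : ℕ) : ℝ) + 1) ^ 2 : ℝ) : ℂ) := by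
    ext k k'
    have := hM k k'
    simp only [dotProduct, Fintype.sum_prod_type, Pi.star_apply] at this
    rw [Matrix.diagonal_apply]
    push_cast
    exact this
  have hinj : Function.Injective fun k : Fin c => (((k : ℕ) : ℝ) + 1) ^ 2 := by
    intro k k' h
    have h' := (sq_eq_sq₀ (by positivity) (by positivity)).1 h
    exact Fin.ext (by exact_mod_cast add_right_cancel h')
  have hZ : Z.IsDiag := by
    refine isDiag_of_commute_diagonal hinj ?_
    rw [← hrho]
    exact congrArg (fun Δ : Mat3 a b c => Δ.2.2) (mul_rho_comm_of_act_eq_zero hΔ h0)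
  have h1 (k i j) : (∑ i', X i i' * M k (i', j)) + (∑ j', Y j j' * M k (i, j'))
      + Z k k * M k (i, j) = 0 := by
    have := congrFun h0 (i, j, k)
    have hs : ∑ k', Z k k' * M k' (i, j) = Z k k * M k (i, j) := by
      refine Finset.sum_eq_single k (fun k' _ hk' => ?_) (by simp)
      rw [hZ hk'.symm, zero_mul]
    rw [← hs]
    exact this
  obtain ⟨x, y, rfl, rfl⟩ := scalar_of_cyc_eigen hab ha hX hY
    (τ := fun k => - Z (Fin.castLE hbc k) (Fin.castLE hbc k)) (by
      intro k i j
      obtain ⟨r, hr, hk⟩ := hN k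
      have h2 := h1 (Fin.castLE hbc k) i j
      simp only [hk, Pi.smul_apply, smul_eq_mul] at h2
      refine mul_left_cancel₀ hr ?_
      rw [mul_add, Finset.mul_sum, Finset.mul_sum]
      simp only [mul_left_comm r]
      linear_combination h2)
  have h2 (k) : Z k k = -(x + y) := by
    have hk : M k ≠ 0 := by
      intro hk
      have := hM k k
      simp only [hk, zero_dotProduct, if_true] at this
      have h3 : ((k : ℂ) + 1) ≠ 0 := by exact_mod_cast Nat.succ_ne_zero k
      exact pow_ne_zero 2 h3 this.symm
    obtain ⟨⟨i, j⟩, hij⟩ := Function.ne_iff.1 hk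
    have h3 := h1 k i j
    simp only [Matrix.scalar_apply, Matrix.diagonal_apply, ite_mul, zero_mul, Finset.sum_ite_eq,
      Finset.mem_univ, if_true] at h3
    refine mul_right_cancel₀ hij ?_
    linear_combination h3
  have hZs : Z = Matrix.diagonal fun _ => -(x + y) := by
    ext k k'
    by_cases h : k = k'
    · subst h; simp [h2]
    · simp [h, hZ h]
  subst hZs
  simp only [Matrix.scalar_apply, Matrix.trace_diagonal, Finset.sum_const, Finset.card_univ,
    Fintype.card_fin, nsmul_eq_mul] at hAB hAC
  have hpos : (a : ℂ) * b + b * c + c * a ≠ 0 := by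
    have : 0 < a * b + b * c + c * a := by
      have : 0 < a * b := Nat.mul_pos (by omega) (by omega)
      omega
    exact_mod_cast this.ne'
  have ha0 : (a : ℂ) ≠ 0 := by exact_mod_cast (by omega : a ≠ 0)
  have hb0 : (b : ℂ) ≠ 0 := by exact_mod_cast (by omega : b ≠ 0)
  have hx : x = 0 := by
    refine (mul_eq_zero.1 (show x * ((a : ℂ) * b + b * c + c * a) = 0 from ?_)).resolve_right hpos
    linear_combination (b : ℂ) * hAC + (c : ℂ) * hAB
  have hy : y = 0 := by
    rw [hx, mul_zero] at hAB
    exact (mul_eq_zero.1 hAB.symm).resolve_left hb0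
  simp [hx, hy]

end

section

open Matrix Filter Topology

variable {a b c : ℕ}

/-- If a negative-weight tensor is orthogonal to the image of the tangent map, there is a first-order
deformation of negative expectation which preserves the marginals. -/
theorem exists_negative_deformation {ψ v : Ten a b c} {q h : Spec3 a b c} (hψ : rho ψ = diag3 q)
    (hq : StrictAnti3 q) (h0 : ∀ p, ψ p ≠ 0 → ev h p = 0) (hv : ∀ p, v p ≠ 0 → ev h p < 0)
    (hv0 : v ≠ 0) (horth : ∀ E ∈ nMinusMod h.1 h.2.1 h.2.2, star v ⬝ᵥ act E ψ = 0) :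
    ∃ u, drho ψ u = 0 ∧ ∑ p, ev h p * Complex.normSq (u p) < 0 := by
  have hsplit (p) : ψ p = 0 ∨ ev h p = 0 := or_iff_not_imp_left.2 (h0 p)
  have hvsplit (p) : v p = 0 ∨ ev h p < 0 := or_iff_not_imp_left.2 (hv p)
  -- the first-order variation of the marginals only has entries increasing `h`
  have hzero {n : ℕ} {x : Fin n → ℝ} {P Q : Matrix (Fin n) (Fin n) ℂ}
      (hP : ∀ i i', ¬ x i' < x i → P i i' = 0) (hQ : ∀ i i', ¬ x i < x i' → Q i i' = 0)
      (hPo : ∀ i i', i < i' → x i' < x i → P i i' = 0) (i i' : Fin n) (hi : i ≤ i')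
      (hx : x i' ≤ x i) : (P + Q) i i' = 0 := by
    rw [Matrix.add_apply, hQ i i' (not_lt.2 hx), add_zero]
    rcases hi.lt_or_eq with hi | rfl
    · by_cases hx' : x i' < x i
      · exact hPo i i' hi hx'
      · exact hP i i' hx'
    · exact hP _ _ (lt_irrefl _)
  have hsingle {n : ℕ} (x : Fin n → ℝ) {i i' : Fin n} (hi : i < i') (hx : x i' < x i) :
      Matrix.single i' i (1 : ℂ) ∈ lowerMod x := by
    intro k k' hk
    rw [Matrix.single_apply]
    split_ifs with h'
    · obtain ⟨rfl, rfl⟩ := h'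
      exact absurd ⟨hi, hx⟩ hk
    · rfl
  have hRA := hzero (x := h.1) (P := (rhoBil ψ v).1) (Q := (rhoBil v ψ).1)
    (fun i i' hx => by
      refine Finset.sum_eq_zero fun p _ => ?_
      rcases hsplit (i, p) with hp | hp
      · simp [hp]
      rcases hvsplit (i', p) with hp' | hp'
      · simp [hp']
      · simp only [ev] at hp hp'; exact absurd (by linarith) hx)
    (fun i i' hx => by
      refine Finset.sum_eq_zero fun p _ => ?_
      rcases hsplit (i', p) with hp | hp
      · simp [hp]
      rcases hvsplit (i, p) with hp' | hp'
      · simp [hp']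
      · simp only [ev] at hp hp'; exact absurd (by linarith) hx)
    (fun i i' hi hx => by
      have := horth (Matrix.single i' i 1, 0, 0) ⟨hsingle h.1 hi hx, zero_mem _, zero_mem _⟩
      rw [dotProduct_act] at this
      simpa [tr3, Matrix.trace_mul_single] using this)
  have hRB := hzero (x := h.2.1) (P := (rhoBil ψ v).2.1) (Q := (rhoBil v ψ).2.1)
    (fun i i' hx => by
      refine Finset.sum_eq_zero fun p _ => ?_
      rcases hsplit (p.1, i, p.2) with hp | hp
      · simp [hp]
      rcases hvsplit (p.1, i', p.2) with hp' | hp'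
      · simp [hp']
      · simp only [ev] at hp hp'; exact absurd (by linarith) hx)
    (fun i i' hx => by
      refine Finset.sum_eq_zero fun p _ => ?_
      rcases hsplit (p.1, i', p.2) with hp | hp
      · simp [hp]
      rcases hvsplit (p.1, i, p.2) with hp' | hp'
      · simp [hp']
      · simp only [ev] at hp hp'; exact absurd (by linarith) hx)
    (fun i i' hi hx => by
      have := horth (0, Matrix.single i' i 1, 0) ⟨zero_mem _, hsingle h.2.1 hi hx, zero_mem _⟩
      rw [dotProduct_act] at this
      simpa [tr3, Matrix.trace_mul_single] using this)
  have hRC := hzero (x := h.2.2) (P := (rhoBil ψ v).2.2) (Q := (rhoBil v ψ).2.2)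
    (fun i i' hx => by
      refine Finset.sum_eq_zero fun p _ => ?_
      rcases hsplit (p.1, p.2, i) with hp | hp
      · simp [hp]
      rcases hvsplit (p.1, p.2, i') with hp' | hp'
      · simp [hp']
      · simp only [ev] at hp hp'; exact absurd (by linarith) hx)
    (fun i i' hx => by
      refine Finset.sum_eq_zero fun p _ => ?_
      rcases hsplit (p.1, p.2, i') with hp | hp
      · simp [hp]
      rcases hvsplit (p.1, p.2, i) with hp' | hp'
      · simp [hp']
      · simp only [ev] at hp hp'; exact absurd (by linarith) hx)
    (fun i i' hi hx => by
      have := horth (0, 0, Matrix.single i' i 1) ⟨zero_mem _, zero_mem _, hsingle h.2.2 hi hx⟩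
      rw [dotProduct_act] at this
      simpa [tr3, Matrix.trace_mul_single] using this)
  set R := drho ψ v with hR
  have hstar : star R = R := star_drho ψ v
  have hHA : R.1.IsHermitian := congrArg Prod.fst hstar
  have hHB : R.2.1.IsHermitian := congrArg (fun Z : Mat3 a b c => Z.2.1) hstar
  have hHC : R.2.2.IsHermitian := congrArg (fun Z : Mat3 a b c => Z.2.2) hstar
  let Yf {n : ℕ} (x : Fin n → ℝ) (M : Matrix (Fin n) (Fin n) ℂ) : Matrix (Fin n) (Fin n) ℂ :=
    Matrix.of fun i i' => M i i' * ((x i - x i')⁻¹ : ℝ)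
  let Zf {n : ℕ} (y x : Fin n → ℝ) (M : Matrix (Fin n) (Fin n) ℂ) : Matrix (Fin n) (Fin n) ℂ :=
    Matrix.of fun i i' => ((y i - y i' : ℝ) : ℂ) * Yf x M i i'
  have hYf {n : ℕ} (x : Fin n → ℝ) {M : Matrix (Fin n) (Fin n) ℂ} (hM : M.IsHermitian) :
      (Yf x M)ᴴ = -Yf x M := by
    ext i i'
    have := hM.apply i i'
    simp only [Yf, Matrix.conjTranspose_apply, Matrix.of_apply, Matrix.neg_apply, star_mul', this]
    rw [RCLike.star_def, Complex.conj_ofReal, ← mul_neg, ← neg_sub (x i) (x i'), inv_neg]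
    push_cast; ring
  have hZf {n : ℕ} (y x : Fin n → ℝ) {M : Matrix (Fin n) (Fin n) ℂ} (hM : M.IsHermitian) :
      (Zf y x M)ᴴ = Zf y x M := by
    ext i i'
    have := congrFun (congrFun (hYf x hM) i) i'
    rw [Matrix.conjTranspose_apply, Matrix.neg_apply] at this
    simp only [Zf, Matrix.conjTranspose_apply, Matrix.of_apply, star_mul', this]
    rw [RCLike.star_def, Complex.conj_ofReal]
    push_cast; ring
  have hcomm {n : ℕ} {x y : Fin n → ℝ} (hx : StrictAnti x) {M : Matrix (Fin n) (Fin n) ℂ}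
      (hM : ∀ i i', i ≤ i' → y i' ≤ y i → M i i' = 0) :
      Yf x M * Matrix.diagonal (fun i => (x i : ℂ)) - Matrix.diagonal (fun i => (x i : ℂ)) * Yf x M
        = -M := by
    ext i i'
    rw [Matrix.sub_apply, Matrix.mul_diagonal, Matrix.diagonal_mul, Matrix.neg_apply]
    by_cases hi : i = i'
    · subst hi; rw [hM i i le_rfl le_rfl]; ring
    · have : (x i : ℂ) - x i' ≠ 0 := sub_ne_zero.2 (by exact_mod_cast hx.injective.ne hi)
      simp only [Yf, Matrix.of_apply]
      push_cast
      field_simp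
      ring
  have hneg {n : ℕ} {x y : Fin n → ℝ} (hx : StrictAnti x) {M : Matrix (Fin n) (Fin n) ℂ}
      (hH : M.IsHermitian) (hM : ∀ i i', i ≤ i' → y i' ≤ y i → M i i' = 0) :
      ((M * Zf y x M).trace).re ≤ 0 := by
    have : ((M * Zf y x M).trace).re
        = ∑ i, ∑ i', Complex.normSq (M i i') * ((y i' - y i) * (x i' - x i)⁻¹) := by
      simp only [Matrix.trace, Matrix.diag_apply, Matrix.mul_apply, Complex.re_sum]
      refine Finset.sum_congr rfl fun i _ => Finset.sum_congr rfl fun i' _ => ?_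
      have h1 : M i' i = star (M i i') := (hH.apply i' i).symm
      simp only [Zf, Yf, Matrix.of_apply, h1]
      rw [show M i i' * (((y i' - y i : ℝ) : ℂ) * (star (M i i') * ((x i' - x i)⁻¹ : ℝ)))
        = (M i i' * star (M i i')) * (((y i' - y i) * (x i' - x i)⁻¹ : ℝ) : ℂ) by
          push_cast; ring, RCLike.star_def, Complex.mul_conj, ← Complex.ofReal_mul,
          Complex.ofReal_re]
    rw [this]
    refine Finset.sum_nonpos fun i _ => Finset.sum_nonpos fun i' _ => ?_
    by_cases h0 : M i i' = 0
    · simp [h0]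
    have h0' : M i' i ≠ 0 := by
      rw [← hH.apply i' i]; exact star_ne_zero.2 h0
    refine mul_nonpos_of_nonneg_of_nonpos (Complex.normSq_nonneg _) ?_
    rcases le_total i i' with hi | hi
    · have h1 : y i < y i' := not_le.1 fun h' => h0 (hM i i' hi h')
      exact mul_nonpos_of_nonneg_of_nonpos (sub_nonneg.2 h1.le)
        (inv_nonpos.2 (sub_nonpos.2 (hx.antitone hi)))
    · have h1 : y i' < y i := not_le.1 fun h' => h0' (hM i' i hi h')
      exact mul_nonpos_of_nonpos_of_nonneg (sub_nonpos.2 h1.le)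
        (inv_nonneg.2 (sub_nonneg.2 (hx.antitone hi)))
  let Y : Mat3 a b c := (Yf q.1 R.1, Yf q.2.1 R.2.1, Yf q.2.2 R.2.2)
  let Z : Mat3 a b c := (Zf h.1 q.1 R.1, Zf h.2.1 q.2.1 R.2.1, Zf h.2.2 q.2.2 R.2.2)
  have hY : star Y = -Y := Prod.ext (hYf _ hHA) (Prod.ext (hYf _ hHB) (hYf _ hHC))
  have hZ : star Z = Z := Prod.ext (hZf _ _ hHA) (Prod.ext (hZf _ _ hHB) (hZf _ _ hHC))
  have hdY : drho ψ (act Y ψ) = -R := by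
    rw [drho_act ψ hY, hψ]
    exact Prod.ext (hcomm hq.1 hRA) (Prod.ext (hcomm hq.2.1 hRB) (hcomm hq.2.2 hRC))
  have hHY : act (diag3 h) (act Y ψ) = act Z ψ := by
    funext p
    rw [act_diag3]
    simp only [act, mul_add, Finset.mul_sum]
    congr 1
    · congr 1
      · refine Finset.sum_congr rfl fun i' _ => ?_
        rcases hsplit (i', p.2.1, p.2.2) with hp | hp
        · simp [hp]
        · have : ev h p = h.1 p.1 - h.1 i' := by simp only [ev] at hp ⊢; linarith
          simp only [Z, Zf, Y, Matrix.of_apply, this]; ring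
      · refine Finset.sum_congr rfl fun i' _ => ?_
        rcases hsplit (p.1, i', p.2.2) with hp | hp
        · simp [hp]
        · have : ev h p = h.2.1 p.2.1 - h.2.1 i' := by simp only [ev] at hp ⊢; linarith
          simp only [Z, Zf, Y, Matrix.of_apply, this]; ring
    · refine Finset.sum_congr rfl fun i' _ => ?_
      rcases hsplit (p.1, p.2.1, i') with hp | hp
      · simp [hp]
      · have : ev h p = h.2.2 p.2.2 - h.2.2 i' := by simp only [ev] at hp ⊢; linarith
        simp only [Z, Zf, Y, Matrix.of_apply, this]; ring
  refine ⟨v + act Y ψ, by rw [drho_add, hdY, ← hR, add_neg_cancel], ?_⟩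
  have hRZ : (tr3 (R * Z)).re ≤ 0 := by
    have h1 := hneg hq.1 hHA hRA
    have h2 := hneg hq.2.1 hHB hRB
    have h3 := hneg hq.2.2 hHC hRC
    have : (tr3 (R * Z)).re = ((R.1 * Zf h.1 q.1 R.1).trace).re
        + ((R.2.1 * Zf h.2.1 q.2.1 R.2.1).trace).re
        + ((R.2.2 * Zf h.2.2 q.2.2 R.2.2).trace).re := rfl
    linarith
  have e1 := two_re_dotProduct_act v ψ hZ
  have e2 := two_re_dotProduct_act (act Y ψ) ψ hZ
  rw [hdY, neg_mul, show tr3 (-(R * Z)) = -tr3 (R * Z) by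
    rw [← neg_one_smul ℝ (R * Z), tr3_smul, neg_one_smul], Complex.neg_re] at e2
  have e3 : ∑ p, ev h p * Complex.normSq ((v + act Y ψ) p)
      = ∑ p, ev h p * Complex.normSq (v p) + 2 * (star v ⬝ᵥ act Z ψ).re
        + (star (act Y ψ) ⬝ᵥ act Z ψ).re := by
    rw [← hHY, star_dotProduct_act_diag3, Complex.ofReal_re]
    simp only [dotProduct, act_diag3, Complex.re_sum, Finset.mul_sum, ← Finset.sum_add_distrib]
    refine Finset.sum_congr rfl fun p _ => ?_
    simp only [Pi.add_apply, Pi.star_apply, Complex.normSq_apply, Complex.add_re, Complex.add_im,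
      Complex.mul_re, Complex.mul_im, RCLike.star_def, Complex.conj_re, Complex.conj_im,
      Complex.ofReal_re, Complex.ofReal_im]
    ring
  have e4 : ∑ p, ev h p * Complex.normSq (v p) < 0 := by
    obtain ⟨p, hp⟩ := Function.ne_iff.1 hv0
    refine Finset.sum_neg' (fun p _ => ?_) ⟨p, Finset.mem_univ p, ?_⟩
    · rcases hvsplit p with hp | hp
      · simp [hp]
      · exact mul_nonpos_of_nonpos_of_nonneg hp.le (Complex.normSq_nonneg _)
    · exact mul_neg_of_neg_of_pos (hv p hp) (Complex.normSq_pos.2 hp)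
  rw [e3]
  change 2 * (star v ⬝ᵥ act Z ψ).re = (tr3 (R * Z)).re at e1
  linarith

end

section

open Matrix Filter Topology

variable {a b c : ℕ}

theorem trace_rho (φ : Ten a b c) :
    (rho φ).1.trace = nsq φ ∧ (rho φ).2.1.trace = nsq φ ∧ (rho φ).2.2.trace = nsq φ := by
  refine ⟨?_, ?_, ?_⟩ <;> rw [← star_dotProduct_self]
  · exact (congrArg _ (rhoA_eq_flat φ)).trans (dotProduct_eq_trace_flatA φ φ).symm
  · exact (congrArg _ (rhoB_eq_flat φ)).trans (dotProduct_eq_trace_flatB φ φ).symm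
  · exact (congrArg _ (rhoC_eq_flat φ)).trans (dotProduct_eq_trace_flatC φ φ).symm

/-- Every triple of spectra near those of a tensor with trivial stabiliser is attained. -/
theorem TrivialStabilizer.exists_eventually {ψ : Ten a b c} (hψ : TrivialStabilizer ψ) :
    ∃ q : Spec3 a b c, Antitone3 q ∧ q ∈ eqSum a b c ∧
      ∀ᶠ μ in 𝓝 q, μ ∈ eqSum a b c → ∃ φ : Ten a b c, rho φ = diag3 μ := by
  obtain ⟨q, U, hq, hU, hU', h⟩ := exists_gact_diag3 ψ
  refine ⟨q, hq, eqSum_of_rho h, ?_⟩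
  have hψq : star U * diag3 q * U = rho ψ := by
    rw [← h, rho_gact hU]
    calc star U * (U * rho ψ * star U) * U = (star U * U) * rho ψ * (star U * U) := by
          simp only [mul_assoc]
      _ = rho ψ := by rw [hU, one_mul, mul_one]
  have hc : Continuous fun μ : Spec3 a b c => pairRange ψ (star U * diag3 μ * U) :=
    (LinearMap.continuous_of_finiteDimensional _).comp
      ((continuous_const.mul continuous_diag3).mul continuous_const)
  have h1 : Set.range (fun φ => pairRange ψ (rho φ)) ∈ 𝓝 (pairRange ψ (star U * diag3 q * U)) := by
    rw [hψq, ← map_pairRange_rho_nhds]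
    exact range_mem_map
  filter_upwards [hc.continuousAt.preimage_mem_nhds h1] with μ ⟨φ, hφ⟩ hV
  have htr {n : ℕ} {V : Matrix (Fin n) (Fin n) ℂ} (hV : V * Vᴴ = 1) (x : Fin n → ℝ) :
      (Vᴴ * Matrix.diagonal (fun i => (x i : ℂ)) * V).trace = ((∑ i, x i : ℝ) : ℂ) := by
    rw [Matrix.trace_mul_comm, ← Matrix.mul_assoc, hV, Matrix.one_mul, Matrix.trace_diagonal]
    push_cast; rfl
  have tA := htr (congrArg Prod.fst hU') μ.1
  have tB := htr (congrArg (fun Z : Mat3 a b c => Z.2.1) hU') μ.2.1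
  have tC := htr (congrArg (fun Z : Mat3 a b c => Z.2.2) hU') μ.2.2
  obtain ⟨rA, rB, rC⟩ := trace_rho φ
  have hz : rho φ - star U * diag3 μ * U = 0 := by
    refine hψ _ ?_ ?_ ?_ (act_eq_zero_of_pairRange ?_ (by
      rw [map_sub, sub_eq_zero]; exact hφ))
    · rw [star_sub, star_rho, star_mul, star_mul, star_star, star_diag3, mul_assoc]
    · refine (Matrix.trace_sub _ _).trans (Eq.trans ?_ (Matrix.trace_sub _ _).symm)
      exact congrArg₂ _ (rA.trans rB.symm) (tA.trans ((congrArg _ hV.1).trans tB.symm))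
    · refine (Matrix.trace_sub _ _).trans (Eq.trans ?_ (Matrix.trace_sub _ _).symm)
      exact congrArg₂ _ (rA.trans rC.symm) (tA.trans ((congrArg _ hV.2).trans tC.symm))
    · rw [star_sub, star_rho, star_mul, star_mul, star_star, star_diag3, mul_assoc]
  refine ⟨gact U φ, ?_⟩
  rw [rho_gact hU, sub_eq_zero.1 hz]
  calc U * (star U * diag3 μ * U) * star U = (U * star U) * diag3 μ * (U * star U) := by
        simp only [mul_assoc]
    _ = diag3 μ := by rw [hU', one_mul, mul_one]

/-- A strictly decreasing vector with vanishing sum. -/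
def ramp (n : ℕ) (i : Fin n) : ℝ := ((n : ℝ) - 1) / 2 - (i : ℕ)

theorem strictAnti_ramp (n : ℕ) : StrictAnti (ramp n) := by
  intro i j hij
  have : ((i : ℕ) : ℝ) < (j : ℕ) := by exact_mod_cast hij
  simp only [ramp]; linarith

theorem sum_ramp (n : ℕ) : ∑ i, ramp n i = 0 := by
  simp only [ramp, Finset.sum_sub_distrib, Finset.sum_const, Finset.card_univ, Fintype.card_fin,
    nsmul_eq_mul]
  rw [Fin.sum_univ_eq_sum_range (fun i => (i : ℝ)) n]
  induction n with
  | zero => simp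
  | succ n ih => rw [Finset.sum_range_succ]; push_cast at ih ⊢; linarith

theorem exists_strictAnti3_interior (ha : 1 < a) (hab : a ≤ b) (hbc : b ≤ c) (hcab : c ≤ a * b) :
    ∃ p : Spec3 a b c, StrictAnti3 p ∧ p ∈ eqSum a b c ∧
      ∀ᶠ μ in 𝓝 p, μ ∈ eqSum a b c → μ ∈ KronCone a b c := by
  obtain ⟨ψ, hψ⟩ := exists_trivialStabilizer ha hab hbc hcab
  obtain ⟨q, hq, hqV, hev⟩ := hψ.exists_eventually
  let r : Spec3 a b c := (ramp a, ramp b, ramp c)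
  have hr : r ∈ eqSum a b c := by simp [mem_eqSum, r, sum_ramp]
  have hc : ContinuousAt (fun t : ℝ => q + t • r) 0 := by fun_prop
  have hev' : ∀ᶠ t in 𝓝[>] (0 : ℝ), ∀ᶠ μ in 𝓝 (q + t • r),
      μ ∈ eqSum a b c → ∃ φ : Ten a b c, rho φ = diag3 μ := by
    have h0 : ∀ᶠ μ' in 𝓝 (q + (0 : ℝ) • r), ∀ᶠ μ in 𝓝 μ',
        μ ∈ eqSum a b c → ∃ φ : Ten a b c, rho φ = diag3 μ := by
      simpa using hev.eventually_nhds
    exact (hc.tendsto.eventually h0).filter_mono nhdsWithin_le_nhds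
  obtain ⟨t, h1, ht⟩ := (hev'.and self_mem_nhdsWithin).exists
  have ht : 0 < t := ht
  have hs {n : ℕ} {x : Fin n → ℝ} (hx : Antitone x) : StrictAnti (x + t • ramp n) :=
    fun i j hij => add_lt_add_of_le_of_lt (hx hij.le)
      (mul_lt_mul_of_pos_left (strictAnti_ramp n hij) ht)
  have hp : StrictAnti3 (q + t • r) := ⟨hs hq.1, hs hq.2.1, hs hq.2.2⟩
  refine ⟨q + t • r, hp, add_mem hqV ((eqSum a b c).smul_mem t hr), ?_⟩
  filter_upwards [h1, isOpen_strictAnti3.mem_nhds hp] with μ h2 h3 hμ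
  exact mem_kronCone_iff.2 ⟨StrictAnti3.antitone3 h3, h2 hμ⟩

/-- A finite family of subspaces not containing `V` can be avoided near each point of `V`. -/
theorem exists_mem_avoiding {E : Type*} [NormedAddCommGroup E] [NormedSpace ℝ E]
    (V : Submodule ℝ E) (s : Finset (Submodule ℝ E)) (hs : ∀ A ∈ s, ¬ V ≤ A) {p : E} (hp : p ∈ V)
    {U : Set E} (hU : U ∈ 𝓝 p) : ∃ x ∈ V, x ∈ U ∧ ∀ A ∈ s, x ∉ A := by
  classical
  obtain ⟨w, hw⟩ : ∃ w : V, ∀ A ∈ s, (w : E) ∉ A := by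
    have h := Subspace.biUnion_ne_univ_of_top_notMem (k := ℝ) (E := V)
      (s := s.image fun A => A.comap V.subtype) (by
        intro h
        obtain ⟨A, hA, hAt⟩ := Finset.mem_image.1 h
        exact hs A hA fun x hx => by
          have : (⟨x, hx⟩ : V) ∈ A.comap V.subtype := hAt ▸ Submodule.mem_top
          exact this)
    obtain ⟨w, hw⟩ := (Set.ne_univ_iff_exists_notMem _).1 h
    refine ⟨w, fun A hA hwA => hw ?_⟩
    exact Set.mem_biUnion (Finset.mem_coe.2 (Finset.mem_image_of_mem _ hA)) hwA
  have hfin : {t : ℝ | ∃ A ∈ s, p + t • (w : E) ∈ A}.Finite := by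
    have : {t : ℝ | ∃ A ∈ s, p + t • (w : E) ∈ A} = ⋃ A ∈ s, {t : ℝ | p + t • (w : E) ∈ A} := by
      ext t; simp
    rw [this]
    refine s.finite_toSet.biUnion fun A hA => Set.Subsingleton.finite fun t ht t' ht' => ?_
    by_contra hne
    have h1 : (t - t') • (w : E) ∈ A := by
      have := A.sub_mem ht ht'
      rwa [add_sub_add_left_eq_sub, ← sub_smul] at this
    exact hw A hA ((A.smul_mem_iff (sub_ne_zero.2 hne)).1 h1)
  have hc : ContinuousAt (fun t : ℝ => p + t • (w : E)) 0 := by fun_prop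
  have hinf : ((fun t : ℝ => p + t • (w : E)) ⁻¹' U).Infinite :=
    infinite_of_mem_nhds 0 (hc.preimage_mem_nhds (by simpa using hU))
  obtain ⟨t, ht, ht'⟩ := hinf.exists_notMem_finite hfin
  exact ⟨_, V.add_mem hp (V.smul_mem t w.2), ht, fun A hA h => ht' ⟨A, hA, h⟩⟩

/-- The last point of a closed set on a segment leaving it. -/
theorem exists_last_mem {E : Type*} [NormedAddCommGroup E] [NormedSpace ℝ E] {C : Set E}
    (hC : IsClosed C) {x y : E} (hx : x ∈ C) (hy : y ∉ C) :
    ∃ t : ℝ, 0 ≤ t ∧ t < 1 ∧ x + t • (y - x) ∈ C ∧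
      ∀ t', t < t' → t' ≤ 1 → x + t' • (y - x) ∉ C := by
  have hc : Continuous fun t : ℝ => x + t • (y - x) := by fun_prop
  have hK : IsCompact (Set.Icc (0 : ℝ) 1 ∩ (fun t : ℝ => x + t • (y - x)) ⁻¹' C) :=
    isCompact_Icc.inter_right (hC.preimage hc)
  obtain ⟨t, ⟨⟨h0, h1⟩, htC⟩, hmax⟩ := hK.exists_isGreatest ⟨0, by simpa using hx⟩
  refine ⟨t, h0, lt_of_le_of_ne h1 ?_, htC, fun t' htt' ht1 hmem => ?_⟩
  · rintro rfl
    exact hy (by simpa using htC)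
  · exact absurd (hmax ⟨⟨h0.trans htt'.le, ht1⟩, hmem⟩) (not_le.2 htt')

theorem kronCone_subset_eqSum {q : Spec3 a b c} (h : q ∈ KronCone a b c) : q ∈ eqSum a b c := by
  obtain ⟨-, ψ, hψ⟩ := mem_kronCone_iff.1 h
  exact eqSum_of_rho hψ

theorem mem_span_support {ψ : Ten a b c} {q : Spec3 a b c} (hψ : rho ψ = diag3 q) :
    q ∈ Submodule.span ℝ (omega '' {p | ψ p ≠ 0}) := by
  have h : q - ∑ p, Complex.normSq (ψ p) • omega p = 0 := by
    refine eq_zero_of_ip3_self ?_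
    rw [map_sub, map_sum, ip3_eq_sum hψ, sub_eq_zero]
    refine Finset.sum_congr rfl fun p _ => ?_
    rw [map_smul, ip3_omega, smul_eq_mul, mul_comm]
  rw [sub_eq_zero.1 h]
  refine Submodule.sum_mem _ fun p _ => ?_
  by_cases hp : ψ p = 0
  · simp [hp]
  · exact Submodule.smul_mem _ _ (Submodule.subset_span ⟨p, hp, rfl⟩)

theorem exists_ip3_eq (f : Spec3 a b c →ₗ[ℝ] ℝ) : ∃ h : Spec3 a b c, f = ip3 h := by
  refine ⟨(fun i => f (Pi.single i 1, 0), fun j => f (0, Pi.single j 1, 0),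
    fun k => f (0, 0, Pi.single k 1)), ?_⟩
  refine LinearMap.prod_ext ?_ (LinearMap.prod_ext ?_ ?_)
  all_goals
    refine LinearMap.pi_ext' fun i => LinearMap.ext_ring ?_
    simp [ip3_apply]

theorem act_mem_weightNeg {ψ : Ten a b c} {h : Spec3 a b c} (h0 : ∀ p, ψ p ≠ 0 → ev h p = 0)
    {X : Mat3 a b c} (hX : X ∈ nMinusMod h.1 h.2.1 h.2.2) (p) (hp : ¬ ev h p < 0) :
    act X ψ p = 0 := by
  have hs (p) : ψ p = 0 ∨ ev h p = 0 := or_iff_not_imp_left.2 (h0 p)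
  have key {n : ℕ} {x : Fin n → ℝ} {M : Matrix (Fin n) (Fin n) ℂ} (hM : M ∈ lowerMod x)
      {i i' : Fin n} (hx : ¬ x i < x i') : M i i' = 0 := hM _ _ fun h' => hx h'.2
  simp only [act]
  rw [Finset.sum_eq_zero, Finset.sum_eq_zero, Finset.sum_eq_zero, add_zero, add_zero] <;>
    intro i' _
  · rcases hs (p.1, p.2.1, i') with h' | h'
    · rw [h', mul_zero]
    · rw [key hX.2.2, zero_mul]
      simp only [ev] at h' hp; intro; apply hp; linarith
  · rcases hs (p.1, i', p.2.2) with h' | h'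
    · rw [h', mul_zero]
    · rw [key hX.2.1, zero_mul]
      simp only [ev] at h' hp; intro; apply hp; linarith
  · rcases hs (i', p.2.1, p.2.2) with h' | h'
    · rw [h', mul_zero]
    · rw [key hX.1, zero_mul]
      simp only [ev] at h' hp; intro; apply hp; linarith

/-- Either the tangent map hits all negative-weight tensors or one of them is orthogonal to its
image. -/
theorem exists_act_or_orthogonal {ψ : Ten a b c} {h : Spec3 a b c} :
    (∀ w : Ten a b c, (∀ p, ¬ ev h p < 0 → w p = 0) →
      ∃ X ∈ nMinusMod h.1 h.2.1 h.2.2, act X ψ = w) ∨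
    ∃ v : Ten a b c, v ≠ 0 ∧ (∀ p, v p ≠ 0 → ev h p < 0) ∧
      ((∀ p, ψ p ≠ 0 → ev h p = 0) →
        ∀ E ∈ nMinusMod h.1 h.2.1 h.2.2, star v ⬝ᵥ act E ψ = 0) := by
  classical
  by_contra hcon
  push Not at hcon
  obtain ⟨⟨w, hw, hX⟩, hcon⟩ := hcon
  have hnot : w ∉ (nMinusMod h.1 h.2.1 h.2.2).map (actL ψ) := by
    rintro ⟨X, hXm, hXe⟩
    exact hX X hXm hXe
  obtain ⟨f, hf, hf0⟩ := Submodule.exists_dual_map_eq_bot_of_notMem hnot inferInstance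
  let v : Ten a b c := fun p => if ev h p < 0 then star (f (Pi.single p 1)) else 0
  have hfv (x : Ten a b c) (hx : ∀ p, ¬ ev h p < 0 → x p = 0) : star v ⬝ᵥ x = f x := by
    rw [LinearMap.pi_apply_eq_sum_univ f x]
    refine Finset.sum_congr rfl fun p _ => ?_
    by_cases hp : ev h p < 0
    · simp only [Pi.star_apply, v, hp, if_true, star_star, smul_eq_mul, mul_comm]
      congr 2
      ext p'
      simp [Pi.single_apply, eq_comm]
    · simp [hx p hp]
  have hv0 : v ≠ 0 := by
    intro hv
    have := hfv w fun p hp => hw p (not_lt.1 hp)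
    rw [hv, star_zero, zero_dotProduct] at this
    exact hf this.symm
  obtain ⟨h0, E, hE, hne⟩ := hcon v hv0 (fun p hp => by
    by_contra hn
    exact hp (by simp [v, hn]))
  refine hne ?_
  rw [hfv _ (act_mem_weightNeg h0 hE)]
  have : f (actL ψ E) ∈ ((nMinusMod h.1 h.2.1 h.2.2).map (actL ψ)).map f :=
    Submodule.mem_map_of_mem (Submodule.mem_map_of_mem hE)
  rw [hf0] at this
  exact (Submodule.mem_bot ℂ).1 this

end

section

open Matrix Filter Topology

variable {a b c : ℕ}

/-- The subspace spanned by the weights in a set of indices. -/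
def weightSpan (s : Set (Fin a × Fin b × Fin c)) : Submodule ℝ (Spec3 a b c) :=
  Submodule.span ℝ (omega '' s)

theorem weightSpan_le_eqSum (s : Set (Fin a × Fin b × Fin c)) : weightSpan s ≤ eqSum a b c := by
  rw [weightSpan, Submodule.span_le]
  rintro _ ⟨p, -, rfl⟩
  exact omega_mem_eqSum p

variable (a b c) in
/-- The proper subspaces of `eqSum` spanned by weights. -/
def properSpans : Finset (Submodule ℝ (Spec3 a b c)) := by
  classical
  exact (Set.finite_range (weightSpan (a := a) (b := b) (c := c))).toFinset.filter
    fun A => ¬ eqSum a b c ≤ A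

theorem mem_properSpans {A : Submodule ℝ (Spec3 a b c)} :
    A ∈ properSpans a b c ↔ (∃ s, weightSpan s = A) ∧ ¬ eqSum a b c ≤ A := by
  classical
  simp [properSpans]

theorem le_eqSum_of_mem_properSpans {A : Submodule ℝ (Spec3 a b c)} (hA : A ∈ properSpans a b c) :
    A ≤ eqSum a b c := by
  obtain ⟨⟨s, rfl⟩, -⟩ := mem_properSpans.1 hA
  exact weightSpan_le_eqSum s

/-- A strictly decreasing boundary point of the cone lies on a proper span of weights. -/
theorem exists_support_mem_properSpans {q : Spec3 a b c} (hq : StrictAnti3 q)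
    (hqC : q ∈ KronCone a b c)
    (hb : ¬ ∀ᶠ μ in 𝓝 q, μ ∈ eqSum a b c → μ ∈ KronCone a b c) :
    ∃ ψ : Ten a b c, rho ψ = diag3 q ∧ weightSpan {p | ψ p ≠ 0} ∈ properSpans a b c ∧
      q ∈ weightSpan {p | ψ p ≠ 0} := by
  obtain ⟨-, ψ, hψ⟩ := mem_kronCone_iff.1 hqC
  exact ⟨ψ, hψ, mem_properSpans.2 ⟨⟨_, rfl⟩, fun h => hb (eventually_mem_of_support hψ hq h)⟩,
    mem_span_support hψ⟩

theorem not_eventually_mem_of_last {E : Type*} [NormedAddCommGroup E] [NormedSpace ℝ E]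
    {C : Set E} {V : Submodule ℝ E} {x y : E} (hx : x ∈ V) (hy : y ∈ V) {t : ℝ} (ht : t < 1)
    (hl : ∀ t', t < t' → t' ≤ 1 → x + t' • (y - x) ∉ C) :
    ¬ ∀ᶠ μ in 𝓝 (x + t • (y - x)), μ ∈ V → μ ∈ C := by
  intro h
  have hc : ContinuousAt (fun s : ℝ => x + s • (y - x)) t := by fun_prop
  have h1 := ((hc.tendsto.eventually h).filter_mono (nhdsWithin_le_nhds (s := Set.Ioi t))).and
    (Ioo_mem_nhdsGT ht)
  obtain ⟨s, h1, h2, h3⟩ := h1.exists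
  exact hl s h2 h3.le (h1 (V.add_mem hx (V.smul_mem s (V.sub_mem hy hx))))

theorem strictAnti3_segment {p l : Spec3 a b c} (hp : StrictAnti3 p) (hl : Antitone3 l) {t : ℝ}
    (h0 : 0 ≤ t) (h1 : t < 1) : StrictAnti3 (p + t • (l - p)) := by
  have h {n : ℕ} {x y : Fin n → ℝ} (hx : StrictAnti x) (hy : Antitone y) :
      StrictAnti (x + t • (y - x)) := by
    intro i j hij
    simp only [Pi.add_apply, Pi.smul_apply, Pi.sub_apply, smul_eq_mul]
    nlinarith [hx hij, hy hij.le]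
  exact ⟨h hp.1 hl.1, h hp.2.1 hl.2.1, h hp.2.2 hl.2.2⟩

/-- Two hyperplanes among the weight spans through a sufficiently general point coincide. -/
theorem finrank_le_of_avoiding {E : Type*} [AddCommGroup E] [Module ℝ E] [FiniteDimensional ℝ E]
    {V A A' : Submodule ℝ E} {p l : E} {t : ℝ} (ht : t < 1)
    (hA : p + t • (l - p) ∈ A) (hA' : p + t • (l - p) ∈ A')
    (hp : Module.finrank ℝ ↥(A ⊓ A') + 2 ≤ Module.finrank ℝ V →
      p ∉ (A ⊓ A') ⊔ Submodule.span ℝ {l}) :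
    Module.finrank ℝ V ≤ Module.finrank ℝ ↥(A ⊓ A') + 1 := by
  by_contra hcon
  refine hp (by omega) ?_
  have h1 : p = (1 - t)⁻¹ • (p + t • (l - p)) + (-((1 - t)⁻¹ * t)) • l := by
    have h2 : (1 - t)⁻¹ * (1 - t) = 1 := inv_mul_cancel₀ (sub_pos.2 ht).ne'
    calc p = ((1 - t)⁻¹ * (1 - t)) • p := by rw [h2, one_smul]
      _ = _ := by module
  rw [h1]
  exact Submodule.add_mem_sup (Submodule.smul_mem _ _ ⟨hA, hA'⟩)
    (Submodule.smul_mem _ _ (Submodule.mem_span_singleton_self l))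

/-- A point outside the cone is separated from it by a hyperplane spanned by weights supporting
the cone near a boundary point with strictly decreasing spectra. -/
theorem exists_supporting (ha : 1 < a) (hab : a ≤ b) (hbc : b ≤ c) (hcab : c ≤ a * b)
    {l : Spec3 a b c} (hl : Antitone3 l) (hlV : l ∈ eqSum a b c) (hlC : l ∉ KronCone a b c) :
    ∃ (h q : Spec3 a b c) (ψ : Ten a b c), StrictAnti3 q ∧ rho ψ = diag3 q ∧ ip3 h l < 0 ∧
      weightSpan {p | ψ p ≠ 0} = eqSum a b c ⊓ LinearMap.ker (ip3 h) ∧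
      ∃ U ∈ 𝓝 q, ∀ μ ∈ U, μ ∈ KronCone a b c → 0 ≤ ip3 h μ := by
  classical
  obtain ⟨p₀, hp₀, hp₀V, hev⟩ := exists_strictAnti3_interior ha hab hbc hcab
  set V := eqSum a b c
  let pairs := ((properSpans a b c ×ˢ properSpans a b c).filter
    fun x : Submodule ℝ (Spec3 a b c) × Submodule ℝ (Spec3 a b c) =>
      Module.finrank ℝ ↥(x.1 ⊓ x.2) + 2 ≤ Module.finrank ℝ V).image fun x => (x.1 ⊓ x.2) ⊔ Submodule.span ℝ {l}
  obtain ⟨p, hpV, ⟨hpC, hp⟩, hav⟩ := exists_mem_avoiding V (properSpans a b c ∪ pairs) (by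
    intro A hA hle
    rcases Finset.mem_union.1 hA with hA | hA
    · exact (mem_properSpans.1 hA).2 hle
    · obtain ⟨⟨B, B'⟩, hB, rfl⟩ := Finset.mem_image.1 hA
      have h1 := (Finset.mem_filter.1 hB).2
      have h2 := Submodule.finrank_mono hle
      have h3 := Submodule.finrank_add_le_finrank_add_finrank (B ⊓ B') (Submodule.span ℝ {l})
      have h4 := finrank_span_finset_le_card (R := ℝ) {l}
      rw [Finset.coe_singleton, Finset.card_singleton, Set.finrank] at h4
      simp only at h1 h2
      omega) hp₀V (inter_mem hev (isOpen_strictAnti3.mem_nhds hp₀))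
  have hpC := hpC hpV
  obtain ⟨t, ht0, ht1, hqC, hlast⟩ := exists_last_mem isClosed_kronCone hpC hlC
  set q := p + t • (l - p) with hqdef
  have hq : StrictAnti3 q := strictAnti3_segment hp hl ht0 ht1
  obtain ⟨ψ, hψ, hA, hqA⟩ := exists_support_mem_properSpans hq hqC
    (not_eventually_mem_of_last hpV hlV ht1 hlast)
  set A := weightSpan {p | ψ p ≠ 0} with hAdef
  have hdim {A' : Submodule ℝ (Spec3 a b c)} (hA' : A' ∈ properSpans a b c) (hq' : q ∈ A') :
      Module.finrank ℝ V ≤ Module.finrank ℝ ↥(A ⊓ A') + 1 :=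
    finrank_le_of_avoiding ht1 hqA hq' fun hle => hav _ (Finset.mem_union_right _
      (Finset.mem_image.2 ⟨(A, A'), Finset.mem_filter.2 ⟨Finset.mem_product.2 ⟨hA, hA'⟩, hle⟩, rfl⟩))
  have hlt {A' : Submodule ℝ (Spec3 a b c)} (hA' : A' ∈ properSpans a b c) :
      Module.finrank ℝ A' < Module.finrank ℝ V :=
    Submodule.finrank_lt_finrank_of_lt
      (lt_of_le_not_ge (le_eqSum_of_mem_properSpans hA') (mem_properSpans.1 hA').2)
  have huniq {A' : Submodule ℝ (Spec3 a b c)} (hA' : A' ∈ properSpans a b c) (hq' : q ∈ A') :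
      A' = A := by
    have h1 := hdim hA' hq'
    have h2 := hlt hA
    have h3 := hlt hA'
    have e1 := Submodule.eq_of_le_of_finrank_le (inf_le_left : A ⊓ A' ≤ A) (by omega)
    have e2 := Submodule.eq_of_le_of_finrank_le (inf_le_right : A ⊓ A' ≤ A') (by omega)
    exact e2.symm.trans e1
  have hpA : p ∉ A := hav _ (Finset.mem_union_left _ hA)
  obtain ⟨h, hhp, hhA⟩ : ∃ h : Spec3 a b c, 0 < ip3 h p ∧ ∀ x ∈ A, ip3 h x = 0 := by
    obtain ⟨f, hf, hf0⟩ := Submodule.exists_dual_map_eq_bot_of_notMem hpA inferInstance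
    have hfA : ∀ x ∈ A, f x = 0 := fun x hx =>
      (Submodule.mem_bot ℝ).1 (hf0 ▸ Submodule.mem_map_of_mem hx)
    rcases lt_or_gt_of_ne hf with hn | hn
    · obtain ⟨h, hh⟩ := exists_ip3_eq (-f)
      exact ⟨h, by rw [← hh]; simpa using hn, fun x hx => by rw [← hh]; simpa using hfA x hx⟩
    · obtain ⟨h, hh⟩ := exists_ip3_eq f
      exact ⟨h, by rw [← hh]; exact hn, fun x hx => by rw [← hh]; exact hfA x hx⟩
  have hseg (s : ℝ) : ip3 h (p + s • (l - p)) = (1 - s) * ip3 h p + s * ip3 h l := by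
    rw [map_add, map_smul, map_sub, smul_eq_mul]; ring
  have hq0 := hhA q hqA
  rw [hqdef, hseg] at hq0
  have hhl : ip3 h l < 0 := by nlinarith [mul_pos (sub_pos.2 ht1) hhp]
  refine ⟨h, q, ψ, hq, hψ, hhl, ?_, ?_⟩
  · refine Submodule.eq_of_le_of_finrank_le (le_inf (weightSpan_le_eqSum _) hhA) ?_
    have h1 : Module.finrank ℝ ↥(V ⊓ LinearMap.ker (ip3 h)) < Module.finrank ℝ V :=
      Submodule.finrank_lt_finrank_of_lt (lt_of_le_not_ge inf_le_left
        fun hle => hhp.ne' (hle hpV).2)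
    have h2 := hdim hA hqA
    rw [inf_idem] at h2
    change _ ≤ Module.finrank ℝ A
    omega
  · have hfar : ∀ᶠ μ in 𝓝 q, ∀ A' ∈ properSpans a b c, μ ∈ A' → q ∈ A' := by
      rw [Filter.eventually_all_finset]
      intro A' _
      by_cases hqA' : q ∈ A'
      · exact Eventually.of_forall fun _ _ => hqA'
      · filter_upwards [(A'.closed_of_finiteDimensional).isOpen_compl.mem_nhds hqA'] with μ h1 h2
        exact absurd h2 h1
    obtain ⟨ε, hε, hball⟩ := Metric.eventually_nhds_iff_ball.1
      (hfar.and (isOpen_strictAnti3.mem_nhds hq))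
    refine ⟨Metric.ball q ε, Metric.ball_mem_nhds q hε, fun μ hμ hμC => ?_⟩
    by_contra hneg
    push Not at hneg
    have hc : ContinuousAt (fun s : ℝ => p + s • (l - p)) t := by fun_prop
    have h1 := ((hc.tendsto.eventually (Metric.ball_mem_nhds q hε)).filter_mono
      (nhdsWithin_le_nhds (s := Set.Ioi t))).and (Ioo_mem_nhdsGT ht1)
    obtain ⟨s, hsb, hts, hs1⟩ := h1.exists
    set y := p + s • (l - p) with hy
    have hyV : y ∈ V := V.add_mem hpV (V.smul_mem s (V.sub_mem hlV hpV))
    have hyneg : ip3 h y < 0 := by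
      rw [hy, hseg]; nlinarith [mul_pos (sub_pos.2 hts) (sub_pos.2 (hhl.trans hhp))]
    obtain ⟨r, hr0, hr1, hrC, hrl⟩ := exists_last_mem isClosed_kronCone hμC (hlast s hts hs1.le)
    have hrb : μ + r • (y - μ) ∈ Metric.ball q ε := by
      have := (convex_ball q ε).add_smul_sub_mem hμ hsb ⟨hr0, hr1.le⟩
      exact this
    obtain ⟨hrA, hrs⟩ := hball _ hrb
    obtain ⟨φ, -, hB, hqB⟩ := exists_support_mem_properSpans hrs hrC
      (not_eventually_mem_of_last (kronCone_subset_eqSum hμC) hyV hr1 hrl)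
    have h2 := hhA _ (huniq hB (hrA _ hB hqB) ▸ hqB)
    rw [map_add, map_smul, map_sub, smul_eq_mul] at h2
    nlinarith [mul_pos (sub_pos.2 hr1) (neg_pos.2 hneg), mul_nonneg hr0 (neg_pos.2 hyneg).le]

/-- At such a boundary point the tangent map is an isomorphism. -/
theorem tangent_bijective {h q : Spec3 a b c} {ψ : Ten a b c} (hq : StrictAnti3 q)
    (hψ : rho ψ = diag3 q) (h0 : ∀ p, ψ p ≠ 0 → ev h p = 0)
    (hU : ∃ U ∈ 𝓝 q, ∀ μ ∈ U, μ ∈ KronCone a b c → 0 ≤ ip3 h μ)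
    {w : Ten a b c} (hw : ∀ p, ¬ ev h p < 0 → w p = 0) :
    ∃ X ∈ nMinusMod h.1 h.2.1 h.2.2, act X ψ = w := by
  rcases exists_act_or_orthogonal (ψ := ψ) (h := h) with hs | ⟨v, hv0, hv, horth⟩
  · exact hs w hw
  · obtain ⟨u, hu, hneg⟩ := exists_negative_deformation hψ hq h0 hv hv0 (horth h0)
    obtain ⟨U, hU, hUC⟩ := hU
    obtain ⟨μ, hμ, hμC, hlt⟩ := exists_mem_of_second_order hψ hq h0 hu hneg hU
    exact absurd (hUC μ hμ hμC) (not_le.2 hlt)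

/-- The mean of a vector. -/
def mean {n : ℕ} (x : Fin n → ℝ) : ℝ := (∑ i, x i) / n

theorem sum_sub_mean {n : ℕ} (hn : 0 < n) (x : Fin n → ℝ) : ∑ i, (x i - mean x) = 0 := by
  have : (n : ℝ) ≠ 0 := by exact_mod_cast hn.ne'
  rw [Finset.sum_sub_distrib, Finset.sum_const, Finset.card_univ, Fintype.card_fin, mean,
    nsmul_eq_mul, mul_div_cancel₀ _ this, sub_self]

theorem wtPair_mean (h : Spec3 a b c) {q : Spec3 a b c} (hq : q ∈ eqSum a b c) :
    wtPair (fun i => h.1 i - mean h.1) (fun i => h.2.1 i - mean h.2.1)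
      (fun i => h.2.2 i - mean h.2.2) (mean h.1 + mean h.2.1 + mean h.2.2) q = ip3 h q := by
  simp only [wtPair, ip3_apply, dotProduct, sub_mul, Finset.sum_sub_distrib, ← Finset.mul_sum]
  rw [add_mul, add_mul]
  conv_lhs => rw [← hq.1, ← hq.2]
  ring

theorem lowerMod_sub_const {n : ℕ} (x : Fin n → ℝ) (r : ℝ) :
    lowerMod (fun i => x i - r) = lowerMod x := by
  ext M
  simp only [lowerMod, sub_lt_sub_iff_right]

theorem nMinusMod_mean (h : Spec3 a b c) :
    nMinusMod (fun i => h.1 i - mean h.1) (fun i => h.2.1 i - mean h.2.1)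
      (fun i => h.2.2 i - mean h.2.2) = nMinusMod h.1 h.2.1 h.2.2 := by
  simp only [nMinusMod, lowerMod_sub_const]

theorem ev_mean (h : Spec3 a b c) (p) :
    h.1 p.1 - mean h.1 + (h.2.1 p.2.1 - mean h.2.1) + (h.2.2 p.2.2 - mean h.2.2)
      + (mean h.1 + mean h.2.1 + mean h.2.2) = ev h p := by
  simp only [ev]; ring

theorem mem_kronCone_of_ressayre (ha : 1 < a) (hab : a ≤ b) (hbc : b ≤ c) (hcab : c ≤ a * b)
    {l : Spec3 a b c} (hl : Antitone3 l) (hlV : l ∈ eqSum a b c)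
    (hR : ∀ (HA : Fin a → ℝ) (HB : Fin b → ℝ) (HC : Fin c → ℝ) (z : ℝ),
      IsRessayre HA HB HC z → 0 ≤ wtPair HA HB HC z l) : l ∈ KronCone a b c := by
  by_contra hlC
  obtain ⟨h, q, ψ, hq, hψ, hhl, hspan, hU⟩ := exists_supporting ha hab hbc hcab hl hlV hlC
  have h0 (p) (hp : ψ p ≠ 0) : ev h p = 0 := by
    have : omega p ∈ weightSpan {p | ψ p ≠ 0} := Submodule.subset_span ⟨p, hp, rfl⟩
    rw [hspan] at this
    exact (ip3_omega h p).symm.trans this.2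
  have hlt := wtPair_mean h hlV
  refine absurd (hR _ _ _ _ ⟨⟨sum_sub_mean (by omega) _, sum_sub_mean (by omega) _,
    sum_sub_mean (by omega) _⟩, ?_, ?_, ψ, ?_, ?_⟩) (not_le.2 (hlt.trans_lt hhl))
  · rintro ⟨e1, e2, e3, e4⟩
    rw [e1, e2, e3, e4] at hlt
    simp [wtPair] at hlt
    exact hhl.ne hlt.symm
  · have hset : {w : Spec3 a b c | ∃ i j k, h.1 i - mean h.1 + (h.2.1 j - mean h.2.1)
        + (h.2.2 k - mean h.2.2) + (mean h.1 + mean h.2.1 + mean h.2.2) = 0 ∧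
        w = (Pi.single i 1, Pi.single j 1, Pi.single k 1)} = omega '' {p | ev h p = 0} := by
      ext w
      constructor
      · rintro ⟨i, j, k, he, rfl⟩
        exact ⟨(i, j, k), (ev_mean h (i, j, k)).symm.trans he, rfl⟩
      · rintro ⟨p, he, rfl⟩
        exact ⟨p.1, p.2.1, p.2.2, (ev_mean h p).trans he, rfl⟩
    have hspan' : weightSpan {p | ev h p = 0} = eqSum a b c ⊓ LinearMap.ker (ip3 h) := by
      refine le_antisymm (le_inf (weightSpan_le_eqSum _) ?_) ?_
      · rw [weightSpan, Submodule.span_le]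
        rintro _ ⟨p, hp, rfl⟩
        exact (ip3_omega h p).trans hp
      · rw [← hspan]
        exact Submodule.span_mono (Set.image_mono h0)
    rw [Admissible, hset]
    ext x
    change x ∈ weightSpan {p | ev h p = 0} ↔ _
    rw [hspan']
    constructor
    · rintro ⟨h1, h2⟩
      exact ⟨h1.1, h1.2, (wtPair_mean h h1).trans h2⟩
    · rintro ⟨h1, h2, h3⟩
      exact ⟨⟨h1, h2⟩, (wtPair_mean h ⟨h1, h2⟩).symm.trans h3⟩
  · intro p hp
    by_contra hne
    exact hp ((ev_mean h p).trans (h0 p hne))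
  · rw [TangentIso, nMinusMod_mean]
    refine ⟨fun X hX p hp => act_mem_weightNeg h0 hX p fun hlt' => hp ?_, ?_, ?_⟩
    · exact (ev_mean h p).trans_lt hlt'
    · rintro ⟨X, hX⟩ ⟨Y, hY⟩ hXY
      have h1 : act (X - Y) ψ = 0 := by
        rw [act_sub_left, sub_eq_zero]
        exact congrArg Subtype.val hXY
      exact Subtype.ext (sub_eq_zero.1
        (act_injOn_nMinusMod hψ hq (Submodule.sub_mem _ hX hY) h1))
    · rintro ⟨w, hw⟩
      obtain ⟨X, hX, hXw⟩ := tangent_bijective hq hψ h0 hU (w := w) fun p hp =>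
        hw p fun hlt' => hp ((ev_mean h p).symm.trans_lt hlt')
      exact ⟨⟨X, hX⟩, Subtype.ext hXw⟩

end

section

open Matrix Filter Topology

variable {a b c : ℕ}

/-- Layer-cake summation: a signed weight of total mass zero which is nonnegative on the superlevel
sets of `f` pairs nonnegatively with `f`. -/
theorem sum_mul_nonneg_of_superlevel {ι : Type*} [Fintype ι] {v f : ι → ℝ} (h0 : ∑ i, v i = 0)
    (h : ∀ x, 0 ≤ ∑ i with x ≤ f i, v i) : 0 ≤ ∑ i, v i * f i := by
  set M := ∑ i, |f i|
  have hM (i) : |f i| ≤ M := Finset.single_le_sum (f := fun i => |f i|)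
    (fun _ _ => abs_nonneg _) (Finset.mem_univ i)
  have hmem (i) : f i ∈ Set.Icc (-M) M := abs_le.1 (hM i)
  have hle : -M ≤ M := neg_le_self (Finset.sum_nonneg fun _ _ => abs_nonneg _)
  have h_integral : ∫ x in (-M)..M, ∑ i, v i * Set.indicator {x | x ≤ f i} (fun _ => (1 : ℝ)) x
      = ∑ i, v i * (f i + M) := by
    rw [intervalIntegral.integral_finsetSum]
    · refine Finset.sum_congr rfl fun i _ => ?_
      rw [intervalIntegral.integral_const_mul, intervalIntegral.integral_indicator (hmem i)]
      simp
    · intro i _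
      refine IntervalIntegrable.const_mul ?_ _
      rw [intervalIntegrable_iff]
      exact (intervalIntegrable_iff.1 intervalIntegrable_const).indicator measurableSet_Iic
  have hnn : 0 ≤ ∫ x in (-M)..M, ∑ i, v i * Set.indicator {x | x ≤ f i} (fun _ => (1 : ℝ)) x := by
    refine intervalIntegral.integral_nonneg hle fun x _ => ?_
    have h1 := h x
    rw [Finset.sum_filter] at h1
    refine h1.trans_eq (Finset.sum_congr rfl fun i _ => ?_)
    simp [Set.indicator_apply]
  rw [h_integral] at hnn
  simpa [mul_add, Finset.sum_add_distrib, ← Finset.sum_mul, h0] using hnn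

/-- The mass of an orthonormal family on a set of coordinates is bounded below by the dimension of
the space of vectors that they span and that are supported there. -/
theorem card_le_sum_normSq {n : ℕ} (u : OrthonormalBasis (Fin n) ℂ (EuclideanSpace ℂ (Fin n)))
    {S K J : Finset (Fin n)} {v : Fin n → EuclideanSpace ℂ (Fin n)} (hv : LinearIndependent ℂ v)
    (hS : ∀ j ∈ J, ∀ i ∉ S, inner ℂ (u i) (v j) = 0) (hK : ∀ j ∈ J, ∀ m ∉ K, v j m = 0) :
    (J.card : ℝ) ≤ ∑ i ∈ S, ∑ m ∈ K, ‖u i m‖ ^ 2 := by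
  set W := Submodule.span ℂ (Set.range fun j : J => v j)
  have hfr : Module.finrank ℂ W = J.card := by
    have := finrank_span_eq_card (hv.comp (fun j : J => (j : Fin n)) Subtype.val_injective)
    rw [Fintype.card_coe] at this
    exact this
  have hWS (w) (hw : w ∈ W) (i) (hi : i ∉ S) : inner ℂ (u i) w = 0 := by
    induction hw using Submodule.span_induction with
    | mem x hx => obtain ⟨j, rfl⟩ := hx; exact hS j j.2 i hi
    | zero => exact inner_zero_right _
    | add x y _ _ hx hy => rw [inner_add_right, hx, hy, add_zero]
    | smul r x _ hx => rw [inner_smul_right, hx, mul_zero]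
  have hWK (w) (hw : w ∈ W) (m) (hm : m ∉ K) : w m = 0 := by
    induction hw using Submodule.span_induction with
    | mem x hx => obtain ⟨j, rfl⟩ := hx; exact hK j j.2 m hm
    | zero => rfl
    | add x y _ _ hx hy => rw [PiLp.add_apply, hx, hy, add_zero]
    | smul r x _ hx => rw [PiLp.smul_apply, hx, smul_zero]
  let w := stdOrthonormalBasis ℂ W
  have hw : Orthonormal ℂ fun l => (w l : EuclideanSpace ℂ (Fin n)) :=
    w.orthonormal.comp_linearIsometry W.subtypeₗᵢ
  have h1 (l) : ∑ i ∈ S, ‖inner ℂ (w l : EuclideanSpace ℂ (Fin n)) (u i)‖ ^ 2 = 1 := by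
    have h := u.sum_sq_norm_inner_left (w l : EuclideanSpace ℂ (Fin n))
    rw [hw.1 l, one_pow] at h
    rw [← h]
    refine Finset.sum_subset (Finset.subset_univ _) fun i _ hi => ?_
    rw [norm_inner_symm, hWS _ (w l).2 i hi]; simp
  have h2 (i) : ∑ l, ‖inner ℂ (w l : EuclideanSpace ℂ (Fin n)) (u i)‖ ^ 2
      ≤ ∑ m ∈ K, ‖u i m‖ ^ 2 := by
    let t : EuclideanSpace ℂ (Fin n) := WithLp.toLp 2 fun m => if m ∈ K then u i m else 0
    have ht (l) : inner ℂ (w l : EuclideanSpace ℂ (Fin n)) (u i)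
        = inner ℂ (w l : EuclideanSpace ℂ (Fin n)) t := by
      simp only [PiLp.inner_apply, t]
      refine Finset.sum_congr rfl fun m _ => ?_
      by_cases hm : m ∈ K
      · simp [hm]
      · simp [hWK _ (w l).2 m hm]
    have h3 := hw.sum_inner_products_le t (s := Finset.univ)
    simp only [ht]
    refine h3.trans_eq ?_
    rw [EuclideanSpace.norm_sq_eq]
    simp only [t, apply_ite norm, norm_zero, ite_pow]
    simp [Finset.sum_ite_mem]
  calc (J.card : ℝ) = ∑ l, ∑ i ∈ S, ‖inner ℂ (w l : EuclideanSpace ℂ (Fin n)) (u i)‖ ^ 2 := by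
        simp only [h1, Finset.sum_const, Finset.card_univ, Fintype.card_fin, hfr, nsmul_eq_mul,
          mul_one]
    _ = ∑ i ∈ S, ∑ l, ‖inner ℂ (w l : EuclideanSpace ℂ (Fin n)) (u i)‖ ^ 2 := Finset.sum_comm
    _ ≤ _ := Finset.sum_le_sum fun i _ => h2 i

/-- Lower triangular matrices with unit diagonal. -/
def LowerUnipotent {n : ℕ} (m : Matrix (Fin n) (Fin n) ℂ) : Prop :=
  (∀ i j, i < j → m i j = 0) ∧ ∀ i, m i i = 1

/-- The columns of a lower unipotent matrix, orthonormalised in decreasing order of `x`. -/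
theorem LowerUnipotent.exists_unitary {n : ℕ} {m : Matrix (Fin n) (Fin n) ℂ}
    (hm : LowerUnipotent m) (x : Fin n → ℝ) :
    ∃ U : Matrix (Fin n) (Fin n) ℂ, Uᴴ * U = 1 ∧ (∀ i j, (Uᴴ * m) i j ≠ 0 → x j ≤ x i) ∧
      ∀ S K : Finset (Fin n), (∀ i j, x i ≤ x j → i ∈ S → j ∈ S) → (∀ i j, i ≤ j → i ∈ K → j ∈ K) →
        ((S ∩ K).card : ℝ) ≤ ∑ i ∈ S, ∑ k ∈ K, ‖U k i‖ ^ 2 := by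
  let v : Fin n → EuclideanSpace ℂ (Fin n) := fun j => WithLp.toLp 2 fun i => m i j
  have hdet : m.det = 1 := by
    rw [Matrix.det_of_isLowerTriangular m fun i j hij => hm.1 i j hij]
    simp [hm.2]
  have hv : LinearIndependent ℂ v := by
    have h : LinearIndependent ℂ m.col :=
      Matrix.linearIndependent_cols_of_isUnit ((Matrix.isUnit_iff_isUnit_det m).2 (by simp [hdet]))
    exact h.map' (WithLp.linearEquiv 2 ℂ (Fin n → ℂ)).symm.toLinearMap (LinearEquiv.ker _)
  let σ := Tuple.sort fun i => -x i
  have hσ : Monotone ((fun i => -x i) ∘ σ) := Tuple.monotone_sort _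
  let u₀ := InnerProductSpace.gramSchmidtOrthonormalBasis (𝕜 := ℂ)
    (by simp : Module.finrank ℂ (EuclideanSpace ℂ (Fin n)) = Fintype.card (Fin n)) (v ∘ σ)
  let u := u₀.reindex σ
  have hu (i j) (hij : inner ℂ (u i) (v j) ≠ 0) : x j ≤ x i := by
    by_contra hlt
    push Not at hlt
    have h1 : σ.symm j < σ.symm i := by
      by_contra hle
      have := hσ (not_lt.1 hle)
      simp only [Function.comp, Equiv.apply_symm_apply] at this
      linarith
    have h2 := InnerProductSpace.gramSchmidtOrthonormalBasis_inv_triangular (𝕜 := ℂ)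
      (by simp : Module.finrank ℂ (EuclideanSpace ℂ (Fin n)) = Fintype.card (Fin n)) (v ∘ σ) h1
    refine hij ?_
    simpa [u] using h2
  let U : Matrix (Fin n) (Fin n) ℂ := Matrix.of fun k i => u i k
  have hUU (i) (y : Fin n → ℂ) : star (fun k => U k i) ⬝ᵥ y = inner ℂ (u i) (WithLp.toLp 2 y) := by
    simp [PiLp.inner_apply, dotProduct, U, mul_comm]
  refine ⟨U, ?_, fun i j hij => hu i j ?_, fun S K hS hK => ?_⟩
  · ext i j
    have h1 := hUU i fun k => U k j
    have h2 := (orthonormal_iff_ite.1 u.orthonormal) i j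
    exact h1.trans (h2.trans (Matrix.one_apply).symm)
  · rw [← show _ = inner ℂ (u i) (v j) from hUU i fun k => m k j]
    exact hij
  · refine card_le_sum_normSq u hv (J := S ∩ K) (fun j hj i hi => ?_) fun j hj k hk => ?_
    · by_contra hne
      exact hi (hS j i (hu i j hne) (Finset.mem_inter.1 hj).1)
    · by_contra hne
      refine hk (hK j k ?_ (Finset.mem_inter.1 hj).2)
      by_contra hlt
      exact hne (hm.1 k j (not_le.1 hlt))

/-- Rotating a sorted diagonal matrix by such a unitary does not increase its pairing with `x`. -/
theorem sum_mul_sum_normSq_le {n : ℕ} {U : Matrix (Fin n) (Fin n) ℂ} (hU : Uᴴ * U = 1)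
    {x l : Fin n → ℝ} (hl : Antitone l)
    (h : ∀ S K : Finset (Fin n), (∀ i j, x i ≤ x j → i ∈ S → j ∈ S) →
      (∀ i j, i ≤ j → i ∈ K → j ∈ K) → ((S ∩ K).card : ℝ) ≤ ∑ i ∈ S, ∑ k ∈ K, ‖U k i‖ ^ 2) :
    ∑ i, x i * ∑ k, l k * ‖U k i‖ ^ 2 ≤ ∑ i, x i * l i := by
  have hU' : U * Uᴴ = 1 := mul_eq_one_comm.1 hU
  have hcol (i) : ∑ k, ‖U k i‖ ^ 2 = 1 := by
    have h1 := congrFun (congrFun hU i) i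
    simp only [Matrix.mul_apply, Matrix.conjTranspose_apply, Matrix.one_apply_eq, RCLike.star_def,
      Complex.conj_mul'] at h1
    exact_mod_cast h1
  have hrow (k) : ∑ i, ‖U k i‖ ^ 2 = 1 := by
    have h1 := congrFun (congrFun hU' k) k
    simp only [Matrix.mul_apply, Matrix.conjTranspose_apply, Matrix.one_apply_eq, RCLike.star_def,
      Complex.mul_conj'] at h1
    exact_mod_cast h1
  let M : Fin n → Fin n → ℝ := fun k i => ‖U k i‖ ^ 2 - if k = i then 1 else 0
  have hM : 0 ≤ ∑ i, (∑ k, M k i * -l k) * x i := by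
    refine sum_mul_nonneg_of_superlevel ?_ fun y => ?_
    · rw [Finset.sum_comm]
      refine Finset.sum_eq_zero fun k _ => ?_
      rw [← Finset.sum_mul]
      simp [M, Finset.sum_sub_distrib, hrow]
    · rw [Finset.sum_comm]
      simp only [← Finset.sum_mul]
      refine sum_mul_nonneg_of_superlevel ?_ fun y' => ?_
      · rw [Finset.sum_comm]
        refine Finset.sum_eq_zero fun i _ => ?_
        simp [M, Finset.sum_sub_distrib, hcol]
      · have h1 := h (Finset.univ.filter fun i => y ≤ x i) (Finset.univ.filter fun k => y' ≤ -l k)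
          (fun i j hij hi => by
            simp only [Finset.mem_filter, Finset.mem_univ, true_and] at hi ⊢
            exact hi.trans hij)
          (fun i j hij hi => by
            simp only [Finset.mem_filter, Finset.mem_univ, true_and] at hi ⊢
            exact hi.trans (neg_le_neg (hl hij)))
        rw [Finset.sum_comm]
        simp only [M, Finset.sum_sub_distrib, Finset.sum_ite_eq']
        rw [sub_nonneg]
        refine le_trans (le_of_eq ?_) h1
        rw [Finset.sum_ite_mem]
        simp
  have : ∑ i, (∑ k, M k i * -l k) * x i
      = ∑ i, x i * l i - ∑ i, x i * ∑ k, l k * ‖U k i‖ ^ 2 := by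
    rw [← Finset.sum_sub_distrib]
    refine Finset.sum_congr rfl fun i _ => ?_
    simp only [M, sub_mul, Finset.sum_sub_distrib, ite_mul, one_mul, zero_mul, Finset.sum_ite_eq',
      Finset.mem_univ, if_true]
    simp only [mul_neg, Finset.sum_neg_distrib, mul_comm (l _)]
    ring
  linarith

end

section

open Matrix Filter Topology

variable {a b c : ℕ}

/-- The total deviation of a matrix from a real diagonal matrix. -/
def diagDev {n : ℕ} (R : Matrix (Fin n) (Fin n) ℂ) (l : Fin n → ℝ) : ℝ :=
  ∑ k, ∑ k', ‖R k k' - Matrix.diagonal (fun i => (l i : ℂ)) k k'‖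

theorem LowerUnipotent.exists_unitary_diag_le {n : ℕ} {m : Matrix (Fin n) (Fin n) ℂ}
    (hm : LowerUnipotent m) (x : Fin n → ℝ) :
    ∃ U : Matrix (Fin n) (Fin n) ℂ, Uᴴ * U = 1 ∧ (∀ i j, (Uᴴ * m) i j ≠ 0 → x j ≤ x i) ∧
      ∀ (R : Matrix (Fin n) (Fin n) ℂ) (l : Fin n → ℝ), Antitone l →
        ∑ i, x i * ((Uᴴ * R * U) i i).re ≤ x ⬝ᵥ l + (∑ i, |x i|) * diagDev R l := by
  obtain ⟨U, hU, hUm, h⟩ := hm.exists_unitary x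
  refine ⟨U, hU, hUm, fun R l hl => ?_⟩
  have hcol (i) : ∑ k, ‖U k i‖ ^ 2 = 1 := by
    have h1 := congrFun (congrFun hU i) i
    simp only [Matrix.mul_apply, Matrix.conjTranspose_apply, Matrix.one_apply_eq, RCLike.star_def,
      Complex.conj_mul'] at h1
    exact_mod_cast h1
  have hent (k i) : ‖U k i‖ ≤ 1 := by
    have h1 := Finset.single_le_sum (f := fun k => ‖U k i‖ ^ 2) (fun _ _ => sq_nonneg _)
      (Finset.mem_univ k)
    rw [hcol] at h1
    exact (sq_le_one_iff₀ (norm_nonneg _)).1 h1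
  set E := R - Matrix.diagonal (fun i => (l i : ℂ)) with hE
  have hdiag (i) : ((Uᴴ * Matrix.diagonal (fun i => (l i : ℂ)) * U) i i).re
      = ∑ k, l k * ‖U k i‖ ^ 2 := by
    rw [Matrix.mul_apply, Complex.re_sum]
    refine Finset.sum_congr rfl fun k _ => ?_
    rw [Matrix.mul_diagonal, Matrix.conjTranspose_apply, mul_right_comm, RCLike.star_def,
      Complex.conj_mul', ← Complex.ofReal_pow, ← Complex.ofReal_mul, Complex.ofReal_re, mul_comm]
  have herr (i) : |((Uᴴ * E * U) i i).re| ≤ diagDev R l := by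
    refine (Complex.abs_re_le_norm _).trans ?_
    simp only [Matrix.mul_apply, Finset.sum_mul]
    refine (norm_sum_le _ _).trans ?_
    rw [diagDev, Finset.sum_comm]
    refine Finset.sum_le_sum fun k' _ => (norm_sum_le _ _).trans (Finset.sum_le_sum fun k _ => ?_)
    rw [norm_mul, norm_mul, Matrix.conjTranspose_apply, norm_star]
    have h1 : ‖U k i‖ * ‖E k k'‖ ≤ 1 * ‖E k k'‖ :=
      mul_le_mul_of_nonneg_right (hent k i) (norm_nonneg _)
    have h2 := mul_le_mul h1 (hent k' i) (norm_nonneg _) (by positivity)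
    simpa [hE] using h2
  have hsplit (i) : ((Uᴴ * R * U) i i).re
      = ∑ k, l k * ‖U k i‖ ^ 2 + ((Uᴴ * E * U) i i).re := by
    rw [← hdiag, ← Complex.add_re, ← Matrix.add_apply, ← Matrix.add_mul, ← Matrix.mul_add, hE,
      add_sub_cancel]
  have h1 := sum_mul_sum_normSq_le hU hl h
  have h2 : ∑ i, x i * ((Uᴴ * E * U) i i).re ≤ (∑ i, |x i|) * diagDev R l := by
    rw [Finset.sum_mul]
    refine Finset.sum_le_sum fun i _ => (le_abs_self _).trans ?_
    rw [abs_mul]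
    exact mul_le_mul_of_nonneg_left (herr i) (abs_nonneg _)
  simp only [hsplit, mul_add, Finset.sum_add_distrib]
  exact add_le_add h1 h2

theorem exists_of_gact_ne_zero {r : Mat3 a b c} {φ : Ten a b c} {p} (h : gact r φ p ≠ 0) :
    ∃ p', φ p' ≠ 0 ∧ r.1 p.1 p'.1 ≠ 0 ∧ r.2.1 p.2.1 p'.2.1 ≠ 0 ∧ r.2.2 p.2.2 p'.2.2 ≠ 0 := by
  simp only [gact, legA, legB, legC] at h
  obtain ⟨i, -, h⟩ := Finset.exists_ne_zero_of_sum_ne_zero h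
  obtain ⟨j, -, h'⟩ := Finset.exists_ne_zero_of_sum_ne_zero (right_ne_zero_of_mul h)
  obtain ⟨k, -, h''⟩ := Finset.exists_ne_zero_of_sum_ne_zero (right_ne_zero_of_mul h')
  exact ⟨(i, j, k), right_ne_zero_of_mul h'', left_ne_zero_of_mul h, left_ne_zero_of_mul h',
    left_ne_zero_of_mul h''⟩

theorem sum_ev_normSq (h : Spec3 a b c) (φ : Ten a b c) :
    ∑ p, ev h p * Complex.normSq (φ p) = ∑ i, h.1 i * ((rho φ).1 i i).re
      + ∑ i, h.2.1 i * ((rho φ).2.1 i i).re + ∑ i, h.2.2 i * ((rho φ).2.2 i i).re := by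
  have h1 := dotProduct_act φ φ (diag3 h)
  rw [star_dotProduct_act_diag3, ← rho_eq_rhoBil] at h1
  have h2 {n : ℕ} (M : Matrix (Fin n) (Fin n) ℂ) (x : Fin n → ℝ) :
      (M * Matrix.diagonal fun i => (x i : ℂ)).trace.re = ∑ i, x i * (M i i).re := by
    rw [Matrix.trace, Complex.re_sum]
    refine Finset.sum_congr rfl fun i _ => ?_
    rw [Matrix.diag_apply, Matrix.mul_diagonal, Complex.re_mul_ofReal, mul_comm]
  have h3 := congrArg Complex.re h1
  rw [Complex.ofReal_re] at h3
  rw [h3, tr3, Complex.add_re, Complex.add_re]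
  exact congrArg₂ _ (congrArg₂ _ (h2 _ _) (h2 _ _)) (h2 _ _)

/-- The total deviation of a triple of matrices from a real diagonal triple. -/
def diagDev3 (R : Mat3 a b c) (l : Spec3 a b c) : ℝ :=
  diagDev R.1 l.1 + diagDev R.2.1 l.2.1 + diagDev R.2.2 l.2.2

theorem diagDev_nonneg {n : ℕ} (R : Matrix (Fin n) (Fin n) ℂ) (l : Fin n → ℝ) : 0 ≤ diagDev R l :=
  Finset.sum_nonneg fun _ _ => Finset.sum_nonneg fun _ _ => norm_nonneg _

theorem diagDev3_diag3 (l : Spec3 a b c) : diagDev3 (diag3 l) l = 0 := by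
  simp [diagDev3, diagDev, diag3]

theorem continuous_diagDev3_rho (l : Spec3 a b c) :
    Continuous fun ψ : Ten a b c => diagDev3 (rho ψ) l := by
  have h := continuous_rho (a := a) (b := b) (c := c)
  have hd {n : ℕ} {f : Ten a b c → Matrix (Fin n) (Fin n) ℂ} (hf : Continuous f) (x : Fin n → ℝ) :
      Continuous fun ψ => diagDev (f ψ) x :=
    continuous_finsetSum _ fun k _ => continuous_finsetSum _ fun k' _ =>
      ((hf.matrix_elem k k').sub continuous_const).norm
  exact ((hd h.fst _).add (hd h.snd.fst _)).add (hd h.snd.snd _)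

/-- Approximate positivity on the lower unipotent orbits of the nonnegative-weight tensors. -/
theorem ip3_add_diagDev3_nonneg (h : Spec3 a b c) {m : Mat3 a b c} (hA : LowerUnipotent m.1)
    (hB : LowerUnipotent m.2.1) (hC : LowerUnipotent m.2.2) {φ : Ten a b c}
    (hφ : ∀ p, φ p ≠ 0 → 0 ≤ ev h p) {l : Spec3 a b c} (hl : Antitone3 l) :
    0 ≤ ip3 h l + (∑ i, |h.1 i| + ∑ i, |h.2.1 i| + ∑ i, |h.2.2 i|)
      * diagDev3 (rho (gact m φ)) l := by
  obtain ⟨UA, hUA, hrA, hlA⟩ := hA.exists_unitary_diag_le h.1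
  obtain ⟨UB, hUB, hrB, hlB⟩ := hB.exists_unitary_diag_le h.2.1
  obtain ⟨UC, hUC, hrC, hlC⟩ := hC.exists_unitary_diag_le h.2.2
  let U : Mat3 a b c := (UA, UB, UC)
  have hU : U * star U = 1 :=
    Prod.ext (mul_eq_one_comm.1 hUA) (Prod.ext (mul_eq_one_comm.1 hUB) (mul_eq_one_comm.1 hUC))
  set R := rho (gact m φ)
  have hR : rho (gact (star U * m) φ) = star U * R * U := by
    rw [gact_mul, rho_gact (by rw [star_star, hU]), star_star]
  have hnn : 0 ≤ ∑ p, ev h p * Complex.normSq (gact (star U * m) φ p) := by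
    refine Finset.sum_nonneg fun p _ => ?_
    by_cases hp : gact (star U * m) φ p = 0
    · rw [hp, map_zero, mul_zero]
    · obtain ⟨p', h0, h1, h2, h3⟩ := exists_of_gact_ne_zero hp
      refine mul_nonneg ((hφ p' h0).trans ?_) (Complex.normSq_nonneg _)
      exact add_le_add (add_le_add (hrA _ _ h1) (hrB _ _ h2)) (hrC _ _ h3)
  rw [sum_ev_normSq, hR] at hnn
  have eA := hlA R.1 l.1 hl.1
  have eB := hlB R.2.1 l.2.1 hl.2.1
  have eC := hlC R.2.2 l.2.2 hl.2.2
  have dA := diagDev_nonneg R.1 l.1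
  have dB := diagDev_nonneg R.2.1 l.2.1
  have dC := diagDev_nonneg R.2.2 l.2.2
  have sA : 0 ≤ ∑ i, |h.1 i| := Finset.sum_nonneg fun _ _ => abs_nonneg _
  have sB : 0 ≤ ∑ i, |h.2.1 i| := Finset.sum_nonneg fun _ _ => abs_nonneg _
  have sC : 0 ≤ ∑ i, |h.2.2 i| := Finset.sum_nonneg fun _ _ => abs_nonneg _
  have hsum := hnn.trans (add_le_add (add_le_add eA eB) eC)
  rw [ip3_apply, diagDev3]
  nlinarith [mul_nonneg sA dB, mul_nonneg sA dC, mul_nonneg sB dA, mul_nonneg sB dC,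
    mul_nonneg sC dA, mul_nonneg sC dB]

/-- Positivity on the whole cone follows from density of those orbits. -/
theorem ip3_nonneg_of_dense {h : Spec3 a b c}
    (hd : Dense {ψ : Ten a b c | ∃ (m : Mat3 a b c) (φ : Ten a b c), LowerUnipotent m.1 ∧
      LowerUnipotent m.2.1 ∧ LowerUnipotent m.2.2 ∧ (∀ p, φ p ≠ 0 → 0 ≤ ev h p) ∧ gact m φ = ψ})
    {l : Spec3 a b c} (hl : l ∈ KronCone a b c) : 0 ≤ ip3 h l := by
  obtain ⟨ha, ψ, hψ⟩ := mem_kronCone_iff.1 hl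
  have hcl : IsClosed {ψ : Ten a b c | 0 ≤ ip3 h l +
      (∑ i, |h.1 i| + ∑ i, |h.2.1 i| + ∑ i, |h.2.2 i|) * diagDev3 (rho ψ) l} :=
    isClosed_le continuous_const
      (continuous_const.add (continuous_const.mul (continuous_diagDev3_rho l)))
  have hall := hcl.closure_subset_iff.2 (by
    rintro ψ ⟨m, φ, hA, hB, hC, hφ, rfl⟩
    exact ip3_add_diagDev3_nonneg h hA hB hC hφ ha) (hd ψ)
  simpa [hψ, diagDev3_diag3] using hall

end

section

open Matrix Filter Topology

variable {a b c : ℕ}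

variable (a b c) in
/-- Coordinates for a triple of matrices and a tensor. -/
abbrev OrbitCoord : Type :=
  (Fin a × Fin a) ⊕ (Fin b × Fin b) ⊕ (Fin c × Fin c) ⊕ (Fin a × Fin b × Fin c)

open Classical in
/-- The entries of the lower triangular matrix strictly compatible with `x`. -/
def maskedMatrix {R : Type} [CommRing R] {n : ℕ} (x : Fin n → ℝ) (y : Fin n × Fin n → R) :
    Matrix (Fin n) (Fin n) R :=
  Matrix.of fun i' i => if i < i' ∧ x i' < x i then y (i', i) else 0

open Classical in
/-- Restriction of a tensor to the indices of nonnegative weight. -/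
def maskedTensor {R : Type} [CommRing R] (h : Spec3 a b c) (y : Fin a × Fin b × Fin c → R) :
    Fin a × Fin b × Fin c → R := fun p => if 0 ≤ ev h p then y p else 0

/-- The orbit map of the lower unipotent group on the tensors of nonnegative weight. -/
def orbitMap {R : Type} [CommRing R] (h : Spec3 a b c) (x : OrbitCoord a b c → R) :
    Fin a × Fin b × Fin c → R := fun p =>
  ∑ i, (1 + maskedMatrix h.1 (fun s => x (.inl s))) p.1 i *
    ∑ j, (1 + maskedMatrix h.2.1 (fun s => x (.inr (.inl s)))) p.2.1 j *
      ∑ k, (1 + maskedMatrix h.2.2 (fun s => x (.inr (.inr (.inl s))))) p.2.2 k *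
        maskedTensor h (fun s => x (.inr (.inr (.inr s)))) (i, j, k)

theorem map_one_add_maskedMatrix {R S : Type} [CommRing R] [CommRing S] (f : R →+* S) {n : ℕ}
    (x : Fin n → ℝ) (y : Fin n × Fin n → R) (i j) :
    f ((1 + maskedMatrix x y) i j) = (1 + maskedMatrix x fun s => f (y s)) i j := by
  simp only [Matrix.add_apply, Matrix.one_apply, maskedMatrix, Matrix.of_apply, map_add, apply_ite f,
    map_one, map_zero]

theorem map_orbitMap {R S : Type} [CommRing R] [CommRing S] (f : R →+* S) (h : Spec3 a b c)
    (x : OrbitCoord a b c → R) (p) : f (orbitMap h x p) = orbitMap h (fun s => f (x s)) p := by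
  simp only [orbitMap, map_sum, map_mul, map_one_add_maskedMatrix]
  simp only [maskedTensor, apply_ite f, map_zero]

theorem orbitMap_eq_gact (h : Spec3 a b c) (x : OrbitCoord a b c → ℂ) :
    orbitMap h x = gact (1 + maskedMatrix h.1 fun s => x (.inl s),
      1 + maskedMatrix h.2.1 fun s => x (.inr (.inl s)),
      1 + maskedMatrix h.2.2 fun s => x (.inr (.inr (.inl s))))
      (maskedTensor h fun s => x (.inr (.inr (.inr s)))) := rfl

theorem lowerUnipotent_one_add_maskedMatrix {n : ℕ} (x : Fin n → ℝ) (y : Fin n × Fin n → ℂ) :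
    LowerUnipotent (1 + maskedMatrix x y) := by
  refine ⟨fun i j hij => ?_, fun i => ?_⟩
  · simp [maskedMatrix, hij.ne, hij.not_gt]
  · simp [maskedMatrix]

theorem contDiff_orbitMap (h : Spec3 a b c) :
    ContDiff ℝ 1 (orbitMap h : (OrbitCoord a b c → ℂ) → Ten a b c) := by
  have hm {n : ℕ} (x : Fin n → ℝ) (f : Fin n × Fin n → OrbitCoord a b c) (i j) :
      ContDiff ℝ 1 fun y : OrbitCoord a b c → ℂ => (1 + maskedMatrix x fun s => y (f s)) i j := by
    simp only [Matrix.add_apply, maskedMatrix, Matrix.of_apply]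
    refine contDiff_const.add ?_
    split_ifs
    · exact contDiff_apply ℝ ℂ _
    · exact contDiff_const
  refine contDiff_pi.2 fun p => ?_
  refine ContDiff.sum fun i _ => (hm _ _ _ _).mul (ContDiff.sum fun j _ => (hm _ _ _ _).mul
    (ContDiff.sum fun k _ => (hm _ _ _ _).mul ?_))
  simp only [maskedTensor]
  split_ifs
  · exact contDiff_apply ℝ ℂ _
  · exact contDiff_const

theorem hasDerivAt_one_add_smul {u : ℝ → Ten a b c} {u' ψ : Ten a b c} (hu : HasDerivAt u u' 0)
    (h0 : u 0 = ψ) {L : Ten a b c →ₗ[ℝ] Ten a b c} {F : ℝ → Ten a b c}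
    (hF : ∀ t, F t = u t + t • L (u t)) : HasDerivAt F (u' + L ψ) 0 := by
  have h1 := (hasDerivAt_id (0 : ℝ)).fun_smul
    ((LinearMap.toContinuousLinearMap L).hasFDerivAt.comp_hasDerivAt (0 : ℝ) hu)
  have h2 := hu.fun_add h1
  rw [show F = fun t => u t + t • L (u t) from funext hF, ← h0]
  simpa using! h2

/-- The derivative at the identity of the action on a moving tensor. -/
theorem hasDerivAt_gact (X : Mat3 a b c) (ψ φ : Ten a b c) :
    HasDerivAt (fun t : ℝ => gact (1 + t • X.1, 1 + t • X.2.1, 1 + t • X.2.2) (ψ + t • φ))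
      (φ + act X ψ) 0 := by
  have h0 : HasDerivAt (fun t : ℝ => ψ + t • φ) φ 0 := by
    simpa using! ((hasDerivAt_id (0 : ℝ)).smul_const φ).const_add ψ
  let LA : Ten a b c →ₗ[ℝ] Ten a b c :=
    { toFun := legA X.1
      map_add' := fun x y => by funext p; simp [legA, mul_add, Finset.sum_add_distrib]
      map_smul' := fun r x => by
        funext p; simp only [legA, Pi.smul_apply, mul_smul_comm, Finset.smul_sum, RingHom.id_apply] }
  let LB : Ten a b c →ₗ[ℝ] Ten a b c :=
    { toFun := legB X.2.1
      map_add' := fun x y => by funext p; simp [legB, mul_add, Finset.sum_add_distrib]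
      map_smul' := fun r x => by
        funext p; simp only [legB, Pi.smul_apply, mul_smul_comm, Finset.smul_sum, RingHom.id_apply] }
  let LC : Ten a b c →ₗ[ℝ] Ten a b c :=
    { toFun := legC X.2.2
      map_add' := fun x y => by funext p; simp [legC, mul_add, Finset.sum_add_distrib]
      map_smul' := fun r x => by
        funext p; simp only [legC, Pi.smul_apply, mul_smul_comm, Finset.smul_sum, RingHom.id_apply] }
  have h1 := hasDerivAt_one_add_smul (F := fun t => legC (1 + t • X.2.2) (ψ + t • φ))
    (ψ := ψ) (L := LC) h0 (by simp) fun t => by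
      funext p
      simp [legC, LC, Matrix.one_apply, add_mul, Finset.sum_add_distrib, Finset.mul_sum, mul_assoc]
  have h2 := hasDerivAt_one_add_smul
    (F := fun t => legB (1 + t • X.2.1) (legC (1 + t • X.2.2) (ψ + t • φ)))
    (ψ := ψ) (L := LB) h1 (by simp [legC_one]) fun t => by
      funext p
      simp [legB, LB, Matrix.one_apply, add_mul, Finset.sum_add_distrib, Finset.mul_sum, mul_assoc]
  have h3 := hasDerivAt_one_add_smul
    (F := fun t => legA (1 + t • X.1) (legB (1 + t • X.2.1) (legC (1 + t • X.2.2) (ψ + t • φ))))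
    (ψ := ψ) (L := LA) h2 (by simp [legC_one, legB_one]) fun t => by
      funext p
      simp [legA, LA, Matrix.one_apply, add_mul, Finset.sum_add_distrib, Finset.mul_sum, mul_assoc]
  have he : φ + act X ψ = φ + LC ψ + LB ψ + LA ψ := by
    rw [act_eq_legs]
    change φ + (LA ψ + LB ψ + LC ψ) = _
    abel
  rw [he]
  exact h3

theorem maskedMatrix_of_mem {n : ℕ} {x : Fin n → ℝ} {M : Matrix (Fin n) (Fin n) ℂ}
    (hM : M ∈ lowerMod x) : (maskedMatrix x fun s => M s.1 s.2) = M := by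
  ext i' i
  simp only [maskedMatrix, Matrix.of_apply]
  split_ifs with h
  · rfl
  · exact (hM i' i h).symm

/-- If the tangent map at a zero-weight tensor is surjective, then the orbits of the nonnegative
weight tensors are dense. -/
theorem denseRange_orbitMap {h : Spec3 a b c} {ψ : Ten a b c} (h0 : ∀ p, ψ p ≠ 0 → ev h p = 0)
    (hs : ∀ w : Ten a b c, (∀ p, ¬ ev h p < 0 → w p = 0) →
      ∃ X ∈ nMinusMod h.1 h.2.1 h.2.2, act X ψ = w) :
    DenseRange (orbitMap h : (OrbitCoord a b c → ℂ) → Ten a b c) := by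
  classical
  let L : (OrbitCoord a b c → ℂ) → Ten a b c := fun v =>
    maskedTensor h (fun s => v (.inr (.inr (.inr s)))) + act (maskedMatrix h.1 fun s => v (.inl s),
      maskedMatrix h.2.1 fun s => v (.inr (.inl s)),
      maskedMatrix h.2.2 fun s => v (.inr (.inr (.inl s)))) ψ
  let x₀ : OrbitCoord a b c → ℂ :=
    Sum.elim (fun _ => 0) (Sum.elim (fun _ => 0) (Sum.elim (fun _ => 0) ψ))
  have hψ : maskedTensor h ψ = ψ := by
    funext p
    simp only [maskedTensor]
    split_ifs with hp
    · rfl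
    · by_contra hne
      exact hp (h0 p (Ne.symm hne)).ge
  have hL : Function.Surjective L := by
    intro w
    obtain ⟨X, hX, hXw⟩ := hs (fun p => if ev h p < 0 then w p else 0) fun p hp => if_neg hp
    refine ⟨Sum.elim (fun s => X.1 s.1 s.2) (Sum.elim (fun s => X.2.1 s.1 s.2)
      (Sum.elim (fun s => X.2.2 s.1 s.2) w)), ?_⟩
    simp only [L, Sum.elim_inl, Sum.elim_inr, maskedMatrix_of_mem hX.1,
      maskedMatrix_of_mem hX.2.1, maskedMatrix_of_mem hX.2.2]
    rw [show ((X.1, X.2.1, X.2.2) : Mat3 a b c) = X from rfl, hXw]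
    funext p
    simp only [Pi.add_apply, maskedTensor]
    rcases lt_or_ge (ev h p) 0 with hp | hp
    · simp [hp, hp.not_ge]
    · simp [hp, hp.not_gt]
  have hd (v) : HasDerivAt (fun t : ℝ => orbitMap h (x₀ + t • v)) (L v) 0 := by
    refine (hasDerivAt_gact (maskedMatrix h.1 fun s => v (.inl s),
      maskedMatrix h.2.1 fun s => v (.inr (.inl s)),
      maskedMatrix h.2.2 fun s => v (.inr (.inr (.inl s)))) ψ
      (maskedTensor h fun s => v (.inr (.inr (.inr s))))).congr_of_eventuallyEq
      (Eventually.of_forall fun t => ?_)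
    have hm {n : ℕ} (x : Fin n → ℝ) (y : Fin n × Fin n → ℂ) :
        (maskedMatrix x fun s => 0 + t • y s) = t • maskedMatrix x y := by
      ext i j
      simp [maskedMatrix]
    have ht (y : Ten a b c) : (maskedTensor h fun s => ψ s + t • y s)
        = ψ + t • maskedTensor h y := by
      conv_rhs => rw [← hψ]
      funext p
      simp only [maskedTensor, Pi.add_apply, Pi.smul_apply]
      split_ifs <;> simp
    beta_reduce
    rw [orbitMap_eq_gact]
    simp only [Pi.add_apply, Pi.smul_apply, x₀, Sum.elim_inl, Sum.elim_inr, hm, ht]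
  have hmap := map_nhds_eq_of_directional (contDiff_orbitMap h) hL hd
  have hP : (fun (x : OrbitCoord a b c → ℂ) t => MvPolynomial.eval x
      (orbitMap h MvPolynomial.X t)) = orbitMap h := by
    funext x t
    rw [map_orbitMap]
    simp
  rw [← hP]
  refine denseRange_eval_of_range_mem_nhds _ (y₀ := orbitMap h x₀) ?_
  rw [hP, ← hmap]
  exact range_mem_map

theorem wtPair_nonneg_of_tangentSurj {HA : Fin a → ℝ} {HB : Fin b → ℝ} {HC : Fin c → ℝ} {z : ℝ}
    {ψ : Ten a b c} (hψ : ψ ∈ weight0Space HA HB HC z) (hs : TangentSurj HA HB HC z ψ)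
    {l : Spec3 a b c} (hl : l ∈ KronCone a b c) : 0 ≤ wtPair HA HB HC z l := by
  let h : Spec3 a b c := (fun i => HA i + z, HB, HC)
  have hev (p) : HA p.1 + HB p.2.1 + HC p.2.2 + z = ev h p := by
    simp only [ev, h]; ring
  have hlow : lowerMod h.1 = lowerMod HA := by
    ext M
    simp only [lowerMod, h, add_lt_add_iff_right]
  have hpair : wtPair HA HB HC z l = ip3 h l := by
    simp only [wtPair, ip3_apply, dotProduct, h, add_mul, Finset.sum_add_distrib, ← Finset.mul_sum]
    ring
  obtain ⟨hmem, hs⟩ := hs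
  have hdense := denseRange_orbitMap (h := h) (ψ := ψ)
    (fun p hp => by
      by_contra hne
      exact hp (hψ p fun he => hne ((hev p).symm.trans he)))
    (fun w hw => by
      obtain ⟨⟨X, hX⟩, hXw⟩ := hs ⟨w, fun p hp => hw p fun hlt => hp ((hev p).trans_lt hlt)⟩
      refine ⟨X, ?_, congrArg Subtype.val hXw⟩
      rw [nMinusMod, hlow]
      exact hX)
  rw [hpair]
  refine ip3_nonneg_of_dense (hdense.mono ?_) hl
  rintro _ ⟨x, rfl⟩
  refine ⟨_, _, lowerUnipotent_one_add_maskedMatrix _ _, lowerUnipotent_one_add_maskedMatrix _ _,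
    lowerUnipotent_one_add_maskedMatrix _ _, fun p hp => ?_, (orbitMap_eq_gact h x).symm⟩
  by_contra hn
  exact hp (if_neg hn)

end

/-- For `1 < a ≤ b ≤ c ≤ ab`, the Kronecker cone is exactly cut out
by the Ressayre inequalities. -/
theorem kronCone_eq_ressayre_inequalities (a b c : ℕ)
    (ha : 1 < a) (hab : a ≤ b) (hbc : b ≤ c) (hcab : c ≤ a * b) :
    KronCone a b c =
      { lam : (Fin a → ℝ) × (Fin b → ℝ) × (Fin c → ℝ) |
        Antitone lam.1 ∧ Antitone lam.2.1 ∧ Antitone lam.2.2 ∧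
        (∑ i, lam.1 i) = (∑ j, lam.2.1 j) ∧ (∑ i, lam.1 i) = (∑ k, lam.2.2 k) ∧
        ∀ (HA : Fin a → ℝ) (HB : Fin b → ℝ) (HC : Fin c → ℝ) (z : ℝ),
          IsRessayre HA HB HC z → 0 ≤ wtPair HA HB HC z lam } := by
  ext lam
  constructor
  · intro h
    obtain ⟨hanti, -⟩ := mem_kronCone_iff.1 h
    have hV := kronCone_subset_eqSum h
    exact ⟨hanti.1, hanti.2.1, hanti.2.2, hV.1, hV.2, fun HA HB HC z ⟨_, _, _, ψ, hψ, hm, hbij⟩ =>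
      wtPair_nonneg_of_tangentSurj hψ ⟨hm, hbij.2⟩ h⟩
  · rintro ⟨h1, h2, h3, h4, h5, hR⟩
    exact mem_kronCone_of_ressayre ha hab hbc hcab ⟨h1, h2, h3⟩ ⟨h4, h5⟩ hR

end
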